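/- arXiv:1409.0464 — 5 statements merged into one kernel-verified Lean document; each statement's English description precedes it below -/
import Mathlib

section
/- Let p be an odd prime, q = p, r ≥ 2, μ ∈ ℤ^r with all μ_i ≥ 1, and let t = (d₁,…,d_{2r−1}) ∈ ℤ_{≥0}^{2r−1} satisfy the divisibility conditions d_{j+1} ≤ m_{j+1} + d_j and d_{j+1} + d_{2r−j} ≤ m_{j+1} + d_j + d_{2r−j−1} for 1 ≤ j ≤ r−2, and 2d_{r+1} ≤ m_r + 2d_{r−1}, where m_i = μ_i − 1. If t does not lie in CQ₁(μ), then the exponential sum G(t) equals 0. -/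
open Finset
open scoped Classical

noncomputable section

namespace Stmt2

/-- `ψ(x) = e^{2πix}`. -/
def psi (y : ℚ) : ℂ := Complex.exp (2 * (Real.pi : ℂ) * Complex.I * (y : ℂ))

/-- The moduli exponents `L₁,…,L_{2r−1}`:
`Lᵢ = d₁+⋯+dᵢ` for `i ≤ r−1`; `L_r = d_r + 2(d₁+⋯+d_{r−1})`;
`L_{r+i'} = d_r − d_{i'−1} + (d_{r+1}+⋯+d_{r+i'}) + (d₁+⋯+d_{r−1})` for `1 ≤ i' ≤ r−1`
(with `d₀ = 0`). -/
def Lf (r : ℕ) (d : ℕ → ℕ) (i : ℕ) : ℕ :=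
  if i ≤ r - 1 then ∑ j ∈ Finset.Icc 1 i, d j
  else if i = r then d r + 2 * ∑ j ∈ Finset.Icc 1 (r - 1), d j
  else (d r + (∑ j ∈ Finset.Icc (r + 1) i, d j) + ∑ j ∈ Finset.Icc 1 (r - 1), d j)
        - d (i - r - 1)

/-- Extension of a `Fin (2r−1)`-tuple of residues to a 1-based function. -/
def cext (r : ℕ) (c : Fin (2 * r - 1) → ℕ) (j : ℕ) : ℕ :=
  if h : 1 ≤ j ∧ j ≤ 2 * r - 1 then c ⟨j - 1, by omega⟩ else 0

/-- `uⱼ`: the inverse of `cⱼ` modulo `p^{Lⱼ}`, taken in `[0, p^{Lⱼ})`, when `dⱼ > 0`;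
`uⱼ = 0` when `dⱼ = 0`. -/
def uinv (p r : ℕ) (d : ℕ → ℕ) (c : Fin (2 * r - 1) → ℕ) (j : ℕ) : ℕ :=
  if d j = 0 then 0 else ((cext r c j : ZMod (p ^ Lf r d j))⁻¹).val

/-- The rational number whose exponential is summed in `G(t)`. -/
def expArg (p r : ℕ) (μ d : ℕ → ℕ) (c : Fin (2 * r - 1) → ℕ) : ℚ :=
  (p : ℚ) ^ (μ 1 - 1) * (cext r c 1 : ℚ) / (p : ℚ) ^ d 1
  + (∑ i ∈ Finset.Icc 1 (r - 2),
      (p : ℚ) ^ (μ (i + 1) - 1) *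
        ((uinv p r d c i : ℚ) * (cext r c (i + 1) : ℚ) / (p : ℚ) ^ d (i + 1)
          - (p : ℚ) ^ d i * (cext r c (2 * r - i) : ℚ) * (uinv p r d c (2 * r - i - 1) : ℚ)
              / (p : ℚ) ^ (d (i + 1) + d (2 * r - i))))
  + (p : ℚ) ^ (μ r - 1) *
      ((uinv p r d c (r - 1) : ℚ) ^ 2 * (cext r c r : ℚ) / (p : ℚ) ^ d r
        + 2 * (p : ℚ) ^ d (r - 1) * (uinv p r d c (r - 1) : ℚ) * (cext r c (r + 1) : ℚ)
            / (p : ℚ) ^ (d (r + 1) + d r)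
        + (p : ℚ) ^ (2 * d (r - 1)) * (cext r c (r + 1) : ℚ) ^ 2 * (uinv p r d c r : ℚ)
            / (p : ℚ) ^ (2 * d (r + 1) + d r))

/-- The exponential sum `G(t)`. -/
def Gexp (p r : ℕ) (μ d : ℕ → ℕ) : ℂ :=
  (∏ k ∈ Finset.Icc 1 (2 * r - 1), ((p : ℂ) ^ Lf r d k)⁻¹) *
    ∑ c ∈ (Fintype.piFinset fun j : Fin (2 * r - 1) =>
              Finset.range (p ^ Lf r d (j.val + 1))).filter
            (fun c => ∀ j : Fin (2 * r - 1), 0 < d (j.val + 1) → Nat.Coprime (c j) p),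
      psi (expArg p r μ d c)

/-- Membership in `CQ₁(μ)`: `dᵢ ≤ μᵢ` for `1 ≤ i ≤ r−1`, and
`d_{2r−i} ≤ μ_{i+1} + dᵢ − d_{i+1}` for `1 ≤ i ≤ r−2`. -/
def MemCQ1 (r : ℕ) (μ d : ℕ → ℕ) : Prop :=
  (∀ i, 1 ≤ i → i ≤ r - 1 → d i ≤ μ i) ∧
    ∀ i, 1 ≤ i → i ≤ r - 2 →
      (d (2 * r - i) : ℤ) ≤ (μ (i + 1) : ℤ) + (d i : ℤ) - (d (i + 1) : ℤ)

/-- The divisibility conditions: `d_{j+1} ≤ m_{j+1} + d_j` and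
`d_{j+1} + d_{2r−j} ≤ m_{j+1} + d_j + d_{2r−j−1}` for `1 ≤ j ≤ r−2`, and
`2d_{r+1} ≤ m_r + 2d_{r−1}`, where `mᵢ = μᵢ − 1`. -/
def Divis (r : ℕ) (μ d : ℕ → ℕ) : Prop :=
  (∀ j, 1 ≤ j → j ≤ r - 2 → d (j + 1) ≤ (μ (j + 1) - 1) + d j) ∧
  (∀ j, 1 ≤ j → j ≤ r - 2 →
      d (j + 1) + d (2 * r - j) ≤ (μ (j + 1) - 1) + d j + d (2 * r - j - 1)) ∧
  2 * d (r + 1) ≤ (μ r - 1) + 2 * d (r - 1)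

theorem psi_add (x y : ℚ) : psi (x + y) = psi x * psi y := by
  unfold psi
  rw [← Complex.exp_add]
  push_cast
  ring_nf

theorem psi_eq_one_iff (x : ℚ) : psi x = 1 ↔ x ∈ (Int.castAddHom ℚ).range := by
  unfold psi
  rw [Complex.exp_eq_one_iff]
  have h0 := Complex.two_pi_I_ne_zero
  constructor
  · rintro ⟨n, hn⟩
    refine ⟨n, ?_⟩
    have h1 : (x : ℂ) = n := mul_left_cancel₀ h0 (by rw [hn]; ring)
    have h2 : x = n := by exact_mod_cast h1
    simp [h2]
  · rintro ⟨n, rfl⟩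
    refine ⟨n, ?_⟩
    simp
    ring

theorem psi_eq_mul_of_sub_mem {x y z : ℚ} (h : x - y - z ∈ (Int.castAddHom ℚ).range) :
    psi x = psi z * psi y := by
  have hx : x = (x - y - z) + (z + y) := by ring
  rw [hx, psi_add, (psi_eq_one_iff _).2 h, psi_add, one_mul]

/-- A sum vanishes if a permutation of the summation set multiplies the summand by a nontrivial
factor that is constant along orbits. -/
theorem sum_eq_zero_of_twist {ι : Type*} (S : Finset ι) (f ζ : ι → ℂ) (φ : ι → ι)
    (hmaps : ∀ c ∈ S, φ c ∈ S) (hinj : Set.InjOn φ S)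
    (hf : ∀ c ∈ S, f (φ c) = ζ c * f c) (hζ : ∀ c ∈ S, ζ (φ c) = ζ c)
    (hne : ∀ c ∈ S, ζ c ≠ 1) : ∑ c ∈ S, f c = 0 := by
  have himage : S.image φ = S :=
    Finset.eq_of_subset_of_card_le (Finset.image_subset_iff.2 hmaps)
      (by rw [Finset.card_image_of_injOn hinj])
  have hshift : ∑ c ∈ S, f (φ c) / (ζ (φ c) - 1) = ∑ c ∈ S, f c / (ζ c - 1) := by
    rw [← Finset.sum_image (f := fun c => f c / (ζ c - 1)) hinj, himage]
  rw [← sub_eq_zero, ← Finset.sum_sub_distrib] at hshift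
  rw [← hshift]
  refine Finset.sum_congr rfl fun c hc => ?_
  have h1 : ζ c - 1 ≠ 0 := sub_ne_zero.2 (hne c hc)
  rw [hf c hc, hζ c hc]
  field_simp

theorem frac_sub_mem_of_modEq {p X Y s A B : ℕ} (hp : p ≠ 0) (h : X ≡ Y [MOD p ^ s])
    (hB : B ≤ A + s) :
    (p : ℚ) ^ A * X / (p : ℚ) ^ B - (p : ℚ) ^ A * Y / (p : ℚ) ^ B ∈ (Int.castAddHom ℚ).range := by
  obtain ⟨k, hk⟩ := Nat.modEq_iff_dvd.1 h.symm
  have hp0 : (p : ℚ) ≠ 0 := by exact_mod_cast hp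
  have hk' : (X : ℚ) - Y = (p : ℚ) ^ s * k := by exact_mod_cast hk
  refine ⟨(p : ℤ) ^ (A + s - B) * k, ?_⟩
  have hpow : (p : ℚ) ^ A * (p : ℚ) ^ s = (p : ℚ) ^ (A + s - B) * (p : ℚ) ^ B := by
    rw [← pow_add, ← pow_add]; congr 1; omega
  simp only [Int.coe_castAddHom]
  push_cast
  rw [← sub_div, ← mul_sub, hk', eq_div_iff (by positivity)]
  linear_combination (-(k : ℚ)) * hpow

theorem frac_sub_sub_mem_of_modEq {p X Y a s n A B : ℕ} (hp : p ≠ 0)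
    (h : X ≡ a * Y [MOD p ^ s]) (hn : 1 ≤ n) (ha : a ≡ 1 + p ^ (n - 1) [MOD p ^ n])
    (hs : B ≤ A + s) (hB : B = A + n) :
    (p : ℚ) ^ A * X / (p : ℚ) ^ B - (p : ℚ) ^ A * Y / (p : ℚ) ^ B - (Y : ℚ) / p
      ∈ (Int.castAddHom ℚ).range := by
  have h1 := frac_sub_mem_of_modEq (A := A) (B := B) hp h hs
  have h2 := frac_sub_mem_of_modEq (A := A) (B := B) hp (ha.mul_right Y) hB.le
  have hp0 : (p : ℚ) ≠ 0 := by exact_mod_cast hp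
  convert add_mem h1 h2 using 1
  have hY : (Y : ℚ) / p = (p : ℚ) ^ A * ((p : ℚ) ^ (n - 1) * Y) / (p : ℚ) ^ B := by
    obtain ⟨k, rfl⟩ : ∃ k, n = k + 1 := ⟨n - 1, by omega⟩
    subst hB
    rw [Nat.add_sub_cancel, div_eq_div_iff hp0 (by positivity)]
    ring
  rw [hY]
  push_cast
  ring

theorem le_Lf_of_lt {r : ℕ} (d : ℕ → ℕ) {j : ℕ} (h1 : 1 ≤ j) (hj : j ≤ r - 1) :
    d j ≤ Lf r d j := by
  rw [Lf, if_pos hj]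
  exact Finset.single_le_sum (f := d) (fun _ _ => Nat.zero_le _) (by simp; omega)

theorem le_Lf_last {r : ℕ} (d : ℕ → ℕ) {j : ℕ} (h1 : 1 ≤ j) (hj : j ≤ r - 1) :
    d j ≤ Lf r d (r - 1) := by
  rw [Lf, if_pos le_rfl]
  exact Finset.single_le_sum (f := d) (fun _ _ => Nat.zero_le _) (by simp; omega)

theorem le_Lf_mid {r : ℕ} (hr : 2 ≤ r) (d : ℕ → ℕ) : d r ≤ Lf r d r := by
  rw [Lf, if_neg (by omega), if_pos rfl]
  omega

theorem add_le_Lf_of_gt {r : ℕ} (hr : 2 ≤ r) {d : ℕ → ℕ} (hd0 : d 0 = 0) {j : ℕ} (hj : r < j)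
    (hj' : j ≤ 2 * r - 1) : d j + d r ≤ Lf r d j := by
  rw [Lf, if_neg (by omega), if_neg (by omega)]
  have h1 : d j ≤ ∑ k ∈ Finset.Icc (r + 1) j, d k :=
    Finset.single_le_sum (f := d) (fun _ _ => Nat.zero_le _) (by simp; omega)
  have h2 : d (j - r - 1) ≤ ∑ k ∈ Finset.Icc 1 (r - 1), d k := by
    rcases Nat.eq_zero_or_pos (j - r - 1) with h | h
    · rw [h, hd0]; exact Nat.zero_le _
    · exact Finset.single_le_sum (f := d) (fun _ _ => Nat.zero_le _) (by simp; omega)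
  omega

theorem le_Lf {r : ℕ} (hr : 2 ≤ r) {d : ℕ → ℕ} (hd0 : d 0 = 0) {j : ℕ} (h1 : 1 ≤ j)
    (hj : j ≤ 2 * r - 1) : d j ≤ Lf r d j := by
  rcases lt_trichotomy j r with h | rfl | h
  · exact le_Lf_of_lt d h1 (by omega)
  · exact le_Lf_mid hr d
  · have := add_le_Lf_of_gt hr hd0 h hj
    omega

theorem zmod_inv_val_mul_modEq {p x : ℕ} [NeZero p] (L : ℕ) (hx : Nat.Coprime x p) :
    ((x : ZMod (p ^ L))⁻¹).val * x ≡ 1 [MOD p ^ L] := by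
  rw [← ZMod.natCast_eq_natCast_iff]
  push_cast
  rw [ZMod.natCast_val, ZMod.cast_id', id, mul_comm, ZMod.coe_mul_inv_eq_one _ (hx.pow_right L)]

/-- The residues whose index has positive exponent are prime to `p`. -/
def Admissible (p r : ℕ) (d : ℕ → ℕ) (c : Fin (2 * r - 1) → ℕ) : Prop :=
  ∀ j, 1 ≤ j → j ≤ 2 * r - 1 → 0 < d j → Nat.Coprime (cext r c j) p

/-- `c'` is obtained from `c` by multiplying the `j`-th residue by `a ^ e j`. -/
def IsTwist (p r : ℕ) (d e : ℕ → ℕ) (a : ℕ) (c c' : Fin (2 * r - 1) → ℕ) : Prop :=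
  ∀ j, 1 ≤ j → j ≤ 2 * r - 1 → cext r c' j ≡ a ^ e j * cext r c j [MOD p ^ Lf r d j]

theorem uinv_mul_modEq {p r : ℕ} [NeZero p] {d : ℕ → ℕ} {c : Fin (2 * r - 1) → ℕ}
    (hc : Admissible p r d c) {j : ℕ} (h1 : 1 ≤ j) (hj : j ≤ 2 * r - 1) (hdj : 0 < d j) :
    uinv p r d c j * cext r c j ≡ 1 [MOD p ^ Lf r d j] := by
  rw [uinv, if_neg hdj.ne']
  exact zmod_inv_val_mul_modEq _ (hc j h1 hj hdj)

theorem IsTwist.uinv_modEq {p r a : ℕ} [NeZero p] {d e : ℕ → ℕ} {c c' : Fin (2 * r - 1) → ℕ}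
    (ht : IsTwist p r d e a c c') (hc : Admissible p r d c) (hc' : Admissible p r d c')
    {j : ℕ} (h1 : 1 ≤ j) (hj : j ≤ 2 * r - 1) :
    a ^ e j * uinv p r d c' j ≡ uinv p r d c j [MOD p ^ Lf r d j] := by
  rcases Nat.eq_zero_or_pos (d j) with h0 | hpos
  · simp [uinv, h0, Nat.ModEq]
  · have hu := uinv_mul_modEq hc h1 hj hpos
    have hu' := uinv_mul_modEq hc' h1 hj hpos
    have hcc := ht j h1 hj
    rw [← ZMod.natCast_eq_natCast_iff] at *
    push_cast at *
    linear_combination (-(a : ZMod (p ^ Lf r d j)) ^ e j * uinv p r d c' j) * hu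
      + (uinv p r d c j : ZMod (p ^ Lf r d j)) * hu'
      - (uinv p r d c' j * uinv p r d c j : ZMod (p ^ Lf r d j)) * hcc

theorem IsTwist.uinv_mul_cext_modEq {p r a : ℕ} [NeZero p] {d e : ℕ → ℕ} {c c' : Fin (2 * r - 1) → ℕ}
    (ht : IsTwist p r d e a c c') (hc : Admissible p r d c) (hc' : Admissible p r d c')
    {j k s : ℕ} (hj1 : 1 ≤ j) (hj : j ≤ 2 * r - 1) (hk1 : 1 ≤ k) (hk : k ≤ 2 * r - 1)
    (hsj : s ≤ Lf r d j) (hsk : s ≤ Lf r d k) (hjk : e j ≤ e k) :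
    uinv p r d c' j * cext r c' k ≡ a ^ (e k - e j) * (uinv p r d c j * cext r c k)
      [MOD p ^ s] := by
  have h1 := (ht.uinv_modEq hc hc' hj1 hj).of_dvd (pow_dvd_pow p hsj)
  have h2 := (ht k hk1 hk).of_dvd (pow_dvd_pow p hsk)
  have hpow : a ^ e k = a ^ (e k - e j) * a ^ e j := by
    rw [← pow_add, Nat.sub_add_cancel hjk]
  calc uinv p r d c' j * cext r c' k
      ≡ uinv p r d c' j * (a ^ e k * cext r c k) [MOD p ^ s] := h2.mul_left _
    _ = (a ^ e j * uinv p r d c' j) * (a ^ (e k - e j) * cext r c k) := by rw [hpow]; ring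
    _ ≡ uinv p r d c j * (a ^ (e k - e j) * cext r c k) [MOD p ^ s] := h1.mul_right _
    _ = a ^ (e k - e j) * (uinv p r d c j * cext r c k) := by ring

theorem IsTwist.expArg_sub_mem {p r a : ℕ} [NeZero p] (hr : 2 ≤ r) {μ d e : ℕ → ℕ}
    (hd0 : d 0 = 0) (hdiv : 2 * d (r + 1) ≤ (μ r - 1) + 2 * d (r - 1))
    {c c' : Fin (2 * r - 1) → ℕ} (ht : IsTwist p r d e a c c')
    (hc : Admissible p r d c) (hc' : Admissible p r d c')
    (her : e r = 2 * e (r - 1)) (her' : e (r + 1) = e (r - 1))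
    (hu : a ^ e (r - 1) * uinv p r d c' (r - 1) ≡ uinv p r d c (r - 1)
      [MOD p ^ (d (r + 1) + d r)])
    {δ₀ : ℚ} {δ ε : ℕ → ℚ}
    (h0 : (p : ℚ) ^ (μ 1 - 1) * (cext r c' 1 : ℚ) / (p : ℚ) ^ d 1
      - (p : ℚ) ^ (μ 1 - 1) * (cext r c 1 : ℚ) / (p : ℚ) ^ d 1 - δ₀ ∈ (Int.castAddHom ℚ).range)
    (hA : ∀ i ∈ Finset.Icc 1 (r - 2),
      (p : ℚ) ^ (μ (i + 1) - 1) * ((uinv p r d c' i * cext r c' (i + 1) : ℕ) : ℚ)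
          / (p : ℚ) ^ d (i + 1)
        - (p : ℚ) ^ (μ (i + 1) - 1) * ((uinv p r d c i * cext r c (i + 1) : ℕ) : ℚ)
          / (p : ℚ) ^ d (i + 1) - δ i ∈ (Int.castAddHom ℚ).range)
    (hB : ∀ i ∈ Finset.Icc 1 (r - 2),
      (p : ℚ) ^ (μ (i + 1) - 1 + d i)
          * ((uinv p r d c' (2 * r - i - 1) * cext r c' (2 * r - i) : ℕ) : ℚ)
          / (p : ℚ) ^ (d (i + 1) + d (2 * r - i))
        - (p : ℚ) ^ (μ (i + 1) - 1 + d i)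
          * ((uinv p r d c (2 * r - i - 1) * cext r c (2 * r - i) : ℕ) : ℚ)
          / (p : ℚ) ^ (d (i + 1) + d (2 * r - i)) - ε i ∈ (Int.castAddHom ℚ).range) :
    expArg p r μ d c' - expArg p r μ d c
      - (δ₀ + ∑ i ∈ Finset.Icc 1 (r - 2), (δ i - ε i)) ∈ (Int.castAddHom ℚ).range := by
  have hp : p ≠ 0 := NeZero.ne p
  have hsum := sum_mem (fun i hi => sub_mem (hA i hi) (hB i hi))
  have hcr := (ht r (by omega) (by omega)).of_dvd (pow_dvd_pow p (le_Lf_mid hr d))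
  have hcr1 := (ht (r + 1) (by omega) (by omega)).of_dvd
    (pow_dvd_pow p (add_le_Lf_of_gt hr hd0 (Nat.lt_succ_self r) (by omega)))
  have hur := (ht.uinv_modEq hc hc' (j := r) (by omega) (by omega)).of_dvd
    (pow_dvd_pow p (le_Lf_mid hr d))
  rw [her] at hcr hur
  rw [her'] at hcr1
  have hdvd : p ^ d r ∣ p ^ (d (r + 1) + d r) := pow_dvd_pow p (by omega)
  have hu1 := hu.of_dvd hdvd
  have hcr2 := hcr1.of_dvd hdvd
  have m1 : uinv p r d c' (r - 1) ^ 2 * cext r c' r ≡ uinv p r d c (r - 1) ^ 2 * cext r c r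
      [MOD p ^ d r] :=
    calc uinv p r d c' (r - 1) ^ 2 * cext r c' r
        ≡ uinv p r d c' (r - 1) ^ 2 * (a ^ (2 * e (r - 1)) * cext r c r) [MOD p ^ d r] :=
          hcr.mul_left _
      _ = (a ^ e (r - 1) * uinv p r d c' (r - 1)) ^ 2 * cext r c r := by ring
      _ ≡ uinv p r d c (r - 1) ^ 2 * cext r c r [MOD p ^ d r] := (hu1.pow 2).mul_right _
  have m2 : 2 * uinv p r d c' (r - 1) * cext r c' (r + 1)
      ≡ 2 * uinv p r d c (r - 1) * cext r c (r + 1) [MOD p ^ (d (r + 1) + d r)] :=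
    calc 2 * uinv p r d c' (r - 1) * cext r c' (r + 1)
        ≡ 2 * uinv p r d c' (r - 1) * (a ^ e (r - 1) * cext r c (r + 1))
          [MOD p ^ (d (r + 1) + d r)] := hcr1.mul_left _
      _ = 2 * (a ^ e (r - 1) * uinv p r d c' (r - 1)) * cext r c (r + 1) := by ring
      _ ≡ 2 * uinv p r d c (r - 1) * cext r c (r + 1) [MOD p ^ (d (r + 1) + d r)] :=
          (hu.mul_left 2).mul_right _
  have m3 : cext r c' (r + 1) ^ 2 * uinv p r d c' r ≡ cext r c (r + 1) ^ 2 * uinv p r d c r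
      [MOD p ^ d r] :=
    calc cext r c' (r + 1) ^ 2 * uinv p r d c' r
        ≡ (a ^ e (r - 1) * cext r c (r + 1)) ^ 2 * uinv p r d c' r [MOD p ^ d r] :=
          (hcr2.pow 2).mul_right _
      _ = cext r c (r + 1) ^ 2 * (a ^ (2 * e (r - 1)) * uinv p r d c' r) := by ring
      _ ≡ cext r c (r + 1) ^ 2 * uinv p r d c r [MOD p ^ d r] := hur.mul_left _
  have r1 := frac_sub_mem_of_modEq (A := μ r - 1) (B := d r) hp m1 (by omega)
  have r2 := frac_sub_mem_of_modEq (A := μ r - 1 + d (r - 1)) (B := d (r + 1) + d r) hp m2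
    (by omega)
  have r3 := frac_sub_mem_of_modEq (A := μ r - 1 + 2 * d (r - 1)) (B := 2 * d (r + 1) + d r) hp m3
    (by omega)
  convert add_mem (add_mem h0 hsum) (add_mem (add_mem r1 r2) r3) using 1
  simp only [expArg, Finset.sum_sub_distrib, mul_sub, pow_add _ (μ _ - 1), Nat.cast_mul,
    Nat.cast_pow, Nat.cast_ofNat, mul_add, mul_div_assoc, mul_assoc, mul_left_comm, mul_comm]
  ring

/-- Multiplication of the `j`-th residue by the `e j`-th power of a factor that depends only on the
residue of index `r - 1`. -/
def twist (p r : ℕ) (d e α : ℕ → ℕ) (c : Fin (2 * r - 1) → ℕ) : Fin (2 * r - 1) → ℕ :=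
  fun j => α (cext r c (r - 1)) ^ e (j.val + 1) * c j % p ^ Lf r d (j.val + 1)

theorem cext_succ {r : ℕ} (c : Fin (2 * r - 1) → ℕ) (j : Fin (2 * r - 1)) :
    cext r c (j.val + 1) = c j := by
  have := j.isLt
  rw [cext, dif_pos (by omega)]
  rfl

theorem cext_twist (p : ℕ) {r : ℕ} (d e α : ℕ → ℕ) (c : Fin (2 * r - 1) → ℕ) {j : ℕ} (h1 : 1 ≤ j)
    (hj : j ≤ 2 * r - 1) :
    cext r (twist p r d e α c) j
      = α (cext r c (r - 1)) ^ e j * cext r c j % p ^ Lf r d j := by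
  obtain ⟨k, rfl⟩ : ∃ k, j = k + 1 := ⟨j - 1, by omega⟩
  have h := cext_succ (twist p r d e α c) ⟨k, by omega⟩
  have h' := cext_succ c ⟨k, by omega⟩
  simp only at h h'
  rw [h, h', twist]

theorem isTwist_twist (p r : ℕ) (d e α : ℕ → ℕ) (c : Fin (2 * r - 1) → ℕ) :
    IsTwist p r d e (α (cext r c (r - 1))) c (twist p r d e α c) := fun j h1 hj => by
  rw [cext_twist p d e α c h1 hj]
  exact Nat.mod_modEq _ _

theorem modEq_one_of_modEq_one_add {p a n : ℕ} (hn : 2 ≤ n)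
    (ha : a ≡ 1 + p ^ (n - 1) [MOD p ^ n]) : a ≡ 1 [MOD p] :=
  (ha.of_dvd (dvd_pow_self p (by omega))).trans ((Nat.ModEq.refl 1).add
    (Nat.modEq_zero_iff_dvd.2 (dvd_pow_self p (by omega : n - 1 ≠ 0))))

theorem coprime_of_modEq_one_add {p a n : ℕ} (hn : 2 ≤ n)
    (ha : a ≡ 1 + p ^ (n - 1) [MOD p ^ n]) : Nat.Coprime a p := by
  rw [Nat.Coprime, (modEq_one_of_modEq_one_add hn ha).gcd_eq, Nat.gcd_one_left]

theorem admissible_twist {p r : ℕ} (hr : 2 ≤ r) {d e α : ℕ → ℕ} (hd0 : d 0 = 0)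
    {c : Fin (2 * r - 1) → ℕ} (hc : Admissible p r d c)
    (ha : Nat.Coprime (α (cext r c (r - 1))) p) : Admissible p r d (twist p r d e α c) := by
  intro j h1 hj hdj
  have hL := le_Lf hr hd0 h1 hj
  have h := (isTwist_twist p r d e α c j h1 hj).of_dvd (dvd_pow_self p (by omega))
  rw [Nat.Coprime, h.gcd_eq]
  exact Nat.Coprime.mul_left (ha.pow_left _) (hc j h1 hj hdj)

theorem Gexp_eq_zero_of_twist {p r n : ℕ} (hp : p.Prime) (hr : 2 ≤ r) (hn : 2 ≤ n)
    {μ d e α : ℕ → ℕ} (hd0 : d 0 = 0)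
    (hα : ∀ y, (0 < d (r - 1) → Nat.Coprime y p) → α y ≡ 1 + p ^ (n - 1) [MOD p ^ n])
    (hinj : ∀ y z, y < p ^ Lf r d (r - 1) → z < p ^ Lf r d (r - 1) →
      (0 < d (r - 1) → Nat.Coprime y p) → (0 < d (r - 1) → Nat.Coprime z p) →
      α y ^ e (r - 1) * y ≡ α z ^ e (r - 1) * z [MOD p ^ Lf r d (r - 1)] → α y = α z)
    (x : (Fin (2 * r - 1) → ℕ) → ℤ)
    (hx : ∀ c, Admissible p r d c →
      Admissible p r d (twist p r d e α c) →
      expArg p r μ d (twist p r d e α c) - expArg p r μ d c - x c / p ∈ (Int.castAddHom ℚ).range ∧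
        x (twist p r d e α c) ≡ x c [ZMOD p] ∧ ¬ (p : ℤ) ∣ x c) :
    Gexp p r μ d = 0 := by
  have hp0 : (p : ℚ) ≠ 0 := by exact_mod_cast hp.ne_zero
  have hmem : ∀ c : Fin (2 * r - 1) → ℕ,
      c ∈ (Fintype.piFinset fun j : Fin (2 * r - 1) =>
              Finset.range (p ^ Lf r d (j.val + 1))).filter
            (fun c => ∀ j : Fin (2 * r - 1), 0 < d (j.val + 1) → Nat.Coprime (c j) p) ↔
        (∀ j, c j < p ^ Lf r d (j.val + 1)) ∧ Admissible p r d c := by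
    intro c
    simp only [Finset.mem_filter, Fintype.mem_piFinset, Finset.mem_range]
    refine and_congr_right fun _ => ⟨fun h j h1 hj hdj => ?_, fun h j hdj => ?_⟩
    · obtain ⟨k, rfl⟩ : ∃ k, j = k + 1 := ⟨j - 1, by omega⟩
      have h' := cext_succ c ⟨k, by omega⟩
      simp only at h'
      rw [h']
      exact h ⟨k, by omega⟩ hdj
    · rw [← cext_succ c j]
      have := j.isLt
      exact h _ (by omega) (by omega) hdj
  have hval : ∀ c, Admissible p r d c → (0 < d (r - 1) → Nat.Coprime (cext r c (r - 1)) p) :=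
    fun c hc => hc (r - 1) (by omega) (by omega)
  have hcop : ∀ c, Admissible p r d c → Nat.Coprime (α (cext r c (r - 1))) p :=
    fun c hc => coprime_of_modEq_one_add hn (hα _ (hval c hc))
  have hadm : ∀ c, Admissible p r d c → Admissible p r d (twist p r d e α c) :=
    fun c hc => admissible_twist hr hd0 hc (hcop c hc)
  have hlt : ∀ c : Fin (2 * r - 1) → ℕ, (∀ j, c j < p ^ Lf r d (j.val + 1)) →
      cext r c (r - 1) < p ^ Lf r d (r - 1) := by
    intro c hc
    obtain ⟨k, rfl⟩ : ∃ k, r = k + 2 := ⟨r - 2, by omega⟩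
    have h' := cext_succ c ⟨k, by omega⟩
    simp only at h'
    exact lt_of_eq_of_lt h' (hc ⟨k, by omega⟩)
  rw [Gexp]
  refine mul_eq_zero_of_right _ (sum_eq_zero_of_twist _ _ (fun c => psi (x c / p))
    (twist p r d e α) ?_ ?_ ?_ ?_ ?_)
  · intro c hc
    rw [hmem] at hc ⊢
    exact ⟨fun j => Nat.mod_lt _ (pow_pos hp.pos _), hadm c hc.2⟩
  · intro c hc c₁ hc₁ heq
    rw [Finset.mem_coe, hmem] at hc hc₁
    have hα_eq : α (cext r c (r - 1)) = α (cext r c₁ (r - 1)) := by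
      refine hinj _ _ (hlt c hc.1) (hlt c₁ hc₁.1) (hval c hc.2) (hval c₁ hc₁.2) ?_
      have h : cext r (twist p r d e α c) (r - 1) = cext r (twist p r d e α c₁) (r - 1) := by
        rw [heq]
      rwa [cext_twist p d e α _ (by omega) (by omega),
        cext_twist p d e α _ (by omega) (by omega)] at h
    funext j
    have h : α (cext r c (r - 1)) ^ e (j.val + 1) * c j
        ≡ α (cext r c₁ (r - 1)) ^ e (j.val + 1) * c₁ j [MOD p ^ Lf r d (j.val + 1)] :=
      congrFun heq j
    rw [← hα_eq] at h
    refine Nat.ModEq.eq_of_lt_of_lt (Nat.ModEq.cancel_left_of_coprime ?_ h) (hc.1 j) (hc₁.1 j)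
    exact Nat.Coprime.pow _ _ (hcop c hc.2).symm
  · intro c hc
    rw [hmem] at hc
    exact psi_eq_mul_of_sub_mem (hx c hc.2 (hadm c hc.2)).1
  · intro c hc
    rw [hmem] at hc
    obtain ⟨k, hk⟩ := (hx c hc.2 (hadm c hc.2)).2.1.symm.dvd
    have hk' : (x (twist p r d e α c) : ℚ) - x c = p * k := by exact_mod_cast hk
    have h := psi_eq_mul_of_sub_mem (x := (x (twist p r d e α c) : ℚ) / p) (y := x c / p) (z := 0)
      ⟨k, by rw [sub_zero, ← sub_div, hk', mul_div_cancel_left₀ _ hp0]; rfl⟩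
    simpa [psi] using h
  · intro c hc
    rw [hmem] at hc
    rw [Ne, psi_eq_one_iff]
    rintro ⟨k, hk⟩
    refine (hx c hc.2 (hadm c hc.2)).2.2 ⟨k, ?_⟩
    simp only [Int.coe_castAddHom] at hk
    rw [eq_div_iff hp0] at hk
    have : (x c : ℚ) = p * k := by rw [← hk]; ring
    exact_mod_cast this

theorem exists_factor {p n S N y : ℕ} [NeZero p] (hn : 2 ≤ n) (hnS : n ≤ S) (hSN : S ≤ N)
    (hy : Nat.Coprime y p) :
    ∃ a, a ≡ 1 + p ^ (n - 1) [MOD p ^ S] ∧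
      a * ((((1 + p ^ (n - 1)) * y : ℕ) : ZMod (p ^ S))⁻¹).val ≡ ((y : ZMod (p ^ S))⁻¹).val
        [MOD p ^ N] := by
  set b := 1 + p ^ (n - 1) with hb
  set u := ((y : ZMod (p ^ S))⁻¹).val with hu
  set v := (((b * y : ℕ) : ZMod (p ^ S))⁻¹).val with hv
  have hbp : Nat.Coprime b p := coprime_of_modEq_one_add hn (Nat.ModEq.refl _)
  have hu1 : u * y ≡ 1 [MOD p ^ S] := zmod_inv_val_mul_modEq S hy
  have hv1 : v * (b * y) ≡ 1 [MOD p ^ S] := zmod_inv_val_mul_modEq S (hbp.mul_left hy)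
  have hvp : Nat.Coprime v p := by
    have h := hv1.of_dvd (dvd_pow_self p (by omega))
    refine Nat.Coprime.coprime_dvd_left (dvd_mul_right v (b * y)) ?_
    rw [Nat.Coprime, h.gcd_eq, Nat.gcd_one_left]
  have hw := zmod_inv_val_mul_modEq N hvp
  set w := ((v : ZMod (p ^ N))⁻¹).val
  have hwS := hw.of_dvd (pow_dvd_pow p hSN)
  refine ⟨u * w, ?_, ?_⟩
  · rw [← ZMod.natCast_eq_natCast_iff] at hu1 hv1 hwS ⊢
    push_cast at hu1 hv1 hwS ⊢
    linear_combination (-(u * w : ZMod (p ^ S))) * hv1 + (u * b * y : ZMod (p ^ S)) * hwS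
      + (b : ZMod (p ^ S)) * hu1
  · simpa [mul_assoc] using hw.mul_left u

theorem exists_factor_function {p n : ℕ} [NeZero p] (hn : 2 ≤ n) {S N D : ℕ}
    (hnS : n ≤ S) (hSN : S ≤ N) :
    ∃ α : ℕ → ℕ, (∀ y, (0 < D → Nat.Coprime y p) → α y ≡ 1 + p ^ (n - 1) [MOD p ^ n]) ∧
      (∀ y z, y < p ^ S → z < p ^ S → (0 < D → Nat.Coprime y p) → (0 < D → Nat.Coprime z p) →
        α y * y ≡ α z * z [MOD p ^ S] → α y = α z) ∧
      ∀ y, (0 < D → Nat.Coprime y p) → 0 < D →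
        α y * (((α y * y : ℕ) : ZMod (p ^ S))⁻¹).val ≡ ((y : ZMod (p ^ S))⁻¹).val
          [MOD p ^ N] := by
  rcases Nat.eq_zero_or_pos D with rfl | hD
  · exact ⟨fun _ => 1 + p ^ (n - 1), fun _ _ => Nat.ModEq.refl _, fun _ _ _ _ _ _ _ => rfl,
      fun _ _ h => absurd h (lt_irrefl 0)⟩
  have h : ∀ y, ∃ a, Nat.Coprime y p → a ≡ 1 + p ^ (n - 1) [MOD p ^ S] ∧
      a * ((((1 + p ^ (n - 1)) * y : ℕ) : ZMod (p ^ S))⁻¹).val ≡ ((y : ZMod (p ^ S))⁻¹).val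
        [MOD p ^ N] := by
    intro y
    by_cases hy : Nat.Coprime y p
    · obtain ⟨a, ha⟩ := exists_factor hn hnS hSN hy
      exact ⟨a, fun _ => ha⟩
    · exact ⟨0, fun h => absurd h hy⟩
  choose α hα using h
  refine ⟨α, fun y hy => (hα y (hy hD)).1.of_dvd (pow_dvd_pow p hnS), ?_, ?_⟩
  · intro y z hyS hzS hy hz hyz
    have h1 := (((hα y (hy hD)).1.mul_right y).symm.trans hyz).trans
      ((hα z (hz hD)).1.mul_right z)
    have hb : Nat.Coprime (1 + p ^ (n - 1)) p := coprime_of_modEq_one_add hn (Nat.ModEq.refl _)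
    rw [Nat.ModEq.eq_of_lt_of_lt
      (Nat.ModEq.cancel_left_of_coprime (Nat.Coprime.pow_left S hb.symm) h1) hyS hzS]
  · intro y hy _
    have h1 := (ZMod.natCast_eq_natCast_iff _ _ _).2 ((hα y (hy hD)).1.mul_right y)
    rw [h1]
    exact (hα y (hy hD)).2

theorem coprime_uinv {p r : ℕ} [NeZero p] {d : ℕ → ℕ} {c : Fin (2 * r - 1) → ℕ}
    (hc : Admissible p r d c) {j : ℕ} (h1 : 1 ≤ j) (hj : j ≤ 2 * r - 1) (hdj : 0 < d j)
    (hL : d j ≤ Lf r d j) : Nat.Coprime (uinv p r d c j) p := by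
  have h := (uinv_mul_modEq hc h1 hj hdj).of_dvd (dvd_pow_self p (by omega))
  refine Nat.Coprime.coprime_dvd_left (dvd_mul_right _ (cext r c j)) ?_
  rw [Nat.Coprime, h.gcd_eq, Nat.gcd_one_left]

/-- Exponents of the twist detecting `d k ≤ μ k`. -/
def lowerExponent (r k j : ℕ) : ℕ := if j < k then 0 else if j = r then 2 else 1

/-- Exponents of the twist detecting `d (k + 1) + d (2r - k) ≤ μ (k + 1) + d k`. -/
def upperExponent (r k j : ℕ) : ℕ := if j < 2 * r - k then 0 else 1

theorem Gexp_eq_zero_of_lt {p r : ℕ} (hp : p.Prime) (hr : 2 ≤ r) {μ d : ℕ → ℕ}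
    (hμ : ∀ i, 1 ≤ i → i ≤ r → 1 ≤ μ i) (hd0 : d 0 = 0) (hdiv : Divis r μ d) {k : ℕ}
    (hk1 : 1 ≤ k) (hk : k ≤ r - 1) (hlt : μ k < d k) : Gexp p r μ d = 0 := by
  have : NeZero p := ⟨hp.ne_zero⟩
  obtain ⟨hdivA, hdivB, hdivR⟩ := hdiv
  have hμk := hμ k hk1 (by omega)
  obtain ⟨n, hn⟩ : ∃ n, d k = μ k - 1 + n := ⟨d k - (μ k - 1), by omega⟩
  have hn2 : 2 ≤ n := by omega
  have hLk := le_Lf_last d hk1 hk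
  obtain ⟨α, hα, hinj, hfac⟩ := exists_factor_function (p := p) hn2 (S := Lf r d (r - 1))
    (N := Lf r d (r - 1) + (d (r + 1) + d r)) (D := d (r - 1)) (by omega) (by omega)
  have he : lowerExponent r k (r - 1) = 1 := by
    rw [lowerExponent, if_neg (by omega), if_neg (by omega)]
  refine Gexp_eq_zero_of_twist (e := lowerExponent r k) (α := α) hp hr hn2 hd0 hα
    (by simpa only [he, pow_one] using hinj)
    (fun c => if k = 1 then (cext r c 1 : ℤ)
      else ((uinv p r d c (k - 1) * cext r c k : ℕ) : ℤ)) ?_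
  intro c hc hc'
  have ht := isTwist_twist p r d (lowerExponent r k) α c
  have ha := hα _ (hc (r - 1) (by omega) (by omega))
  have hu : α (cext r c (r - 1)) ^ lowerExponent r k (r - 1)
        * uinv p r d (twist p r d (lowerExponent r k) α c) (r - 1)
      ≡ uinv p r d c (r - 1) [MOD p ^ (d (r + 1) + d r)] := by
    rcases Nat.eq_zero_or_pos (d (r - 1)) with h0 | hpos
    · simp [uinv, h0, Nat.ModEq]
    · have h := (hfac _ (hc (r - 1) (by omega) (by omega)) hpos).of_dvd
        (pow_dvd_pow p (Nat.le_add_left (d (r + 1) + d r) _))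
      rw [uinv, uinv, if_neg hpos.ne', if_neg hpos.ne',
        cext_twist p d _ α c (by omega) (by omega), he, pow_one, ZMod.natCast_mod]
      exact h
  generalize twist p r d (lowerExponent r k) α c = c' at ht hc' hu ⊢
  generalize α (cext r c (r - 1)) = a at ht ha hu
  have hA : ∀ i ∈ Finset.Icc 1 (r - 2),
      (p : ℚ) ^ (μ (i + 1) - 1) * ((uinv p r d c' i * cext r c' (i + 1) : ℕ) : ℚ)
          / (p : ℚ) ^ d (i + 1)
        - (p : ℚ) ^ (μ (i + 1) - 1) * ((uinv p r d c i * cext r c (i + 1) : ℕ) : ℚ)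
          / (p : ℚ) ^ d (i + 1)
        - (if i = k - 1 then ((uinv p r d c i * cext r c (i + 1) : ℕ) : ℚ) / p else 0)
        ∈ (Int.castAddHom ℚ).range := by
    intro i hi
    rw [Finset.mem_Icc] at hi
    have hLi := le_Lf_of_lt d (r := r) hi.1 (by omega)
    have hLi' := le_Lf_of_lt d (r := r) (j := i + 1) (by omega) (by omega)
    have hdi := hdivA i hi.1 hi.2
    have hs : d (i + 1) ≤ μ (i + 1) - 1 + min (Lf r d i) (Lf r d (i + 1)) := by omega
    have hle : lowerExponent r k i ≤ lowerExponent r k (i + 1) := by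
      unfold lowerExponent; split_ifs <;> omega
    have h := ht.uinv_mul_cext_modEq hc hc' hi.1 (by omega) (by omega : 1 ≤ i + 1) (by omega)
      (min_le_left _ _) (min_le_right _ _) hle
    split_ifs with hik
    · obtain rfl : k = i + 1 := by omega
      have h1 : lowerExponent r (i + 1) (i + 1) - lowerExponent r (i + 1) i = 1 := by
        unfold lowerExponent; split_ifs <;> omega
      rw [h1, pow_one] at h
      exact frac_sub_sub_mem_of_modEq hp.ne_zero h (by omega) ha hs hn
    · have h1 : lowerExponent r k (i + 1) - lowerExponent r k i = 0 := by
        unfold lowerExponent; split_ifs <;> omega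
      rw [h1, pow_zero, one_mul] at h
      rw [sub_zero]
      exact frac_sub_mem_of_modEq hp.ne_zero h hs
  have hB : ∀ i ∈ Finset.Icc 1 (r - 2),
      (p : ℚ) ^ (μ (i + 1) - 1 + d i)
          * ((uinv p r d c' (2 * r - i - 1) * cext r c' (2 * r - i) : ℕ) : ℚ)
          / (p : ℚ) ^ (d (i + 1) + d (2 * r - i))
        - (p : ℚ) ^ (μ (i + 1) - 1 + d i)
          * ((uinv p r d c (2 * r - i - 1) * cext r c (2 * r - i) : ℕ) : ℚ)
          / (p : ℚ) ^ (d (i + 1) + d (2 * r - i)) - (fun _ => (0 : ℚ)) i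
        ∈ (Int.castAddHom ℚ).range := by
    intro i hi
    rw [Finset.mem_Icc] at hi
    have hL := le_Lf hr hd0 (j := 2 * r - i - 1) (by omega) (by omega)
    have hL' := le_Lf hr hd0 (j := 2 * r - i) (by omega) (by omega)
    have hdi := hdivA i hi.1 hi.2
    have hdi' := hdivB i hi.1 hi.2
    have he1 : lowerExponent r k (2 * r - i - 1) = 1 := by
      rw [lowerExponent, if_neg (by omega), if_neg (by omega)]
    have he2 : lowerExponent r k (2 * r - i) = 1 := by
      rw [lowerExponent, if_neg (by omega), if_neg (by omega)]
    have h := ht.uinv_mul_cext_modEq hc hc' (by omega : 1 ≤ 2 * r - i - 1) (by omega)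
      (by omega : 1 ≤ 2 * r - i) (by omega) (min_le_left _ _) (min_le_right _ _)
      (by rw [he1, he2])
    rw [he1, he2, Nat.sub_self, pow_zero, one_mul] at h
    rw [sub_zero]
    exact frac_sub_mem_of_modEq hp.ne_zero h (by omega)
  have h0 : (p : ℚ) ^ (μ 1 - 1) * (cext r c' 1 : ℚ) / (p : ℚ) ^ d 1
      - (p : ℚ) ^ (μ 1 - 1) * (cext r c 1 : ℚ) / (p : ℚ) ^ d 1
      - (if k = 1 then (cext r c 1 : ℚ) / p else 0) ∈ (Int.castAddHom ℚ).range := by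
    have h := ht 1 le_rfl (by omega)
    have hL := le_Lf_of_lt d (r := r) le_rfl (by omega : 1 ≤ r - 1)
    split_ifs with hk'
    · subst hk'
      have h1 : lowerExponent r 1 1 = 1 := by
        rw [lowerExponent, if_neg (by omega), if_neg (by omega)]
      rw [h1, pow_one] at h
      exact frac_sub_sub_mem_of_modEq hp.ne_zero h (by omega) ha (by omega) hn
    · have h1 : lowerExponent r k 1 = 0 := by rw [lowerExponent, if_pos (by omega)]
      rw [h1, pow_zero, one_mul] at h
      rw [sub_zero]
      exact frac_sub_mem_of_modEq hp.ne_zero h (by omega)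
  have hmem := ht.expArg_sub_mem hr hd0 hdivR hc hc'
    (by unfold lowerExponent; split_ifs <;> omega) (by unfold lowerExponent; split_ifs <;> omega)
    hu h0 hA hB
  have hap := modEq_one_of_modEq_one_add hn2 ha
  have hkc := hc k hk1 (by omega) (by omega)
  by_cases hk' : k = 1
  · subst hk'
    refine ⟨?_, ?_, ?_⟩
    · convert hmem using 2
      have hz : ∑ i ∈ Finset.Icc 1 (r - 2),
          ((if i = 1 - 1 then ((uinv p r d c i * cext r c (i + 1) : ℕ) : ℚ) / p else 0)
            - (fun _ => (0 : ℚ)) i) = 0 := by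
        refine Finset.sum_eq_zero fun i hi => ?_
        rw [Finset.mem_Icc] at hi
        rw [if_neg (by omega), sub_zero]
      rw [hz]
      simp
    · simp only [if_true]
      have h := (ht 1 le_rfl (by omega)).of_dvd (dvd_pow_self p (by
        have := le_Lf_of_lt d (r := r) le_rfl (by omega : 1 ≤ r - 1); omega))
      have h2 := h.trans ((hap.pow (lowerExponent r 1 1)).mul_right _)
      rw [one_pow, one_mul] at h2
      exact (Int.natCast_modEq_iff).2 h2
    · simp only [if_true]
      rw [Int.natCast_dvd_natCast]
      exact (Nat.Prime.coprime_iff_not_dvd hp).1 hkc.symm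
  · obtain ⟨i, rfl⟩ : ∃ i, k = i + 1 := ⟨k - 1, by omega⟩
    have hdi := hdivA i (by omega) (by omega)
    have hLi := le_Lf_of_lt d (r := r) (j := i) (by omega) (by omega)
    have hLi' := le_Lf_of_lt d (r := r) (j := i + 1) (by omega) (by omega)
    simp only [if_neg hk', Nat.add_sub_cancel]
    refine ⟨?_, ?_, ?_⟩
    · convert hmem using 2
      simp only [if_neg hk', Nat.add_sub_cancel, sub_zero, zero_add]
      rw [Finset.sum_ite_eq', if_pos (by rw [Finset.mem_Icc]; omega)]
      push_cast
      rfl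
    · have h := ht.uinv_mul_cext_modEq hc hc' (by omega : 1 ≤ i) (by omega) (by omega : 1 ≤ i + 1)
        (by omega) (s := 1) (by omega) (by omega)
        (by unfold lowerExponent; split_ifs <;> omega)
      rw [pow_one] at h
      have h2 := h.trans ((hap.pow _).mul_right _)
      rw [one_pow, one_mul] at h2
      exact (Int.natCast_modEq_iff).2 h2
    · rw [Int.natCast_dvd_natCast]
      exact (Nat.Prime.coprime_iff_not_dvd hp).1
        ((coprime_uinv hc (by omega) (by omega) (by omega) hLi).mul_left hkc).symm

theorem Gexp_eq_zero_of_add_lt {p r : ℕ} (hp : p.Prime) (hr : 2 ≤ r) {μ d : ℕ → ℕ}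
    (hμ : ∀ i, 1 ≤ i → i ≤ r → 1 ≤ μ i) (hd0 : d 0 = 0) (hdiv : Divis r μ d) {k : ℕ}
    (hk1 : 1 ≤ k) (hk : k ≤ r - 2) (hlt : μ (k + 1) + d k < d (k + 1) + d (2 * r - k)) :
    Gexp p r μ d = 0 := by
  have : NeZero p := ⟨hp.ne_zero⟩
  obtain ⟨hdivA, hdivB, hdivR⟩ := hdiv
  have hμk := hμ (k + 1) (by omega) (by omega)
  have hdk := hdivA k hk1 hk
  have hdk' := hdivB k hk1 hk
  obtain ⟨n, hn⟩ : ∃ n, d (k + 1) + d (2 * r - k) = μ (k + 1) - 1 + d k + n :=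
    ⟨d (k + 1) + d (2 * r - k) - (μ (k + 1) - 1 + d k), by omega⟩
  have hn2 : 2 ≤ n := by omega
  have helow : ∀ j, j < 2 * r - k → upperExponent r k j = 0 := fun j hj => if_pos hj
  have heup : ∀ j, 2 * r - k ≤ j → upperExponent r k j = 1 := fun j hj => if_neg (by omega)
  refine Gexp_eq_zero_of_twist (e := upperExponent r k) (α := fun _ => 1 + p ^ (n - 1)) hp hr hn2
    hd0 (fun _ _ => Nat.ModEq.refl _) (fun _ _ _ _ _ _ _ => rfl)
    (fun c => -((uinv p r d c (2 * r - k - 1) * cext r c (2 * r - k) : ℕ) : ℤ)) ?_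
  intro c hc hc'
  have ht := isTwist_twist p r d (upperExponent r k) (fun _ => 1 + p ^ (n - 1)) c
  have hu : (1 + p ^ (n - 1)) ^ upperExponent r k (r - 1)
        * uinv p r d (twist p r d (upperExponent r k) (fun _ => 1 + p ^ (n - 1)) c) (r - 1)
      ≡ uinv p r d c (r - 1) [MOD p ^ (d (r + 1) + d r)] := by
    rw [uinv, uinv, cext_twist p d _ _ c (by omega) (by omega), helow _ (by omega), pow_zero,
      one_mul, one_mul, ZMod.natCast_mod]
  have ha : 1 + p ^ (n - 1) ≡ 1 + p ^ (n - 1) [MOD p ^ n] := Nat.ModEq.refl _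
  generalize twist p r d (upperExponent r k) (fun _ => 1 + p ^ (n - 1)) c = c' at ht hc' hu ⊢
  have hap := modEq_one_of_modEq_one_add hn2 ha
  have hA : ∀ i ∈ Finset.Icc 1 (r - 2),
      (p : ℚ) ^ (μ (i + 1) - 1) * ((uinv p r d c' i * cext r c' (i + 1) : ℕ) : ℚ)
          / (p : ℚ) ^ d (i + 1)
        - (p : ℚ) ^ (μ (i + 1) - 1) * ((uinv p r d c i * cext r c (i + 1) : ℕ) : ℚ)
          / (p : ℚ) ^ d (i + 1) - (fun _ => (0 : ℚ)) i ∈ (Int.castAddHom ℚ).range := by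
    intro i hi
    rw [Finset.mem_Icc] at hi
    have hLi := le_Lf_of_lt d (r := r) hi.1 (by omega)
    have hLi' := le_Lf_of_lt d (r := r) (j := i + 1) (by omega) (by omega)
    have hdi := hdivA i hi.1 hi.2
    have he1 := helow i (by omega)
    have he2 := helow (i + 1) (by omega)
    have h := ht.uinv_mul_cext_modEq hc hc' hi.1 (by omega) (by omega : 1 ≤ i + 1) (by omega)
      (min_le_left _ _) (min_le_right _ _) (by rw [he1, he2])
    rw [he1, he2, Nat.sub_self, pow_zero, one_mul] at h
    rw [sub_zero]
    exact frac_sub_mem_of_modEq hp.ne_zero h (by omega)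
  have hB : ∀ i ∈ Finset.Icc 1 (r - 2),
      (p : ℚ) ^ (μ (i + 1) - 1 + d i)
          * ((uinv p r d c' (2 * r - i - 1) * cext r c' (2 * r - i) : ℕ) : ℚ)
          / (p : ℚ) ^ (d (i + 1) + d (2 * r - i))
        - (p : ℚ) ^ (μ (i + 1) - 1 + d i)
          * ((uinv p r d c (2 * r - i - 1) * cext r c (2 * r - i) : ℕ) : ℚ)
          / (p : ℚ) ^ (d (i + 1) + d (2 * r - i))
        - (if i = k then ((uinv p r d c (2 * r - i - 1) * cext r c (2 * r - i) : ℕ) : ℚ) / p else 0)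
        ∈ (Int.castAddHom ℚ).range := by
    intro i hi
    rw [Finset.mem_Icc] at hi
    have hL := le_Lf hr hd0 (j := 2 * r - i - 1) (by omega) (by omega)
    have hL' := le_Lf hr hd0 (j := 2 * r - i) (by omega) (by omega)
    have hdi := hdivA i hi.1 hi.2
    have hdi' := hdivB i hi.1 hi.2
    have hs : d (i + 1) + d (2 * r - i)
        ≤ μ (i + 1) - 1 + d i + min (Lf r d (2 * r - i - 1)) (Lf r d (2 * r - i)) := by omega
    have hle : upperExponent r k (2 * r - i - 1) ≤ upperExponent r k (2 * r - i) := by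
      unfold upperExponent; split_ifs <;> omega
    have h := ht.uinv_mul_cext_modEq hc hc' (by omega : 1 ≤ 2 * r - i - 1) (by omega)
      (by omega : 1 ≤ 2 * r - i) (by omega) (min_le_left _ _) (min_le_right _ _) hle
    split_ifs with hik
    · subst hik
      rw [heup _ le_rfl, helow _ (by omega), Nat.sub_zero, pow_one] at h
      exact frac_sub_sub_mem_of_modEq hp.ne_zero h (by omega) ha hs hn
    · have h1 : upperExponent r k (2 * r - i) - upperExponent r k (2 * r - i - 1) = 0 := by
        unfold upperExponent; split_ifs <;> omega
      rw [h1, pow_zero, one_mul] at h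
      rw [sub_zero]
      exact frac_sub_mem_of_modEq hp.ne_zero h hs
  have h0 : (p : ℚ) ^ (μ 1 - 1) * (cext r c' 1 : ℚ) / (p : ℚ) ^ d 1
      - (p : ℚ) ^ (μ 1 - 1) * (cext r c 1 : ℚ) / (p : ℚ) ^ d 1 - 0 ∈ (Int.castAddHom ℚ).range := by
    have h := ht 1 le_rfl (by omega)
    have hL := le_Lf_of_lt d (r := r) le_rfl (by omega : 1 ≤ r - 1)
    rw [helow 1 (by omega), pow_zero, one_mul] at h
    rw [sub_zero]
    exact frac_sub_mem_of_modEq hp.ne_zero h (by omega)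
  have hmem := ht.expArg_sub_mem hr hd0 hdivR hc hc'
    (by rw [helow _ (by omega), helow _ (by omega)])
    (by rw [helow _ (by omega), helow _ (by omega)]) hu h0 hA hB
  have hL := le_Lf hr hd0 (j := 2 * r - k - 1) (by omega) (by omega)
  have hL' := le_Lf hr hd0 (j := 2 * r - k) (by omega) (by omega)
  refine ⟨?_, ?_, ?_⟩
  · convert hmem using 2
    simp only [zero_sub, zero_add, Finset.sum_neg_distrib]
    rw [Finset.sum_ite_eq', if_pos (by rw [Finset.mem_Icc]; omega)]
    push_cast
    ring
  · refine Int.ModEq.neg ((Int.natCast_modEq_iff).2 ?_)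
    have h := ht.uinv_mul_cext_modEq hc hc' (by omega : 1 ≤ 2 * r - k - 1) (by omega)
      (by omega : 1 ≤ 2 * r - k) (by omega) (s := 1) (by omega) (by omega)
      (by unfold upperExponent; split_ifs <;> omega)
    rw [pow_one] at h
    have h2 := h.trans ((hap.pow _).mul_right _)
    rwa [one_pow, one_mul] at h2
  · rw [dvd_neg, Int.natCast_dvd_natCast]
    exact (Nat.Prime.coprime_iff_not_dvd hp).1
      ((coprime_uinv hc (by omega) (by omega) (by omega) hL).mul_left
        (hc (2 * r - k) (by omega) (by omega) (by omega))).symm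

/-- If `t ∉ CQ₁(μ)` (and the divisibility conditions hold), then `G(t) = 0`. -/
theorem stmt2 (p : ℕ) (hp : p.Prime) (hpodd : Odd p) (r : ℕ) (hr : 2 ≤ r)
    (μ : ℕ → ℕ) (hμ : ∀ i, 1 ≤ i → i ≤ r → 1 ≤ μ i)
    (d : ℕ → ℕ) (hd : ∀ j, (j = 0 ∨ 2 * r - 1 < j) → d j = 0)
    (hdiv : Divis r μ d)
    (hnot : ¬ MemCQ1 r μ d) :
    Gexp p r μ d = 0 := by
  have hd0 := hd 0 (Or.inl rfl)
  by_contra hG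
  refine hnot ⟨fun i h1 hi => ?_, fun i h1 hi => ?_⟩
  · by_contra h
    exact hG (Gexp_eq_zero_of_lt hp hr hμ hd0 hdiv h1 hi (by omega))
  · by_contra h
    exact hG (Gexp_eq_zero_of_add_lt hp hr hμ hd0 hdiv h1 hi (by omega))

end Stmt2
end
end

section
/- Let p be an odd prime, q = p, r ≥ 2, μ ∈ ℤ^r with all μ_i ≥ 1, and let t = (d₁,…,d_{2r−1}) ∈ ℤ_{≥0}^{2r−1} satisfy the divisibility conditions d_{j+1} ≤ m_{j+1} + d_j and d_{j+1} + d_{2r−j} ≤ m_{j+1} + d_j + d_{2r−j−1} for 1 ≤ j ≤ r−2, and 2d_{r+1} ≤ m_r + 2d_{r−1}, where m_i = μ_i − 1. If t ∈ CQ₁^≤(μ), then the exponential sum G(t) equals G_Δ(t). -/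
open Finset
open scoped Classical

noncomputable section

namespace Stmt3

/-- `ψ(x) = e^{2πix}`. -/
def psi (y : ℚ) : ℂ := Complex.exp (2 * (Real.pi : ℂ) * Complex.I * (y : ℂ))

/-- The moduli exponents `L₁,…,L_{2r−1}`:
`Lᵢ = d₁+⋯+dᵢ` for `i ≤ r−1`; `L_r = d_r + 2(d₁+⋯+d_{r−1})`;
`L_{r+i'} = d_r − d_{i'−1} + (d_{r+1}+⋯+d_{r+i'}) + (d₁+⋯+d_{r−1})` for `1 ≤ i' ≤ r−1`
(with `d₀ = 0`). -/
def Lf (r : ℕ) (d : ℕ → ℕ) (i : ℕ) : ℕ :=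
  if i ≤ r - 1 then ∑ j ∈ Finset.Icc 1 i, d j
  else if i = r then d r + 2 * ∑ j ∈ Finset.Icc 1 (r - 1), d j
  else (d r + (∑ j ∈ Finset.Icc (r + 1) i, d j) + ∑ j ∈ Finset.Icc 1 (r - 1), d j)
        - d (i - r - 1)

/-- Extension of a `Fin (2r−1)`-tuple of residues to a 1-based function. -/
def cext (r : ℕ) (c : Fin (2 * r - 1) → ℕ) (j : ℕ) : ℕ :=
  if h : 1 ≤ j ∧ j ≤ 2 * r - 1 then c ⟨j - 1, by omega⟩ else 0

/-- `uⱼ`: the inverse of `cⱼ` modulo `p^{Lⱼ}`, taken in `[0, p^{Lⱼ})`, when `dⱼ > 0`;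
`uⱼ = 0` when `dⱼ = 0`. -/
def uinv (p r : ℕ) (d : ℕ → ℕ) (c : Fin (2 * r - 1) → ℕ) (j : ℕ) : ℕ :=
  if d j = 0 then 0 else ((cext r c j : ZMod (p ^ Lf r d j))⁻¹).val

/-- The rational number whose exponential is summed in `G(t)`. -/
def expArg (p r : ℕ) (μ d : ℕ → ℕ) (c : Fin (2 * r - 1) → ℕ) : ℚ :=
  (p : ℚ) ^ (μ 1 - 1) * (cext r c 1 : ℚ) / (p : ℚ) ^ d 1
  + (∑ i ∈ Finset.Icc 1 (r - 2),
      (p : ℚ) ^ (μ (i + 1) - 1) *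
        ((uinv p r d c i : ℚ) * (cext r c (i + 1) : ℚ) / (p : ℚ) ^ d (i + 1)
          - (p : ℚ) ^ d i * (cext r c (2 * r - i) : ℚ) * (uinv p r d c (2 * r - i - 1) : ℚ)
              / (p : ℚ) ^ (d (i + 1) + d (2 * r - i))))
  + (p : ℚ) ^ (μ r - 1) *
      ((uinv p r d c (r - 1) : ℚ) ^ 2 * (cext r c r : ℚ) / (p : ℚ) ^ d r
        + 2 * (p : ℚ) ^ d (r - 1) * (uinv p r d c (r - 1) : ℚ) * (cext r c (r + 1) : ℚ)
            / (p : ℚ) ^ (d (r + 1) + d r)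
        + (p : ℚ) ^ (2 * d (r - 1)) * (cext r c (r + 1) : ℚ) ^ 2 * (uinv p r d c r : ℚ)
            / (p : ℚ) ^ (2 * d (r + 1) + d r))

/-- The exponential sum `G(t)`. -/
def Gexp (p r : ℕ) (μ d : ℕ → ℕ) : ℂ :=
  (∏ k ∈ Finset.Icc 1 (2 * r - 1), ((p : ℂ) ^ Lf r d k)⁻¹) *
    ∑ c ∈ (Fintype.piFinset fun j : Fin (2 * r - 1) =>
              Finset.range (p ^ Lf r d (j.val + 1))).filter
            (fun c => ∀ j : Fin (2 * r - 1), 0 < d (j.val + 1) → Nat.Coprime (c j) p),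
      psi (expArg p r μ d c)

/-- Membership in `CQ₁(μ)`: `dᵢ ≤ μᵢ` for `1 ≤ i ≤ r−1`, and
`d_{2r−i} ≤ μ_{i+1} + dᵢ − d_{i+1}` for `1 ≤ i ≤ r−2`. -/
def MemCQ1 (r : ℕ) (μ d : ℕ → ℕ) : Prop :=
  (∀ i, 1 ≤ i → i ≤ r - 1 → d i ≤ μ i) ∧
    ∀ i, 1 ≤ i → i ≤ r - 2 →
      (d (2 * r - i) : ℤ) ≤ (μ (i + 1) : ℤ) + (d i : ℤ) - (d (i + 1) : ℤ)

/-- The divisibility conditions: `d_{j+1} ≤ m_{j+1} + d_j` and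
`d_{j+1} + d_{2r−j} ≤ m_{j+1} + d_j + d_{2r−j−1}` for `1 ≤ j ≤ r−2`, and
`2d_{r+1} ≤ m_r + 2d_{r−1}`, where `mᵢ = μᵢ − 1`. -/
def Divis (r : ℕ) (μ d : ℕ → ℕ) : Prop :=
  (∀ j, 1 ≤ j → j ≤ r - 2 → d (j + 1) ≤ (μ (j + 1) - 1) + d j) ∧
  (∀ j, 1 ≤ j → j ≤ r - 2 →
      d (j + 1) + d (2 * r - j) ≤ (μ (j + 1) - 1) + d j + d (2 * r - j - 1)) ∧
  2 * d (r + 1) ≤ (μ r - 1) + 2 * d (r - 1)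


/-- Membership in `CQ₁^≤(μ)`: `dᵢ ≤ μᵢ` for `1 ≤ i ≤ r`,
`d_r ≤ μ_r + 2(d_{r−1} − d_{r+1})`, and `d_{2r−i} ≤ μ_{i+1} + dᵢ − d_{i+1}` for
`1 ≤ i ≤ r−2`. -/
def MemCQ1Le (r : ℕ) (μ d : ℕ → ℕ) : Prop :=
  (∀ i, 1 ≤ i → i ≤ r → d i ≤ μ i) ∧
  ((d r : ℤ) ≤ (μ r : ℤ) + 2 * ((d (r - 1) : ℤ) - (d (r + 1) : ℤ))) ∧
  ∀ i, 1 ≤ i → i ≤ r - 2 →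
    (d (2 * r - i) : ℤ) ≤ (μ (i + 1) : ℤ) + (d i : ℤ) - (d (i + 1) : ℤ)

/-- The decoration of the entry `𝔠ᵢ` of `Δ(t)`: circled iff `dᵢ = 0`. -/
def CircledB (d : ℕ → ℕ) (i : ℕ) : Prop := d i = 0

/-- The entry `𝔠ᵢ` of `Δ(t)` is boxed iff: `dᵢ = μᵢ` (for `i ≤ r`);
`d_r = μ_r + 2(d_{r−1} − d_{r+1})` (for `i = r+1`); and
`d_{2r−i} = μ_{i+1} + dᵢ − d_{i+1}`, rewritten at index `i`, otherwise. -/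
def BoxedB (r : ℕ) (μ d : ℕ → ℕ) (i : ℕ) : Prop :=
  if i ≤ r then d i = μ i
  else if i = r + 1 then
    (d r : ℤ) = (μ r : ℤ) + 2 * ((d (r - 1) : ℤ) - (d (r + 1) : ℤ))
  else
    (d i : ℤ) = (μ (2 * r - i + 1) : ℤ) + (d (2 * r - i) : ℤ) - (d (2 * r - i + 1) : ℤ)

/-- `γ(𝔠ᵢ)`, with `q = p`. -/
def gamB (p r : ℕ) (μ d : ℕ → ℕ) (i : ℕ) : ℂ :=
  if BoxedB r μ d i then (if CircledB d i then 0 else -((p : ℂ))⁻¹)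
  else (if CircledB d i then 1 else 1 - ((p : ℂ))⁻¹)

/-- `G_Δ(t) = ∏_{i=1}^{2r−1} γ(𝔠ᵢ)`. -/
def GDeltaB (p r : ℕ) (μ d : ℕ → ℕ) : ℂ :=
  ∏ i ∈ Finset.Icc 1 (2 * r - 1), gamB p r μ d i

/-- Extension of an `n`-tuple to a 1-based function, by zero. -/
def tupleExt (n : ℕ) (c : Fin n → ℕ) (j : ℕ) : ℕ :=
  if h : 1 ≤ j ∧ j ≤ n then c ⟨j - 1, by omega⟩ else 0

lemma tupleExt_snoc (n : ℕ) (c : Fin n → ℕ) (x : ℕ) :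
    tupleExt (n + 1) (Fin.snoc (α := fun _ => ℕ) c x)
      = Function.update (tupleExt n c) (n + 1) x := by
  funext j
  by_cases hj : j = n + 1
  · subst hj
    simp [tupleExt, Fin.snoc]
  · rw [Function.update_of_ne hj]
    unfold tupleExt
    by_cases h : 1 ≤ j ∧ j ≤ n
    · have h' : 1 ≤ j ∧ j ≤ n + 1 := by omega
      have h'' : j - 1 < n := by omega
      simp [h, h', Fin.snoc, h'']
    · have h' : ¬ (1 ≤ j ∧ j ≤ n + 1) := by omega
      simp [h, h']

/-- Summing out the coordinates of a tuple one at a time, starting with the last one. -/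
lemma sum_piFinset_eq_of_step (S : ℕ → Finset ℕ) (V : ℕ → (ℕ → ℕ) → ℂ) (n : ℕ)
    (hV : ∀ k < n, ∀ e : ℕ → ℕ, (∀ j, 1 ≤ j → j ≤ k → e j ∈ S j) →
      ∑ x ∈ S (k + 1), V (k + 1) (Function.update e (k + 1) x) = V k e) :
    ∑ c ∈ Fintype.piFinset (fun j : Fin n => S (j.val + 1)), V n (tupleExt n c)
      = V 0 (fun _ => 0) := by
  induction n with
  | zero =>
    have h : tupleExt 0 = fun _ _ => 0 := by
      funext c j
      simp only [tupleExt]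
      rw [dif_neg (by omega)]
    simp [h]
  | succ n ih =>
    rw [← ih fun k hk => hV k (by omega)]
    have hset : ∑ c ∈ Fintype.piFinset (fun j : Fin (n + 1) => S (j.val + 1)),
        V (n + 1) (tupleExt (n + 1) c)
        = ∑ c ∈ Fintype.piFinset (fun j : Fin n => S (j.val + 1)), ∑ x ∈ S (n + 1),
            V (n + 1) (tupleExt (n + 1) (Fin.snoc (α := fun _ => ℕ) c x)) := by
      rw [← Finset.sum_product']
      refine Finset.sum_nbij' (fun c => (Fin.init (α := fun _ => ℕ) c, c (Fin.last n)))
        (fun y => Fin.snoc (α := fun _ => ℕ) y.1 y.2) ?_ ?_ ?_ ?_ ?_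
      · intro c hc
        rw [Fintype.mem_piFinset] at hc
        simp only [Finset.mem_product, Fintype.mem_piFinset]
        exact ⟨fun j => hc j.castSucc, hc (Fin.last n)⟩
      · intro y hy
        simp only [Finset.mem_product, Fintype.mem_piFinset] at hy
        rw [Fintype.mem_piFinset]
        intro j
        induction j using Fin.lastCases with
        | last => simpa using hy.2
        | cast j => simpa using hy.1 j
      · intro c _
        simp
      · intro y _
        simp
      · intro c _
        simp
    rw [hset]
    refine Finset.sum_congr rfl fun c hc => ?_
    simp only [tupleExt_snoc]
    refine hV n (by omega) _ fun j h1 h2 => ?_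
    rw [Fintype.mem_piFinset] at hc
    have := hc ⟨j - 1, by omega⟩
    have hj : j - 1 + 1 = j := by omega
    simpa [tupleExt, h1, h2, hj] using this

/-- The residues modulo `p ^ L`, restricted to the invertible ones when `k > 0`. -/
def residues (p L k : ℕ) : Finset ℕ :=
  (Finset.range (p ^ L)).filter fun x => 0 < k → Nat.Coprime x p

lemma sum_residues_zero (p L : ℕ) (g : ℕ → ℂ) :
    ∑ x ∈ residues p L 0, g x = ∑ x ∈ Finset.range (p ^ L), g x := by
  simp [residues]

section Residues

variable {p : ℕ} [hp : Fact p.Prime]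

lemma sum_range_natCast (f : ZMod p → ℂ) :
    ∑ x ∈ Finset.range p, f (x : ZMod p) = ∑ a, f a := by
  refine Finset.sum_nbij' (fun x => (x : ZMod p)) ZMod.val ?_ ?_ ?_ ?_ ?_
  · simp
  · intro a _
    simpa using ZMod.val_lt a
  · intro x hx
    exact ZMod.val_cast_of_lt (by simpa using hx)
  · intro a _
    exact ZMod.natCast_zmod_val a
  · simp

lemma sum_range_mul_natCast (f : ZMod p → ℂ) (m : ℕ) :
    ∑ x ∈ Finset.range (p * m), f (x : ZMod p) = m * ∑ a, f a := by
  induction m with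
  | zero => simp
  | succ m ih =>
    rw [Nat.mul_succ, Finset.sum_range_add, ih]
    simp only [Nat.cast_add, Nat.cast_mul, CharP.cast_eq_zero, zero_mul, zero_add]
    rw [sum_range_natCast]
    push_cast
    ring

lemma sum_range_pow_natCast (f : ZMod p → ℂ) {L : ℕ} (hL : 1 ≤ L) :
    ∑ x ∈ Finset.range (p ^ L), f (x : ZMod p) = (p : ℂ) ^ L * ((p : ℂ)⁻¹ * ∑ a, f a) := by
  obtain ⟨L, rfl⟩ := Nat.exists_eq_add_of_le' hL
  have hp0 : (p : ℂ) ≠ 0 := by exact_mod_cast hp.out.ne_zero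
  rw [pow_succ', sum_range_mul_natCast]
  push_cast
  field_simp
  ring

lemma coprime_iff_natCast_ne_zero (x : ℕ) : Nat.Coprime x p ↔ (x : ZMod p) ≠ 0 := by
  rw [Ne, ZMod.natCast_eq_zero_iff, Nat.coprime_comm, hp.out.coprime_iff_not_dvd]

lemma sum_residues_of_pos (f : ZMod p → ℂ) {L k : ℕ} (hL : 1 ≤ L) (hk : 0 < k) :
    ∑ x ∈ residues p L k, f (x : ZMod p)
      = (p : ℂ) ^ L * ((p : ℂ)⁻¹ * ∑ a ∈ univ.erase 0, f a) := by
  rw [residues, Finset.sum_filter]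
  simp only [hk, forall_true_left, coprime_iff_natCast_ne_zero]
  rw [sum_range_pow_natCast (fun a => if a ≠ 0 then f a else 0) hL, ← Finset.sum_filter,
    Finset.filter_ne']

lemma card_erase_zero : ((univ.erase (0 : ZMod p)).card : ℂ) = p - 1 := by
  rw [Finset.card_erase_of_mem (Finset.mem_univ _), Finset.card_univ, ZMod.card,
    Nat.cast_sub hp.out.one_le, Nat.cast_one]

lemma sum_residues_one {L k : ℕ} (hL : 0 < k → 1 ≤ L) :
    ∑ _x ∈ residues p L k, (1 : ℂ) = (p : ℂ) ^ L * (if k = 0 then 1 else 1 - (p : ℂ)⁻¹) := by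
  have hp0 : (p : ℂ) ≠ 0 := by exact_mod_cast hp.out.ne_zero
  rcases Nat.eq_zero_or_pos k with rfl | hk
  · rw [sum_residues_zero]
    simp
  · rw [sum_residues_of_pos (fun _ => 1) (hL hk) hk]
    simp only [Finset.sum_const, nsmul_eq_mul, card_erase_zero, hk.ne', if_false]
    field_simp

lemma sum_stdAddChar_mul (s : ZMod p) :
    ∑ a ∈ univ.erase 0, ZMod.stdAddChar (a * s) = (if s = 0 then (p : ℂ) else 0) - 1 := by
  have h := AddChar.sum_mulShift s (ZMod.isPrimitive_stdAddChar p)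
  rw [← Finset.add_sum_erase _ _ (Finset.mem_univ (0 : ZMod p))] at h
  rw [ZMod.card] at h
  simp only [zero_mul, AddChar.map_zero_eq_one] at h
  rw [eq_sub_iff_add_eq', h]
  push_cast
  rfl

lemma sum_residues_stdAddChar {L k : ℕ} (hL : 1 ≤ L) (hk : 0 < k) {s : ZMod p} (hs : s ≠ 0) :
    ∑ x ∈ residues p L k, ZMod.stdAddChar ((x : ZMod p) * s) = (p : ℂ) ^ L * (-(p : ℂ)⁻¹) := by
  rw [sum_residues_of_pos (fun a => ZMod.stdAddChar (a * s)) hL hk, sum_stdAddChar_mul,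
    if_neg hs]
  ring

lemma sum_stdAddChar_inv_mul (s : ZMod p) :
    ∑ a ∈ univ.erase 0, ZMod.stdAddChar (a⁻¹ * s) = (if s = 0 then (p : ℂ) else 0) - 1 := by
  rw [← sum_stdAddChar_mul]
  refine Finset.sum_nbij' (·⁻¹) (·⁻¹) ?_ ?_ ?_ ?_ ?_ <;> simp

lemma sum_sum_stdAddChar_sq_mul_inv :
    ∑ y ∈ univ.erase 0, ∑ z : ZMod p, ZMod.stdAddChar (z ^ 2 * y⁻¹) = (0 : ℂ) := by
  rw [Finset.sum_comm]
  simp only [mul_comm _ (_⁻¹), sum_stdAddChar_inv_mul]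
  simp [Finset.sum_sub_distrib, ZMod.card]

lemma sum_sum_stdAddChar_add_sq {x : ZMod p} (hx : x ≠ 0) :
    ∑ y ∈ univ.erase 0, ∑ z ∈ univ.erase (0 : ZMod p),
      ZMod.stdAddChar (x ^ 2 * y + 2 * x * z + z ^ 2 * y⁻¹) = (1 : ℂ) := by
  have h : ∀ y ∈ univ.erase (0 : ZMod p), ∑ z ∈ univ.erase (0 : ZMod p),
      (ZMod.stdAddChar (x ^ 2 * y + 2 * x * z + z ^ 2 * y⁻¹) : ℂ)
      = ∑ w ∈ univ.erase (0 : ZMod p), ZMod.stdAddChar (y * (x + w) ^ 2) := by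
    intro y hy
    have hy0 : y ≠ 0 := Finset.ne_of_mem_erase hy
    refine Finset.sum_nbij' (fun z => z * y⁻¹) (fun w => w * y) ?_ ?_ ?_ ?_ ?_
    · simp [hy0]
    · simp [hy0]
    · intro z _
      field_simp
    · intro w _
      field_simp
    · intro z _
      congr 1
      field_simp
      ring
  rw [Finset.sum_congr rfl h, Finset.sum_comm]
  simp only [sum_stdAddChar_mul]
  rw [Finset.sum_sub_distrib, Finset.sum_const, nsmul_eq_mul, card_erase_zero]
  have h2 : ∀ w : ZMod p, (if (x + w) ^ 2 = 0 then (p : ℂ) else 0)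
      = if w = -x then (p : ℂ) else 0 := by
    intro w
    have : (x + w) ^ 2 = 0 ↔ w = -x := by
      rw [pow_eq_zero_iff two_ne_zero, add_comm, add_eq_zero_iff_eq_neg]
    simp only [this]
  simp only [h2]
  rw [Finset.sum_ite_eq']
  simp [hx]

lemma natCast_val_inv {c L : ℕ} (hL : 1 ≤ L) (hc : Nat.Coprime c p) :
    (((c : ZMod (p ^ L))⁻¹.val : ℕ) : ZMod p) = (c : ZMod p)⁻¹ := by
  have hpL : p ∣ p ^ L := dvd_pow_self p (by omega)
  have : NeZero (p ^ L) := ⟨pow_ne_zero _ hp.out.ne_zero⟩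
  have h := congrArg (ZMod.castHom hpL (ZMod p))
    (ZMod.coe_mul_inv_eq_one c (Nat.Coprime.pow_right L hc))
  rw [map_mul, map_one, map_natCast] at h
  have hv : (((c : ZMod (p ^ L))⁻¹.val : ℕ) : ZMod p)
      = ZMod.castHom hpL (ZMod p) (c : ZMod (p ^ L))⁻¹ := by
    conv_rhs => rw [← ZMod.natCast_zmod_val (c : ZMod (p ^ L))⁻¹]
    rw [map_natCast]
  rw [hv]
  exact eq_inv_of_mul_eq_one_right h

lemma natCast_pow_sub {A B : ℕ} (h : B ≤ A) :
    ((p ^ (A - B) : ℕ) : ZMod p) = if A = B then 1 else 0 := by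
  split_ifs with hAB
  · simp [hAB]
  · have : A - B ≠ 0 := by omega
    simp [this]

lemma psi_intCast_div (N : ℤ) : psi ((N : ℚ) / p) = ZMod.stdAddChar (N : ZMod p) := by
  rw [ZMod.stdAddChar_coe, psi]
  congr 1
  push_cast
  ring

end Residues

lemma sum_Icc_eq_sum_pairs {M : Type*} [AddCommMonoid M] (f : ℕ → M) {r : ℕ} (hr : 2 ≤ r) :
    ∑ j ∈ Finset.Icc 1 (2 * r - 1), f j
      = f 1 + ∑ i ∈ Finset.Icc 1 (r - 2), (f (i + 1) + f (2 * r - i)) + (f r + f (r + 1)) := by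
  obtain ⟨s, rfl⟩ := Nat.exists_eq_add_of_le' hr
  have hI : ∀ (n : ℕ) (g : ℕ → M), ∑ j ∈ Finset.Icc 1 n, g j = ∑ j ∈ Finset.range n, g (j + 1) := by
    intro n g
    induction n with
    | zero => simp
    | succ n ih => rw [Finset.sum_Icc_succ_top (by omega), Finset.sum_range_succ, ih]
  rw [hI, hI, Finset.sum_add_distrib, show 2 * (s + 2) - 1 = (1 + s) + (2 + s) by omega,
    Finset.sum_range_add, Finset.sum_range_add, Finset.sum_range_add]
  rw [show s + 2 - 2 = s by omega,
    ← Finset.sum_range_reflect (fun x => f (1 + s + (2 + x) + 1))]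
  have h1 : ∀ x ∈ Finset.range s, f (1 + s + (2 + (s - 1 - x)) + 1) = f (2 * (s + 2) - (x + 1)) := by
    intro x hx
    rw [Finset.mem_range] at hx
    congr 1
    omega
  rw [Finset.sum_congr rfl h1]
  simp only [Finset.sum_range_succ, Finset.sum_range_zero, zero_add, add_zero]
  simp only [add_comm 1, add_assoc, Nat.reduceAdd]
  abel

section Block

variable {p : ℕ} [hp : Fact p.Prime]

/-- The weight attached to an entry `k` with boxing condition `P`. -/
def boxWeight (p : ℕ) (P : Prop) (k : ℕ) : ℂ :=
  if P then (if k = 0 then 0 else -((p : ℂ))⁻¹) else (if k = 0 then 1 else 1 - ((p : ℂ))⁻¹)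

lemma sum_residues_stdAddChar_eq_boxWeight {L k : ℕ} (hL : 0 < k → 1 ≤ L) {P : Prop}
    [Decidable P] {s : ZMod p} (hP : P → 0 < k ∧ s ≠ 0) :
    ∑ x ∈ residues p L k, ZMod.stdAddChar ((if P then 1 else 0) * s * (x : ZMod p))
      = (p : ℂ) ^ L * boxWeight p P k := by
  by_cases h : P
  · obtain ⟨hk, hs⟩ := hP h
    simp only [h, if_true, one_mul, mul_comm s, boxWeight, hk.ne', if_false]
    exact sum_residues_stdAddChar (hL hk) hk hs
  · simp only [h, if_false, zero_mul, AddChar.map_zero_eq_one, boxWeight]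
    exact sum_residues_one hL

/-- The sum over the two coordinates that occur quadratically. -/
lemma sum_sum_residues_quadratic {L L' k a b m : ℕ} {x : ZMod p} (hm : 1 ≤ m) (hkm : k ≤ m)
    (hkb : k + 2 * b ≤ m + 2 * a) (hba : 2 * b ≤ m - 1 + 2 * a) (hL : 0 < k → 1 ≤ L)
    (hLb : 0 < b → 1 ≤ L') (hLk : 0 < k → 1 ≤ L') (hx0 : a = 0 → x = 0) (hx : 0 < a → x ≠ 0) :
    ∑ y ∈ residues p L k, ∑ z ∈ residues p L' b,
      ZMod.stdAddChar ((if k = m then 1 else 0) * x ^ 2 * (y : ZMod p)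
        + 2 * (if m + a = k + b then 1 else 0) * x * (z : ZMod p)
        + (if m + 2 * a = k + 2 * b then 1 else 0) * (z : ZMod p) ^ 2
            * (if k = 0 then 0 else (y : ZMod p)⁻¹))
      = ((p : ℂ) ^ L * boxWeight p (k = m) k)
        * ((p : ℂ) ^ L' * boxWeight p (m + 2 * a = k + 2 * b) b) := by
  by_cases h1 : k = m <;> by_cases h2 : m + 2 * a = k + 2 * b
  · have hβ : m + a = k + b := by omega
    have hk : 0 < k := by omega
    have hab : a = b := by omega
    simp only [h1, h2, hβ, if_true, one_mul, mul_one, boxWeight]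
    subst h1 hab
    simp only [hk.ne', if_false]
    rcases Nat.eq_zero_or_pos a with rfl | ha
    · have hz : ∀ y : ZMod p, ∑ z ∈ residues p L' 0,
          (ZMod.stdAddChar (x ^ 2 * y + 2 * x * (z : ZMod p) + (z : ZMod p) ^ 2 * y⁻¹) : ℂ)
          = (p : ℂ) ^ L' * ((p : ℂ)⁻¹ * ∑ z : ZMod p, ZMod.stdAddChar (z ^ 2 * y⁻¹)) := by
        intro y
        rw [sum_residues_zero]
        simp only [hx0 rfl, mul_zero, zero_mul, zero_add, ne_eq, OfNat.ofNat_ne_zero,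
          not_false_eq_true, zero_pow]
        exact sum_range_pow_natCast (fun z => ZMod.stdAddChar (z ^ 2 * y⁻¹)) (hLk hk)
      simp only [hz]
      rw [sum_residues_of_pos (fun y => (p : ℂ) ^ L' * ((p : ℂ)⁻¹ * ∑ z : ZMod p,
        ZMod.stdAddChar (z ^ 2 * y⁻¹))) (hL hk) hk]
      simp only [← Finset.mul_sum]
      rw [sum_sum_stdAddChar_sq_mul_inv]
      simp
    · have hz : ∀ y : ZMod p, ∑ z ∈ residues p L' a,
          (ZMod.stdAddChar (x ^ 2 * y + 2 * x * (z : ZMod p) + (z : ZMod p) ^ 2 * y⁻¹) : ℂ)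
          = (p : ℂ) ^ L' * ((p : ℂ)⁻¹ * ∑ z ∈ univ.erase (0 : ZMod p),
              ZMod.stdAddChar (x ^ 2 * y + 2 * x * z + z ^ 2 * y⁻¹)) := fun y =>
        sum_residues_of_pos
          (fun z => ZMod.stdAddChar (x ^ 2 * y + 2 * x * z + z ^ 2 * y⁻¹)) (hLb ha) ha
      simp only [hz]
      rw [sum_residues_of_pos (fun y => (p : ℂ) ^ L' * ((p : ℂ)⁻¹ *
        ∑ z ∈ univ.erase (0 : ZMod p), ZMod.stdAddChar (x ^ 2 * y + 2 * x * z + z ^ 2 * y⁻¹)))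
        (hL hk) hk]
      simp only [← Finset.mul_sum]
      rw [sum_sum_stdAddChar_add_sq (hx ha)]
      simp only [ha.ne', if_false]
      ring
  · have hβ : m + a ≠ k + b := by omega
    simp only [h2, hβ, if_false, mul_zero, zero_mul, add_zero, Finset.sum_const, nsmul_eq_mul]
    rw [← Finset.mul_sum, sum_residues_stdAddChar_eq_boxWeight hL
      (fun h => ⟨by omega, pow_ne_zero _ (hx (by omega))⟩)]
    have hone := sum_residues_one (p := p) hLb
    simp only [Finset.sum_const, nsmul_eq_mul, mul_one] at hone
    rw [hone, boxWeight, boxWeight]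
    simp only [if_false]
    ring
  · have hβ : m + a ≠ k + b := by omega
    have hk : k ≠ 0 := by omega
    have hb : 0 < b := by omega
    simp only [h1, h2, hβ, if_false, if_true, mul_zero, zero_mul, zero_add, hk, one_mul]
    rw [Finset.sum_comm]
    have hy : ∀ z ∈ residues p L' b, ∑ y ∈ residues p L k,
        (ZMod.stdAddChar ((z : ZMod p) ^ 2 * (y : ZMod p)⁻¹) : ℂ)
        = (p : ℂ) ^ L * (-(p : ℂ)⁻¹) := by
      intro z hz
      have hz0 : (z : ZMod p) ≠ 0 :=
        (coprime_iff_natCast_ne_zero z).1 ((Finset.mem_filter.1 hz).2 hb)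
      simp only [mul_comm ((z : ZMod p) ^ 2)]
      rw [sum_residues_of_pos (fun y => ZMod.stdAddChar (y⁻¹ * (z : ZMod p) ^ 2)) (hL (by omega))
        (by omega), sum_stdAddChar_inv_mul, if_neg (pow_ne_zero _ hz0)]
      ring
    rw [Finset.sum_congr rfl hy, Finset.sum_const, nsmul_eq_mul]
    have hone := sum_residues_one (p := p) hLb
    simp only [Finset.sum_const, nsmul_eq_mul, mul_one] at hone
    rw [hone]
    simp only [boxWeight, hk, hb.ne', if_false, if_true]
    ring
  · have hβ : m + a ≠ k + b := by omega
    simp only [h1, h2, hβ, if_false, mul_zero, zero_mul, add_zero, AddChar.map_zero_eq_one]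
    rw [Finset.sum_congr rfl fun _ _ => (sum_residues_one (p := p) hLb).trans (mul_one _).symm,
      ← Finset.mul_sum, sum_residues_one hL, boxWeight, boxWeight]
    simp only [if_false]
    ring

end Block

section Phase

/-- `uinv` as a function of the extended tuple. -/
def invRes (p r : ℕ) (d e : ℕ → ℕ) (j : ℕ) : ℕ :=
  if d j = 0 then 0 else ((e j : ZMod (p ^ Lf r d j))⁻¹).val

/-- The amount by which the `j`-th entry falls short of being boxed. -/
def boxGap (r : ℕ) (μ d : ℕ → ℕ) (j : ℕ) : ℕ :=
  if j ≤ r then μ j - d j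
  else if j = r + 1 then (μ r + 2 * d (r - 1)) - (d r + 2 * d (r + 1))
  else (μ (2 * r - j + 1) + d (2 * r - j)) - (d (2 * r - j + 1) + d j)

/-- The multiplier of `κ_j e_j` in the summand with index `j ∉ {r, r + 1}`. -/
def linCoeff (p r : ℕ) (d e : ℕ → ℕ) (j : ℕ) : ℤ :=
  if j = 1 then 1 else if j < r then invRes p r d e (j - 1) else -invRes p r d e (j - 1)

/-- The numerators over `p` of the summands of the exponent, each placed at the last coordinate it
involves. -/
def phaseTerm (p r : ℕ) (μ d e : ℕ → ℕ) (j : ℕ) : ℤ :=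
  if j = r then 0
  else if j = r + 1 then
    (p ^ boxGap r μ d r : ℕ) * (invRes p r d e (r - 1) : ℤ) ^ 2 * e r
      + 2 * (p ^ ((μ r + d (r - 1)) - (d r + d (r + 1))) : ℕ) * invRes p r d e (r - 1) * e (r + 1)
      + (p ^ boxGap r μ d (r + 1) : ℕ) * (e (r + 1) : ℤ) ^ 2 * invRes p r d e r
  else (p ^ boxGap r μ d j : ℕ) * linCoeff p r d e j * e j

/-- The numerator over `p` of the part of the exponent involving the first `k` coordinates. -/
def phase (p r : ℕ) (μ d : ℕ → ℕ) (k : ℕ) (e : ℕ → ℕ) : ZMod p :=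
  ((∑ j ∈ Finset.Icc 1 k, phaseTerm p r μ d e j : ℤ) : ZMod p)

variable {p r : ℕ} {μ d : ℕ → ℕ}

lemma pow_mul_pow_div {p : ℕ} (hp : p.Prime) {a b g D : ℕ} (h : a + b + 1 = g + D) :
    (p : ℚ) ^ a * (p : ℚ) ^ b / (p : ℚ) ^ D = (p : ℚ) ^ g / p := by
  have hp0 : (p : ℚ) ≠ 0 := by exact_mod_cast hp.ne_zero
  rw [div_eq_div_iff (pow_ne_zero _ hp0) hp0, ← pow_add, ← pow_succ, ← pow_add, h]

lemma expArg_eq_sum_phaseTerm (hp : p.Prime) (hr : 2 ≤ r) (hμ : ∀ i, 1 ≤ i → i ≤ r → 1 ≤ μ i)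
    (hmem : MemCQ1Le r μ d) (c : Fin (2 * r - 1) → ℕ) :
    expArg p r μ d c
      = ((∑ j ∈ Finset.Icc 1 (2 * r - 1), phaseTerm p r μ d (cext r c) j : ℤ) : ℚ) / p := by
  obtain ⟨hle, hler, hlei⟩ := hmem
  rw [sum_Icc_eq_sum_pairs _ hr, expArg]
  push_cast
  rw [add_div, add_div, Finset.sum_div]
  have hu : ∀ j, uinv p r d c j = invRes p r d (cext r c) j := fun _ => rfl
  simp only [hu]
  congr 1
  congr 1
  · have h1 := hμ 1 le_rfl (by omega)
    have h2 := hle 1 le_rfl (by omega)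
    have h := pow_mul_pow_div hp (a := μ 1 - 1) (b := 0) (g := μ 1 - d 1) (D := d 1) (by omega)
    rw [phaseTerm, if_neg (by omega), if_neg (by omega), linCoeff, if_pos rfl, boxGap,
      if_pos (by omega)]
    push_cast
    linear_combination (cext r c 1 : ℚ) * h
  · refine Finset.sum_congr rfl fun i hi => ?_
    rw [Finset.mem_Icc] at hi
    have h1 := hμ (i + 1) (by omega) (by omega)
    have h2 := hle (i + 1) (by omega) (by omega)
    have h3 := hlei i hi.1 hi.2
    have e1 := pow_mul_pow_div hp (a := μ (i + 1) - 1) (b := 0) (g := μ (i + 1) - d (i + 1))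
      (D := d (i + 1)) (by omega)
    have e2 := pow_mul_pow_div hp (a := μ (i + 1) - 1) (b := d i)
      (g := (μ (i + 1) + d i) - (d (i + 1) + d (2 * r - i)))
      (D := d (i + 1) + d (2 * r - i)) (by omega)
    rw [phaseTerm, if_neg (by omega), if_neg (by omega), linCoeff, if_neg (by omega),
      if_pos (by omega), boxGap, if_pos (by omega), phaseTerm, if_neg (by omega),
      if_neg (by omega), linCoeff, if_neg (by omega), if_neg (by omega), boxGap,
      if_neg (by omega), if_neg (by omega), show 2 * r - (2 * r - i) = i by omega,
      show i + 1 - 1 = i by omega]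
    push_cast
    linear_combination
      (invRes p r d (cext r c) i : ℚ) * (cext r c (i + 1) : ℚ) * e1
      - (cext r c (2 * r - i) : ℚ) * (invRes p r d (cext r c) (2 * r - i - 1) : ℚ) * e2
  · have h1 := hμ r (by omega) le_rfl
    have h2 := hle r (by omega) le_rfl
    have e1 := pow_mul_pow_div hp (a := μ r - 1) (b := 0) (g := μ r - d r) (D := d r) (by omega)
    have e2 := pow_mul_pow_div hp (a := μ r - 1) (b := d (r - 1))
      (g := (μ r + d (r - 1)) - (d r + d (r + 1))) (D := d (r + 1) + d r) (by omega)
    have e3 := pow_mul_pow_div hp (a := μ r - 1) (b := 2 * d (r - 1))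
      (g := (μ r + 2 * d (r - 1)) - (d r + 2 * d (r + 1))) (D := 2 * d (r + 1) + d r) (by omega)
    rw [phaseTerm, if_pos rfl, phaseTerm, if_neg (by omega), if_pos rfl, boxGap, if_pos le_rfl,
      boxGap, if_neg (by omega), if_pos rfl]
    push_cast
    linear_combination
      (invRes p r d (cext r c) (r - 1) : ℚ) ^ 2 * (cext r c r : ℚ) * e1
      + 2 * (invRes p r d (cext r c) (r - 1) : ℚ) * (cext r c (r + 1) : ℚ) * e2
      + (cext r c (r + 1) : ℚ) ^ 2 * (invRes p r d (cext r c) r : ℚ) * e3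

lemma phaseTerm_congr (hr : 2 ≤ r) {e e' : ℕ → ℕ} {j : ℕ} (h : ∀ i ≤ j, e i = e' i) :
    phaseTerm p r μ d e j = phaseTerm p r μ d e' j := by
  have hinv : ∀ i ≤ j, invRes p r d e i = invRes p r d e' i := by
    intro i hi
    rw [invRes, invRes, h i hi]
  unfold phaseTerm
  split_ifs with h1 h2
  · rfl
  · rw [hinv (r - 1) (by omega), hinv r (by omega), h r (by omega), h (r + 1) (by omega)]
  · rw [linCoeff, linCoeff, hinv (j - 1) (by omega), h j le_rfl]

lemma phase_succ_update (hr : 2 ≤ r) (k : ℕ) (e : ℕ → ℕ) (x : ℕ) :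
    phase p r μ d (k + 1) (Function.update e (k + 1) x) = phase p r μ d k e
      + (phaseTerm p r μ d (Function.update e (k + 1) x) (k + 1) : ZMod p) := by
  rw [phase, phase, Finset.sum_Icc_succ_top (by omega), Int.cast_add]
  congr 2
  refine Finset.sum_congr rfl fun j hj => phaseTerm_congr hr fun i hi => ?_
  rw [Finset.mem_Icc] at hj
  exact Function.update_of_ne (by omega) _ _

lemma one_le_Lf (hr : 2 ≤ r) (hd : d 0 = 0) {j : ℕ} (h1 : 1 ≤ j) (h2 : j ≤ 2 * r - 1)
    (hj : 0 < d j) : 1 ≤ Lf r d j := by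
  unfold Lf
  split_ifs with h h'
  · have := Finset.single_le_sum (f := d) (fun _ _ => Nat.zero_le _)
      (Finset.mem_Icc.2 ⟨h1, le_refl j⟩)
    omega
  · subst h'
    omega
  · have hs := Finset.single_le_sum (f := d) (fun _ _ => Nat.zero_le _)
      (Finset.mem_Icc.2 ⟨(by omega : r + 1 ≤ j), le_refl j⟩)
    rcases Nat.eq_zero_or_pos (j - r - 1) with h0 | h0
    · rw [h0, hd]
      omega
    · have := Finset.single_le_sum (f := d) (fun _ _ => Nat.zero_le _)
        (Finset.mem_Icc.2 ⟨(by omega : 1 ≤ j - r - 1), (by omega : j - r - 1 ≤ r - 1)⟩)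
      omega

lemma one_le_Lf_succ (hr : 2 ≤ r) (hd : d 0 = 0) (hj : 0 < d r) : 1 ≤ Lf r d (r + 1) := by
  rw [Lf, if_neg (by omega), if_neg (by omega), show r + 1 - r - 1 = 0 by omega, hd]
  omega

lemma gamB_eq_boxWeight (j : ℕ) :
    gamB p r μ d j = boxWeight p (BoxedB r μ d j) (d j) := by
  simp only [gamB, boxWeight, CircledB]
  congr

variable [hp : Fact p.Prime]

lemma natCast_invRes (hr : 2 ≤ r) (hd : d 0 = 0) {e : ℕ → ℕ} {j : ℕ} (h1 : 1 ≤ j)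
    (h2 : j ≤ 2 * r - 1) (he : e j ∈ residues p (Lf r d j) (d j)) :
    (invRes p r d e j : ZMod p) = if d j = 0 then 0 else (e j : ZMod p)⁻¹ := by
  unfold invRes
  split_ifs with h
  · simp
  · have hj : 0 < d j := by omega
    exact natCast_val_inv (one_le_Lf hr hd h1 h2 hj) ((Finset.mem_filter.1 he).2 hj)

lemma natCast_invRes_ne_zero (hr : 2 ≤ r) (hd : d 0 = 0) {e : ℕ → ℕ} {j : ℕ} (h1 : 1 ≤ j)
    (h2 : j ≤ 2 * r - 1) (he : e j ∈ residues p (Lf r d j) (d j)) (hj : 0 < d j) :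
    (invRes p r d e j : ZMod p) ≠ 0 := by
  rw [natCast_invRes hr hd h1 h2 he, if_neg hj.ne']
  exact inv_ne_zero ((coprime_iff_natCast_ne_zero _).1 ((Finset.mem_filter.1 he).2 hj))

lemma natCast_pow_boxGap (hmem : MemCQ1Le r μ d) {j : ℕ} (h1 : 1 ≤ j) (h2 : j ≤ 2 * r - 1) :
    ((p ^ boxGap r μ d j : ℕ) : ZMod p) = if BoxedB r μ d j then 1 else 0 := by
  obtain ⟨hle, hler, hlei⟩ := hmem
  have hcond : ∀ {A B : ℕ}, B ≤ A → boxGap r μ d j = A - B → (BoxedB r μ d j ↔ A = B) →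
      ((p ^ boxGap r μ d j : ℕ) : ZMod p) = if BoxedB r μ d j then 1 else 0 := by
    intro A B hBA hgap hbox
    rw [hgap, natCast_pow_sub hBA]
    simp only [hbox]
  by_cases h : j ≤ r
  · refine hcond (hle j h1 h) (by simp [boxGap, h]) ?_
    simp [BoxedB, h, eq_comm]
  · by_cases h' : j = r + 1
    · subst h'
      refine hcond (A := μ r + 2 * d (r - 1)) (B := d r + 2 * d (r + 1)) (by omega)
        (by simp [boxGap]) ?_
      simp only [BoxedB, h, if_false, if_true]
      omega
    · have h3 := hlei (2 * r - j) (by omega) (by omega)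
      rw [show 2 * r - (2 * r - j) = j by omega] at h3
      refine hcond (A := μ (2 * r - j + 1) + d (2 * r - j)) (B := d (2 * r - j + 1) + d j)
        (by omega) (by simp [boxGap, h, h']) ?_
      simp only [BoxedB, h, h', if_false]
      omega

lemma linCoeff_ne_zero_of_boxedB (hr : 2 ≤ r) (hμ : ∀ i, 1 ≤ i → i ≤ r → 1 ≤ μ i) (hd : d 0 = 0)
    (hdiv : Divis r μ d) {e : ℕ → ℕ} {j : ℕ} (h1 : 1 ≤ j) (h2 : j ≤ 2 * r - 1)
    (hjr : j ≠ r) (hjr' : j ≠ r + 1)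
    (he : ∀ i, 1 ≤ i → i < j → e i ∈ residues p (Lf r d i) (d i)) (hB : BoxedB r μ d j) :
    0 < d j ∧ (linCoeff p r d e j : ZMod p) ≠ 0 := by
  obtain ⟨hdiv1, hdiv2, -⟩ := hdiv
  have key : ∀ i, 1 ≤ i → i < j → 0 < d i → (invRes p r d e i : ZMod p) ≠ 0 :=
    fun i hi hij => natCast_invRes_ne_zero hr hd hi (by omega) (he i hi hij)
  unfold BoxedB at hB
  unfold linCoeff
  by_cases hlt : j < r
  · rw [if_pos hlt.le] at hB
    have hμj := hμ j h1 hlt.le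
    refine ⟨by omega, ?_⟩
    by_cases hj1 : j = 1
    · simp [hj1]
    · have h3 := hdiv1 (j - 1) (by omega) (by omega)
      rw [show j - 1 + 1 = j by omega] at h3
      simpa [hj1, hlt] using key (j - 1) (by omega) (by omega) (by omega)
  · rw [if_neg (by omega), if_neg hjr'] at hB
    have h3 := hdiv1 (2 * r - j) (by omega) (by omega)
    have h4 := hdiv2 (2 * r - j) (by omega) (by omega)
    have hμj := hμ (2 * r - j + 1) (by omega) (by omega)
    rw [show 2 * r - (2 * r - j) = j by omega] at h4
    have hj1 : j ≠ 1 := by omega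
    refine ⟨by omega, ?_⟩
    simpa [hj1, hlt] using key (j - 1) (by omega) (by omega) (by omega)

/-- Summing out a coordinate on which the exponent depends linearly. -/
lemma sum_phase_linear (hr : 2 ≤ r) (hμ : ∀ i, 1 ≤ i → i ≤ r → 1 ≤ μ i) (hd : d 0 = 0)
    (hdiv : Divis r μ d) (hmem : MemCQ1Le r μ d) {e : ℕ → ℕ} {k : ℕ} (hk : k + 1 ≤ 2 * r - 1)
    (hkr : k + 1 ≠ r) (hkr' : k ≠ r)
    (he : ∀ i, 1 ≤ i → i ≤ k → e i ∈ residues p (Lf r d i) (d i)) :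
    ∑ x ∈ residues p (Lf r d (k + 1)) (d (k + 1)),
      (ZMod.stdAddChar (phase p r μ d (k + 1) (Function.update e (k + 1) x)) : ℂ)
      = ZMod.stdAddChar (phase p r μ d k e)
        * ((p : ℂ) ^ Lf r d (k + 1) * gamB p r μ d (k + 1)) := by
  have hlin : ∀ x, linCoeff p r d (Function.update e (k + 1) x) (k + 1)
      = linCoeff p r d e (k + 1) := by
    intro x
    simp [linCoeff, invRes]
  have hterm : ∀ x, (phaseTerm p r μ d (Function.update e (k + 1) x) (k + 1) : ZMod p)
      = (if BoxedB r μ d (k + 1) then 1 else 0) * (linCoeff p r d e (k + 1) : ZMod p) * x := by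
    intro x
    rw [phaseTerm, if_neg hkr, if_neg (by omega), hlin, Function.update_self, Int.cast_mul,
      Int.cast_mul, Int.cast_natCast, natCast_pow_boxGap hmem (by omega) hk, Int.cast_natCast]
  simp only [phase_succ_update hr, AddChar.map_add_eq_mul, hterm, ← Finset.mul_sum]
  rw [sum_residues_stdAddChar_eq_boxWeight (one_le_Lf hr hd (by omega) hk)
    fun h => linCoeff_ne_zero_of_boxedB hr hμ hd hdiv (by omega) hk hkr (by omega)
      (fun i h1 h2 => he i h1 (by omega)) h, gamB_eq_boxWeight]

/-- Summing out the coordinates `r` and `r + 1`. -/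
lemma sum_phase_quadratic {s : ℕ} (hs : r = s + 1) (hr : 2 ≤ r)
    (hμ : ∀ i, 1 ≤ i → i ≤ r → 1 ≤ μ i) (hd : d 0 = 0)
    (hdiv : Divis r μ d) (hmem : MemCQ1Le r μ d) {e : ℕ → ℕ}
    (he : ∀ i, 1 ≤ i → i ≤ s → e i ∈ residues p (Lf r d i) (d i)) :
    ∑ y ∈ residues p (Lf r d r) (d r), ∑ z ∈ residues p (Lf r d (r + 1)) (d (r + 1)),
      (ZMod.stdAddChar (phase p r μ d (r + 1)
        (Function.update (Function.update e r y) (r + 1) z)) : ℂ)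
      = ZMod.stdAddChar (phase p r μ d s e)
        * (((p : ℂ) ^ Lf r d r * gamB p r μ d r)
          * ((p : ℂ) ^ Lf r d (r + 1) * gamB p r μ d (r + 1))) := by
  have hs1 := he s (by omega) le_rfl
  have hrs : r - 1 = s := by omega
  have hmem' := hmem
  obtain ⟨hle, hler, -⟩ := hmem
  obtain ⟨-, -, hdiv3⟩ := hdiv
  rw [hrs] at hler hdiv3
  have hμr := hμ r (by omega) le_rfl
  have hler' := hle r (by omega) le_rfl
  have hBr : BoxedB r μ d r ↔ d r = μ r := by simp [BoxedB]
  have hBr' : BoxedB r μ d (r + 1) ↔ μ r + 2 * d s = d r + 2 * d (r + 1) := by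
    simp only [BoxedB, Nat.not_succ_le_self, if_false, if_true, hrs]
    omega
  have hphase : ∀ y ∈ residues p (Lf r d r) (d r), ∀ z,
      phase p r μ d (r + 1) (Function.update (Function.update e r y) (r + 1) z)
      = phase p r μ d s e + ((if d r = μ r then 1 else 0)
          * (invRes p r d e s : ZMod p) ^ 2 * (y : ZMod p)
        + 2 * (if μ r + d s = d r + d (r + 1) then 1 else 0) * (invRes p r d e s : ZMod p)
            * (z : ZMod p)
        + (if μ r + 2 * d s = d r + 2 * d (r + 1) then 1 else 0) * (z : ZMod p) ^ 2
            * (if d r = 0 then 0 else (y : ZMod p)⁻¹)) := by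
    intro y hy z
    have hfirst : phase p r μ d r (Function.update e r y) = phase p r μ d s e := by
      have h := phase_succ_update (p := p) (μ := μ) (d := d) hr s e y
      rw [← hs] at h
      rw [h, phaseTerm, if_pos rfl]
      simp
    have hur : invRes p r d (Function.update (Function.update e r y) (r + 1) z) r
        = invRes p r d (Function.update e r y) r := by
      simp [invRes]
    have hus : invRes p r d (Function.update (Function.update e r y) (r + 1) z) s
        = invRes p r d e s := by
      rw [invRes, invRes, Function.update_of_ne (by omega), Function.update_of_ne (by omega)]
    have huy := natCast_invRes (p := p) (r := r) (d := d) (e := Function.update e r y) hr hd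
      (by omega : 1 ≤ r) (by omega) (by simpa using hy)
    rw [Function.update_self] at huy
    have hβ : ((p ^ ((μ r + d s) - (d r + d (r + 1))) : ℕ) : ZMod p)
        = if μ r + d s = d r + d (r + 1) then 1 else 0 := natCast_pow_sub (by omega)
    rw [phase_succ_update hr, hfirst, phaseTerm, if_neg (by omega), if_pos rfl, hrs, hur, hus,
      Function.update_self, Function.update_of_ne (by omega), Function.update_self]
    simp only [Int.cast_add, Int.cast_mul, Int.cast_pow, Int.cast_natCast, Int.cast_ofNat]
    rw [hβ, huy, natCast_pow_boxGap hmem' (by omega) (by omega),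
      natCast_pow_boxGap hmem' (by omega) (by omega)]
    simp only [hBr, hBr']
  rw [Finset.sum_congr rfl fun y hy => Finset.sum_congr rfl fun z _ => by
    rw [hphase y hy z, AddChar.map_add_eq_mul]]
  simp only [← Finset.mul_sum]
  rw [gamB_eq_boxWeight, gamB_eq_boxWeight,
    sum_sum_residues_quadratic hμr hler' (by omega) hdiv3
      (one_le_Lf hr hd (by omega) (by omega)) (one_le_Lf hr hd (by omega) (by omega))
      (one_le_Lf_succ hr hd)
      (fun h => by simp [invRes, h])
      (natCast_invRes_ne_zero hr hd (by omega) (by omega) hs1)]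
  simp only [hBr, hBr']

end Phase

/-- The sum over all coordinates after the `k`-th one. -/
def tailSum (p : ℕ) [Fact p.Prime] (r : ℕ) (μ d : ℕ → ℕ) (k : ℕ) (e : ℕ → ℕ) : ℂ :=
  if k = r then
    (∑ z ∈ residues p (Lf r d (r + 1)) (d (r + 1)),
      ZMod.stdAddChar (phase p r μ d (r + 1) (Function.update e (r + 1) z)))
      * ∏ j ∈ Finset.Ioc (r + 1) (2 * r - 1), ((p : ℂ) ^ Lf r d j * gamB p r μ d j)
  else ZMod.stdAddChar (phase p r μ d k e)
    * ∏ j ∈ Finset.Ioc k (2 * r - 1), ((p : ℂ) ^ Lf r d j * gamB p r μ d j)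

lemma prod_Ioc_eq_mul (w : ℕ → ℂ) {k n : ℕ} (h : k + 1 ≤ n) :
    ∏ j ∈ Finset.Ioc k n, w j = w (k + 1) * ∏ j ∈ Finset.Ioc (k + 1) n, w j := by
  rw [← Finset.prod_Ioc_consecutive w (Nat.le_succ k) h, Nat.Ioc_succ_singleton,
    Finset.prod_singleton]

lemma sum_tailSum_succ {p r : ℕ} {μ d : ℕ → ℕ} [Fact p.Prime] (hr : 2 ≤ r)
    (hμ : ∀ i, 1 ≤ i → i ≤ r → 1 ≤ μ i) (hd : d 0 = 0) (hdiv : Divis r μ d)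
    (hmem : MemCQ1Le r μ d) {k : ℕ} (hk : k < 2 * r - 1) (e : ℕ → ℕ)
    (he : ∀ j, 1 ≤ j → j ≤ k → e j ∈ residues p (Lf r d j) (d j)) :
    ∑ x ∈ residues p (Lf r d (k + 1)) (d (k + 1)),
      tailSum p r μ d (k + 1) (Function.update e (k + 1) x) = tailSum p r μ d k e := by
  by_cases hkr : k = r
  · subst hkr
    simp only [tailSum, if_true, Nat.succ_ne_self, if_false, Finset.sum_mul]
  · by_cases hkr1 : k + 1 = r
    · have hq := sum_phase_quadratic hkr1.symm hr hμ hd hdiv hmem he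
      simp only [tailSum, hkr, hkr1, if_true, if_false]
      rw [← Finset.sum_mul, hq, prod_Ioc_eq_mul _ (show k + 1 ≤ 2 * r - 1 by omega), hkr1,
        prod_Ioc_eq_mul _ (show r + 1 ≤ 2 * r - 1 by omega)]
      ring
    · simp only [tailSum, hkr, hkr1, if_false]
      rw [← Finset.sum_mul, sum_phase_linear hr hμ hd hdiv hmem (by omega) hkr1 hkr he,
        prod_Ioc_eq_mul _ (show k + 1 ≤ 2 * r - 1 by omega)]
      ring

/-- If `t ∈ CQ₁^≤(μ)` (and the divisibility conditions hold), then `G(t) = G_Δ(t)`. -/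
theorem stmt3 (p : ℕ) (hp : p.Prime) (hpodd : Odd p) (r : ℕ) (hr : 2 ≤ r)
    (μ : ℕ → ℕ) (hμ : ∀ i, 1 ≤ i → i ≤ r → 1 ≤ μ i)
    (d : ℕ → ℕ) (hd : ∀ j, (j = 0 ∨ 2 * r - 1 < j) → d j = 0)
    (hdiv : Divis r μ d)
    (hmem : MemCQ1Le r μ d) :
    Gexp p r μ d = GDeltaB p r μ d := by
  have : Fact p.Prime := ⟨hp⟩
  have hp0 : (p : ℂ) ≠ 0 := by exact_mod_cast hp.ne_zero
  have hset : (Fintype.piFinset fun j : Fin (2 * r - 1) =>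
        Finset.range (p ^ Lf r d (j.val + 1))).filter
          (fun c => ∀ j : Fin (2 * r - 1), 0 < d (j.val + 1) → Nat.Coprime (c j) p)
      = Fintype.piFinset fun j : Fin (2 * r - 1) =>
          residues p (Lf r d (j.val + 1)) (d (j.val + 1)) := by
    ext c
    simp only [Finset.mem_filter, Fintype.mem_piFinset, residues, forall_and]
  have hpsi : ∀ c, psi (expArg p r μ d c)
      = tailSum p r μ d (2 * r - 1) (tupleExt (2 * r - 1) c) := by
    intro c
    rw [expArg_eq_sum_phaseTerm hp hr hμ hmem, psi_intCast_div, tailSum, if_neg (by omega),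
      Finset.Ioc_self, Finset.prod_empty, mul_one]
    rfl
  rw [Gexp, hset]
  simp only [hpsi]
  rw [sum_piFinset_eq_of_step (fun j => residues p (Lf r d j) (d j)) (tailSum p r μ d) (2 * r - 1)
    fun k hk e he => sum_tailSum_succ hr hμ (hd 0 (Or.inl rfl)) hdiv hmem hk e he,
    tailSum, if_neg (by omega), GDeltaB,
    show Finset.Ioc 0 (2 * r - 1) = Finset.Icc 1 (2 * r - 1) from rfl, phase]
  simp only [zero_lt_one, Finset.Icc_eq_empty_of_lt, Finset.sum_empty, Int.cast_zero,
    AddChar.map_zero_eq_one, one_mul]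
  rw [← Finset.prod_mul_distrib]
  refine Finset.prod_congr rfl fun j _ => ?_
  rw [inv_mul_cancel_left₀ (pow_ne_zero _ hp0)]

end Stmt3
end
end

section
/- Let p be an odd prime, q = p, r ≥ 2, μ ∈ ℤ^r with all μ_i ≥ 1, and let t = (d₁,…,d_{2r−1}) ∈ CQ₁(μ) satisfy the divisibility conditions d_{j+1} ≤ m_{j+1} + d_j and d_{j+1} + d_{2r−j} ≤ m_{j+1} + d_j + d_{2r−j−1} for 1 ≤ j ≤ r−2, and 2d_{r+1} ≤ m_r + 2d_{r−1}, where m_i = μ_i − 1. Suppose d_{r−1} = d_{r+1} and d_r > μ_r. If d_r − μ_r is odd, then the exponential sum G(t) = (1 − q^{−1}) q^{−(d_r − μ_r + 1)/2} · Π_{1≤i≤2r−1, i≠r, i≠r+1} γ(𝔠_i), where 𝔠_i are the decorated entries of Δ(t). If d_r − μ_r is even, then G(t) = 0. -/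
open Finset
open scoped Classical

noncomputable section

namespace Stmt4

/-- `ψ(x) = e^{2πix}`. -/
def psi (y : ℚ) : ℂ := Complex.exp (2 * (Real.pi : ℂ) * Complex.I * (y : ℂ))

/-- The moduli exponents `L₁,…,L_{2r−1}`:
`Lᵢ = d₁+⋯+dᵢ` for `i ≤ r−1`; `L_r = d_r + 2(d₁+⋯+d_{r−1})`;
`L_{r+i'} = d_r − d_{i'−1} + (d_{r+1}+⋯+d_{r+i'}) + (d₁+⋯+d_{r−1})` for `1 ≤ i' ≤ r−1`
(with `d₀ = 0`). -/
def Lf (r : ℕ) (d : ℕ → ℕ) (i : ℕ) : ℕ :=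
  if i ≤ r - 1 then ∑ j ∈ Finset.Icc 1 i, d j
  else if i = r then d r + 2 * ∑ j ∈ Finset.Icc 1 (r - 1), d j
  else (d r + (∑ j ∈ Finset.Icc (r + 1) i, d j) + ∑ j ∈ Finset.Icc 1 (r - 1), d j)
        - d (i - r - 1)

/-- Extension of a `Fin (2r−1)`-tuple of residues to a 1-based function. -/
def cext (r : ℕ) (c : Fin (2 * r - 1) → ℕ) (j : ℕ) : ℕ :=
  if h : 1 ≤ j ∧ j ≤ 2 * r - 1 then c ⟨j - 1, by omega⟩ else 0

/-- `uⱼ`: the inverse of `cⱼ` modulo `p^{Lⱼ}`, taken in `[0, p^{Lⱼ})`, when `dⱼ > 0`;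
`uⱼ = 0` when `dⱼ = 0`. -/
def uinv (p r : ℕ) (d : ℕ → ℕ) (c : Fin (2 * r - 1) → ℕ) (j : ℕ) : ℕ :=
  if d j = 0 then 0 else ((cext r c j : ZMod (p ^ Lf r d j))⁻¹).val

/-- The rational number whose exponential is summed in `G(t)`. -/
def expArg (p r : ℕ) (μ d : ℕ → ℕ) (c : Fin (2 * r - 1) → ℕ) : ℚ :=
  (p : ℚ) ^ (μ 1 - 1) * (cext r c 1 : ℚ) / (p : ℚ) ^ d 1
  + (∑ i ∈ Finset.Icc 1 (r - 2),
      (p : ℚ) ^ (μ (i + 1) - 1) *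
        ((uinv p r d c i : ℚ) * (cext r c (i + 1) : ℚ) / (p : ℚ) ^ d (i + 1)
          - (p : ℚ) ^ d i * (cext r c (2 * r - i) : ℚ) * (uinv p r d c (2 * r - i - 1) : ℚ)
              / (p : ℚ) ^ (d (i + 1) + d (2 * r - i))))
  + (p : ℚ) ^ (μ r - 1) *
      ((uinv p r d c (r - 1) : ℚ) ^ 2 * (cext r c r : ℚ) / (p : ℚ) ^ d r
        + 2 * (p : ℚ) ^ d (r - 1) * (uinv p r d c (r - 1) : ℚ) * (cext r c (r + 1) : ℚ)
            / (p : ℚ) ^ (d (r + 1) + d r)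
        + (p : ℚ) ^ (2 * d (r - 1)) * (cext r c (r + 1) : ℚ) ^ 2 * (uinv p r d c r : ℚ)
            / (p : ℚ) ^ (2 * d (r + 1) + d r))

/-- The exponential sum `G(t)`. -/
def Gexp (p r : ℕ) (μ d : ℕ → ℕ) : ℂ :=
  (∏ k ∈ Finset.Icc 1 (2 * r - 1), ((p : ℂ) ^ Lf r d k)⁻¹) *
    ∑ c ∈ (Fintype.piFinset fun j : Fin (2 * r - 1) =>
              Finset.range (p ^ Lf r d (j.val + 1))).filter
            (fun c => ∀ j : Fin (2 * r - 1), 0 < d (j.val + 1) → Nat.Coprime (c j) p),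
      psi (expArg p r μ d c)

/-- Membership in `CQ₁(μ)`: `dᵢ ≤ μᵢ` for `1 ≤ i ≤ r−1`, and
`d_{2r−i} ≤ μ_{i+1} + dᵢ − d_{i+1}` for `1 ≤ i ≤ r−2`. -/
def MemCQ1 (r : ℕ) (μ d : ℕ → ℕ) : Prop :=
  (∀ i, 1 ≤ i → i ≤ r - 1 → d i ≤ μ i) ∧
    ∀ i, 1 ≤ i → i ≤ r - 2 →
      (d (2 * r - i) : ℤ) ≤ (μ (i + 1) : ℤ) + (d i : ℤ) - (d (i + 1) : ℤ)

/-- The divisibility conditions: `d_{j+1} ≤ m_{j+1} + d_j` and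
`d_{j+1} + d_{2r−j} ≤ m_{j+1} + d_j + d_{2r−j−1}` for `1 ≤ j ≤ r−2`, and
`2d_{r+1} ≤ m_r + 2d_{r−1}`, where `mᵢ = μᵢ − 1`. -/
def Divis (r : ℕ) (μ d : ℕ → ℕ) : Prop :=
  (∀ j, 1 ≤ j → j ≤ r - 2 → d (j + 1) ≤ (μ (j + 1) - 1) + d j) ∧
  (∀ j, 1 ≤ j → j ≤ r - 2 →
      d (j + 1) + d (2 * r - j) ≤ (μ (j + 1) - 1) + d j + d (2 * r - j - 1)) ∧
  2 * d (r + 1) ≤ (μ r - 1) + 2 * d (r - 1)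

def CircledB (d : ℕ → ℕ) (i : ℕ) : Prop := d i = 0

/-- The entry `𝔠ᵢ` of `Δ(t)` is boxed iff: `dᵢ = μᵢ` (for `i ≤ r`);
`d_r = μ_r + 2(d_{r−1} − d_{r+1})` (for `i = r+1`); and
`d_{2r−i} = μ_{i+1} + dᵢ − d_{i+1}`, rewritten at index `i`, otherwise. -/
def BoxedB (r : ℕ) (μ d : ℕ → ℕ) (i : ℕ) : Prop :=
  if i ≤ r then d i = μ i
  else if i = r + 1 then
    (d r : ℤ) = (μ r : ℤ) + 2 * ((d (r - 1) : ℤ) - (d (r + 1) : ℤ))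
  else
    (d i : ℤ) = (μ (2 * r - i + 1) : ℤ) + (d (2 * r - i) : ℤ) - (d (2 * r - i + 1) : ℤ)

/-- `γ(𝔠ᵢ)`, with `q = p`. -/
def gamB (p r : ℕ) (μ d : ℕ → ℕ) (i : ℕ) : ℂ :=
  if BoxedB r μ d i then (if CircledB d i then 0 else -((p : ℂ))⁻¹)
  else (if CircledB d i then 1 else 1 - ((p : ℂ))⁻¹)

/-- `G_Δ(t) = ∏_{i=1}^{2r−1} γ(𝔠ᵢ)`. -/
def GDeltaB (p r : ℕ) (μ d : ℕ → ℕ) : ℂ :=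
  ∏ i ∈ Finset.Icc 1 (2 * r - 1), gamB p r μ d i

lemma psi_add (x y : ℚ) : psi (x + y) = psi x * psi y := by
  unfold psi
  rw [← Complex.exp_add]
  push_cast
  ring_nf

lemma psi_sum {ι : Type*} (s : Finset ι) (f : ι → ℚ) :
    psi (∑ i ∈ s, f i) = ∏ i ∈ s, psi (f i) := by
  induction s using Finset.induction_on with
  | empty => simp [psi]
  | insert a s ha ih => rw [Finset.sum_insert ha, Finset.prod_insert ha, psi_add, ih]

lemma psi_intCast_div (M : ℕ) [NeZero M] (z : ℤ) :
    psi ((z : ℚ) / (M : ℚ)) = ZMod.stdAddChar (z : ZMod M) := by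
  rw [ZMod.stdAddChar_coe, psi]
  push_cast
  ring_nf

lemma psi_intCast (z : ℤ) : psi (z : ℚ) = 1 := by
  rw [psi, Complex.exp_eq_one_iff]
  exact ⟨z, by push_cast; ring⟩

/-- Summing a function of period `M` over `k` periods. -/
lemma sum_range_mul_of_periodic {M : ℕ} {h : ℕ → ℂ} (hh : Function.Periodic h M) (k : ℕ) :
    ∑ x ∈ range (M * k), h x = k * ∑ x ∈ range M, h x := by
  induction k with
  | zero => simp
  | succ k ih =>
    rw [Nat.mul_succ, Finset.sum_range_add, ih]
    have : ∀ x, h (M * k + x) = h x := fun x => by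
      rw [add_comm, mul_comm]
      exact hh.nat_mul k x
    simp only [this]
    push_cast
    ring

lemma sum_range_zmod (M : ℕ) [NeZero M] (g : ZMod M → ℂ) :
    ∑ x ∈ range M, g (x : ZMod M) = ∑ x : ZMod M, g x := by
  refine Finset.sum_bij' (fun x _ => (x : ZMod M)) (fun x _ => x.val) ?_ ?_ ?_ ?_ ?_
  · simp
  · intro x _
    simpa using ZMod.val_lt x
  · intro x hx
    exact ZMod.val_cast_of_lt (by simpa using hx)
  · simp
  · simp

lemma isUnit_natCast_zmod_pow {p N : ℕ} (hN : 0 < N) (x : ℕ) :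
    IsUnit (x : ZMod (p ^ N)) ↔ x.Coprime p := by
  rw [ZMod.isUnit_iff_coprime, Nat.coprime_pow_right_iff hN]

/-- Sums over residues modulo `p ^ L` (possibly prime to `p`) of a function of the class
modulo `p ^ N`. -/
lemma sum_range_filter_coprime {p N L : ℕ} [NeZero p] (hN : 0 < N) (hL : N ≤ L) (Q : Prop) [Decidable Q]
    (g : ZMod (p ^ N) → ℂ) :
    ∑ x ∈ (range (p ^ L)).filter (fun x => Q → x.Coprime p), g (x : ZMod (p ^ N)) =
      (p : ℂ) ^ (L - N) * ∑ x : ZMod (p ^ N) with (Q → IsUnit x), g x := by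
  have hpow : p ^ L = p ^ N * p ^ (L - N) := by rw [← pow_add]; congr 1; omega
  rw [Finset.sum_filter, Finset.sum_filter]
  simp only [← isUnit_natCast_zmod_pow (p := p) hN]
  rw [hpow, sum_range_mul_of_periodic, Nat.cast_pow,
    ← sum_range_zmod (p ^ N) (fun x => if Q → IsUnit x then g x else 0)]
  intro x
  simp

lemma sum_range_filter_dvd {p : ℕ} (hp : 0 < p) (n : ℕ) (g : ℕ → ℂ) :
    ∑ x ∈ (range (p ^ (n + 1))).filter (fun x => p ∣ x), g x =
      ∑ t ∈ range (p ^ n), g (p * t) := by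
  symm
  refine Finset.sum_bij (fun t _ => p * t) ?_ ?_ ?_ ?_
  · intro t ht
    simp only [mem_filter, mem_range, dvd_mul_right, and_true] at ht ⊢
    rw [pow_succ']
    exact Nat.mul_lt_mul_of_pos_left ht hp
  · intro a _ b _ h
    exact Nat.eq_of_mul_eq_mul_left hp h
  · intro b hb
    simp only [mem_filter, mem_range] at hb
    obtain ⟨hb, t, rfl⟩ := hb
    refine ⟨t, ?_, rfl⟩
    rw [pow_succ'] at hb
    simpa using Nat.lt_of_mul_lt_mul_left hb
  · simp

lemma natCast_pow_eq_zero (p N : ℕ) : ((p : ZMod (p ^ N))) ^ N = 0 := by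
  rw [← Nat.cast_pow, ZMod.natCast_self]

/-- The Ramanujan sum modulo a prime power. -/
lemma sum_isUnit_stdAddChar {p : ℕ} [hp : Fact p.Prime] (n : ℕ) (w : ZMod (p ^ (n + 1))) :
    ∑ x : ZMod (p ^ (n + 1)) with IsUnit x, ZMod.stdAddChar (x * w) =
      (if w = 0 then (p : ℂ) ^ (n + 1) else 0) - (if p * w = 0 then (p : ℂ) ^ n else 0) := by
  have hp0 : (p : ℂ) ≠ 0 := by exact_mod_cast hp.out.ne_zero
  have hfull : ∀ b : ZMod (p ^ (n + 1)), ∑ x, ZMod.stdAddChar (x * b) =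
      if b = 0 then (p : ℂ) ^ (n + 1) else 0 := fun b => by
    rw [AddChar.sum_mulShift b (ZMod.isPrimitive_stdAddChar _), ZMod.card]
    push_cast
    rfl
  have hnon : ∑ x : ZMod (p ^ (n + 1)) with ¬ IsUnit x, ZMod.stdAddChar (x * w) =
      if p * w = 0 then (p : ℂ) ^ n else 0 := by
    rw [Finset.sum_filter,
      ← sum_range_zmod _ (fun x => if ¬ IsUnit x then ZMod.stdAddChar (x * w) else 0)]
    simp only [isUnit_natCast_zmod_pow n.succ_pos, Nat.coprime_comm (m := p),
      hp.out.coprime_iff_not_dvd, not_not]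
    rw [← Finset.sum_filter, sum_range_filter_dvd hp.out.pos]
    have hper : Function.Periodic (fun t : ℕ =>
        (ZMod.stdAddChar (((p * t : ℕ) : ZMod (p ^ (n + 1))) * w) : ℂ)) (p ^ n) := by
      intro t
      have : ((p * (t + p ^ n) : ℕ) : ZMod (p ^ (n + 1))) = ((p * t : ℕ) : ZMod (p ^ (n + 1))) := by
        have h := natCast_pow_eq_zero p (n + 1)
        push_cast
        rw [mul_add, ← pow_succ', h, add_zero]
      simp only [this]
    have h1 := sum_range_mul_of_periodic hper p
    rw [← pow_succ] at h1
    have h2 := hfull (p * w)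
    rw [← sum_range_zmod _ (fun x => ZMod.stdAddChar (x * ((p : ZMod (p ^ (n + 1))) * w)))] at h2
    have h3 : ∀ x : ℕ, (x : ZMod (p ^ (n + 1))) * (p * w) = ((p * x : ℕ) : ZMod (p ^ (n + 1))) * w :=
      fun x => by push_cast; ring
    simp only [h3] at h2
    rw [h2] at h1
    apply mul_left_cancel₀ hp0
    rw [← h1]
    split_ifs <;> ring
  rw [← hnon, ← hfull w, eq_sub_iff_add_eq, Finset.sum_filter_add_sum_filter_not]

lemma card_filter_dvd_range_mul {a : ℕ} (ha : 0 < a) (b : ℕ) :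
    ((range (a * b)).filter (fun z => a ∣ z)).card = b := by
  rw [show (range (a * b)).filter (fun z => a ∣ z) = (range b).image (fun t => a * t) from ?_]
  · rw [Finset.card_image_of_injective _ (fun x y h => Nat.eq_of_mul_eq_mul_left ha h), card_range]
  · ext z
    simp only [mem_filter, mem_range, mem_image]
    constructor
    · rintro ⟨h, t, rfl⟩
      exact ⟨t, Nat.lt_of_mul_lt_mul_left h, rfl⟩
    · rintro ⟨t, ht, rfl⟩
      exact ⟨Nat.mul_lt_mul_of_pos_left ht ha, dvd_mul_right _ _⟩

lemma pow_dvd_sq_iff {p : ℕ} (hp : p.Prime) (k z : ℕ) : p ^ k ∣ z ^ 2 ↔ p ^ ((k + 1) / 2) ∣ z := by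
  rcases eq_or_ne z 0 with rfl | hz
  · simp
  rw [hp.pow_dvd_iff_le_factorization (pow_ne_zero 2 hz), hp.pow_dvd_iff_le_factorization hz,
    Nat.factorization_pow]
  simp only [Finsupp.smul_apply, smul_eq_mul]
  omega

lemma card_filter_pow_dvd_sq {p : ℕ} (hp : p.Prime) {k N : ℕ} (hk : k ≤ N) :
    ((range (p ^ N)).filter (fun z => p ^ k ∣ z ^ 2)).card = p ^ (N - (k + 1) / 2) := by
  simp only [pow_dvd_sq_iff hp]
  have : p ^ N = p ^ ((k + 1) / 2) * p ^ (N - (k + 1) / 2) := by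
    rw [← pow_add]; congr 1; omega
  rw [this, card_filter_dvd_range_mul (pow_pos hp.pos _)]

/-- The quadratic Gauss sum modulo `p ^ (n + 1)` averaged over units. -/
lemma sum_isUnit_sum_sq {p : ℕ} [hp : Fact p.Prime] (n : ℕ) :
    ∑ x : ZMod (p ^ (n + 1)) with IsUnit x, ∑ z : ZMod (p ^ (n + 1)),
        (ZMod.stdAddChar (x * z ^ 2) : ℂ) =
      (p : ℂ) ^ (n + 1) * (p : ℂ) ^ (n + 1 - (n + 2) / 2) -
        (p : ℂ) ^ n * (p : ℂ) ^ (n + 1 - (n + 1) / 2) := by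
  rw [Finset.sum_comm]
  simp only [sum_isUnit_stdAddChar]
  rw [← sum_range_zmod _ (fun z : ZMod (p ^ (n + 1)) => (if z ^ 2 = 0 then (p : ℂ) ^ (n + 1) else 0) -
    (if (p : ZMod (p ^ (n + 1))) * z ^ 2 = 0 then (p : ℂ) ^ n else 0)), Finset.sum_sub_distrib]
  have h1 : ∀ z : ℕ, (z : ZMod (p ^ (n + 1))) ^ 2 = 0 ↔ p ^ (n + 1) ∣ z ^ 2 := fun z => by
    rw [← Nat.cast_pow, ZMod.natCast_eq_zero_iff]
  have h2 : ∀ z : ℕ, (p : ZMod (p ^ (n + 1))) * (z : ZMod (p ^ (n + 1))) ^ 2 = 0 ↔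
      p ^ n ∣ z ^ 2 := fun z => by
    rw [← Nat.cast_pow, ← Nat.cast_mul, ZMod.natCast_eq_zero_iff, pow_succ',
      Nat.mul_dvd_mul_iff_left hp.out.pos]
  simp only [h1, h2]
  rw [← Finset.sum_filter, ← Finset.sum_filter, Finset.sum_const, Finset.sum_const,
    card_filter_pow_dvd_sq hp.out le_rfl, card_filter_pow_dvd_sq hp.out n.le_succ]
  simp only [nsmul_eq_mul, Nat.cast_pow]
  ring

lemma pow_mul_eq_zero_of_not_isUnit {p : ℕ} [hp : Fact p.Prime] {n : ℕ} {y : ZMod (p ^ (n + 1))}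
    (hy : ¬ IsUnit y) : (p : ZMod (p ^ (n + 1))) ^ n * y = 0 := by
  rw [← ZMod.natCast_zmod_val y] at hy ⊢
  rw [isUnit_natCast_zmod_pow n.succ_pos, Nat.coprime_comm, hp.out.coprime_iff_not_dvd,
    not_not] at hy
  obtain ⟨t, ht⟩ := hy
  rw [ht]
  have h := natCast_pow_eq_zero p (n + 1)
  push_cast
  rw [← mul_assoc, ← pow_succ, h, zero_mul]

lemma not_isUnit_add_prime_pow {p : ℕ} [hp : Fact p.Prime] {n : ℕ} (hn : 1 ≤ n)
    {y : ZMod (p ^ (n + 1))} (hy : ¬ IsUnit y) :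
    ¬ IsUnit (y + (p : ZMod (p ^ (n + 1))) ^ n) := by
  intro h
  obtain ⟨m, rfl⟩ : ∃ m, n = m + 1 := ⟨n - 1, by omega⟩
  have h0 := natCast_pow_eq_zero p (m + 1 + 1)
  have : (p : ZMod (p ^ (m + 1 + 1))) ^ (m + 1) * (y + (p : ZMod (p ^ (m + 1 + 1))) ^ (m + 1)) = 0 := by
    rw [mul_add, pow_mul_eq_zero_of_not_isUnit hy, zero_add]
    linear_combination (p : ZMod (p ^ (m + 1 + 1))) ^ m * h0
  rw [h.mul_left_eq_zero, ← Nat.cast_pow, ZMod.natCast_eq_zero_iff,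
    Nat.pow_dvd_pow_iff_le_right hp.out.one_lt] at this
  omega

/-- Non-units contribute nothing to a quadratic Gauss sum shifted by a unit. -/
lemma sum_not_isUnit_eq_zero {p : ℕ} [hp : Fact p.Prime] (hodd : Odd p) {n : ℕ} (hn : 1 ≤ n)
    {u x : ZMod (p ^ (n + 1))} (hu : IsUnit u) :
    ∑ y : ZMod (p ^ (n + 1)) with ¬ IsUnit y,
      (ZMod.stdAddChar (u ^ 2 * x + 2 * u * y + y ^ 2 * x⁻¹) : ℂ) = 0 := by
  set P : ZMod (p ^ (n + 1)) := (p : ZMod (p ^ (n + 1))) ^ n with hP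
  have h0 := natCast_pow_eq_zero p (n + 1)
  have hPP : P * P = 0 := by
    obtain ⟨m, rfl⟩ : ∃ m, n = m + 1 := ⟨n - 1, by omega⟩
    rw [hP]
    linear_combination (p : ZMod (p ^ (m + 1 + 1))) ^ m * h0
  have hnegP : ∀ y : ZMod (p ^ (n + 1)), ¬ IsUnit y → ¬ IsUnit (y - P) := by
    intro y hy
    have := not_isUnit_add_prime_pow hn (y := -y) (by simpa using hy)
    rw [← IsUnit.neg_iff] at this
    convert this using 2
    ring
  have hne : (ZMod.stdAddChar (2 * u * P) : ℂ) ≠ 1 := by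
    intro h
    rw [← AddChar.map_zero_eq_one (ZMod.stdAddChar (N := p ^ (n + 1)))] at h
    have h3 := ZMod.injective_stdAddChar h
    have h2 : IsUnit (2 : ZMod (p ^ (n + 1))) := by
      have := (isUnit_natCast_zmod_pow (p := p) n.succ_pos 2).2 (Nat.coprime_two_left.2 hodd)
      simpa using this
    rw [(h2.mul hu).mul_right_eq_zero, hP, ← Nat.cast_pow, ZMod.natCast_eq_zero_iff,
      Nat.pow_dvd_pow_iff_le_right hp.out.one_lt] at h3
    omega
  have key : ∑ y : ZMod (p ^ (n + 1)) with ¬ IsUnit y,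
      (ZMod.stdAddChar (u ^ 2 * x + 2 * u * y + y ^ 2 * x⁻¹) : ℂ) =
      ZMod.stdAddChar (2 * u * P) * ∑ y : ZMod (p ^ (n + 1)) with ¬ IsUnit y,
      (ZMod.stdAddChar (u ^ 2 * x + 2 * u * y + y ^ 2 * x⁻¹) : ℂ) := by
    rw [Finset.mul_sum]
    refine Finset.sum_bij' (fun y _ => y - P) (fun y _ => y + P) ?_ ?_ ?_ ?_ ?_
    · intro y hy
      simpa using hnegP y (by simpa using hy)
    · intro y hy
      simpa using not_isUnit_add_prime_pow hn (by simpa using hy)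
    · simp
    · simp
    · intro y hy
      have hy0 : P * y = 0 := pow_mul_eq_zero_of_not_isUnit (by simpa using hy)
      rw [← AddChar.map_add_eq_mul]
      congr 1
      linear_combination (2 * x⁻¹) * hy0 - x⁻¹ * hPP
  by_contra hS
  exact hne (mul_right_cancel₀ hS (by rw [one_mul]; exact key.symm))

lemma sum_isUnit_sum_middle {p : ℕ} [hp : Fact p.Prime] (hodd : Odd p) {n : ℕ} (hn : 1 ≤ n)
    {Q : Prop} [Decidable Q] {u : ZMod (p ^ (n + 1))} (hu : Q → IsUnit u) :
    ∑ x : ZMod (p ^ (n + 1)) with IsUnit x, ∑ y : ZMod (p ^ (n + 1)) with (Q → IsUnit y),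
        (ZMod.stdAddChar (u ^ 2 * x + 2 * u * y + y ^ 2 * x⁻¹) : ℂ) =
      ∑ x : ZMod (p ^ (n + 1)) with IsUnit x, ∑ z : ZMod (p ^ (n + 1)),
        (ZMod.stdAddChar (x * z ^ 2) : ℂ) := by
  have hinv : ∀ x : ZMod (p ^ (n + 1)), IsUnit x → x⁻¹ * x = 1 := fun x hx =>
    ZMod.inv_mul_of_unit x hx
  have hinvunit : ∀ x : ZMod (p ^ (n + 1)), IsUnit x → IsUnit x⁻¹ := fun x hx =>
    IsUnit.of_mul_eq_one x (hinv x hx)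
  have hinvinv : ∀ x : ZMod (p ^ (n + 1)), IsUnit x → x⁻¹⁻¹ = x := fun x hx => by
    have h1 := hinv x hx
    have h2 := hinv _ (hinvunit x hx)
    linear_combination x * h2 - x⁻¹⁻¹ * h1
  have step : ∀ x : ZMod (p ^ (n + 1)), IsUnit x →
      ∑ y : ZMod (p ^ (n + 1)) with (Q → IsUnit y),
        (ZMod.stdAddChar (u ^ 2 * x + 2 * u * y + y ^ 2 * x⁻¹) : ℂ) =
      ∑ z : ZMod (p ^ (n + 1)), (ZMod.stdAddChar (x⁻¹ * z ^ 2) : ℂ) := by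
    intro x hx
    have hfull : ∑ y : ZMod (p ^ (n + 1)) with (Q → IsUnit y),
        (ZMod.stdAddChar (u ^ 2 * x + 2 * u * y + y ^ 2 * x⁻¹) : ℂ) =
        ∑ y : ZMod (p ^ (n + 1)),
          (ZMod.stdAddChar (u ^ 2 * x + 2 * u * y + y ^ 2 * x⁻¹) : ℂ) := by
      by_cases hQ : Q
      · simp only [hQ, true_imp_iff]
        rw [← Finset.sum_filter_add_sum_filter_not univ (fun y : ZMod (p ^ (n + 1)) => IsUnit y),
          sum_not_isUnit_eq_zero hodd hn (hu hQ), add_zero]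
      · simp [hQ]
    rw [hfull]
    refine Fintype.sum_equiv (Equiv.addLeft (u * x)) _ _ fun y => congrArg _ ?_
    simp only [Equiv.coe_addLeft]
    linear_combination (-(2 * u * y) - u ^ 2 * x) * hinv x hx
  rw [Finset.sum_congr rfl fun x hx => step x (by simpa using hx)]
  refine Finset.sum_bij' (fun x _ => x⁻¹) (fun x _ => x⁻¹) ?_ ?_ ?_ ?_ ?_
  · intro x hx
    simpa using hinvunit x (by simpa using hx)
  · intro x hx
    simpa using hinvunit x (by simpa using hx)
  · intro x hx
    exact hinvinv x (by simpa using hx)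
  · intro x hx
    exact hinvinv x (by simpa using hx)
  · simp

/-- Replace the `k`-th coordinate (counted from `1`) of a tuple. -/
def setCoord {n : ℕ} (c : Fin n → ℕ) (k x : ℕ) : Fin n → ℕ :=
  fun i => if i.val + 1 = k then x else c i

lemma mem_piFinset_setCoord {n : ℕ} {S : ℕ → Finset ℕ} {c : Fin n → ℕ} {k x : ℕ}
    (hc : c ∈ Fintype.piFinset fun j : Fin n => S (j.val + 1)) (hx : x ∈ S k) :
    setCoord c k x ∈ Fintype.piFinset fun j : Fin n => S (j.val + 1) := by
  rw [Fintype.mem_piFinset] at hc ⊢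
  intro j
  unfold setCoord
  split_ifs with h
  · rwa [h]
  · exact hc j

lemma card_mul_sum_piFinset {n : ℕ} (S : ℕ → Finset ℕ) (g : (Fin n → ℕ) → ℂ) {k : ℕ}
    (hk : 1 ≤ k) (hkn : k ≤ n) :
    ((S k).card : ℂ) * ∑ c ∈ Fintype.piFinset (fun j : Fin n => S (j.val + 1)), g c =
      ∑ c ∈ Fintype.piFinset (fun j : Fin n => S (j.val + 1)),
        ∑ x ∈ S k, g (setCoord c k x) := by
  have hkk : k - 1 + 1 = k := by omega
  have hcoord : ∀ c ∈ Fintype.piFinset (fun j : Fin n => S (j.val + 1)),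
      c ⟨k - 1, by omega⟩ ∈ S k := by
    intro c hc
    have := (Fintype.mem_piFinset.1 hc) ⟨k - 1, by omega⟩
    simpa only [hkk] using this
  have hback : ∀ (c : Fin n → ℕ) (x : ℕ),
      setCoord (setCoord c k x) k (c ⟨k - 1, by omega⟩) = c := by
    intro c x
    funext i
    unfold setCoord
    split_ifs with h
    · congr 1
      ext
      simp only
      omega
    · rfl
  have hval : ∀ (c : Fin n → ℕ) (x : ℕ), setCoord c k x ⟨k - 1, by omega⟩ = x := by
    intro c x
    simp [setCoord, hkk]
  have hL : ((S k).card : ℂ) * ∑ c ∈ Fintype.piFinset (fun j : Fin n => S (j.val + 1)), g c =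
      ∑ c ∈ Fintype.piFinset (fun j : Fin n => S (j.val + 1)), ∑ _x ∈ S k, g c := by
    simp only [Finset.sum_const, nsmul_eq_mul, Finset.mul_sum]
  rw [hL, ← Finset.sum_product', ← Finset.sum_product']
  refine Finset.sum_bij' (fun q _ => (setCoord q.1 k q.2, q.1 ⟨k - 1, by omega⟩))
    (fun q _ => (setCoord q.1 k q.2, q.1 ⟨k - 1, by omega⟩)) ?_ ?_ ?_ ?_ ?_
  · rintro ⟨c, x⟩ h
    rw [Finset.mem_product] at h ⊢
    exact ⟨mem_piFinset_setCoord h.1 h.2, hcoord c h.1⟩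
  · rintro ⟨c, x⟩ h
    rw [Finset.mem_product] at h ⊢
    exact ⟨mem_piFinset_setCoord h.1 h.2, hcoord c h.1⟩
  · rintro ⟨c, x⟩ _
    simp only [hback, hval]
  · rintro ⟨c, x⟩ _
    simp only [hback, hval]
  · rintro ⟨c, x⟩ _
    simp only [hback]

/-- Integrate out one coordinate. -/
lemma card_mul_sum_mul {n : ℕ} (S : ℕ → Finset ℕ) (H φ : (Fin n → ℕ) → ℂ) {k : ℕ}
    (hk : 1 ≤ k) (hkn : k ≤ n) (hH : ∀ c x, H (setCoord c k x) = H c) {K : ℂ}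
    (hφ : ∀ c ∈ Fintype.piFinset (fun j : Fin n => S (j.val + 1)),
      ∑ x ∈ S k, φ (setCoord c k x) = K) :
    ((S k).card : ℂ) * ∑ c ∈ Fintype.piFinset (fun j : Fin n => S (j.val + 1)), H c * φ c =
      K * ∑ c ∈ Fintype.piFinset (fun j : Fin n => S (j.val + 1)), H c := by
  rw [card_mul_sum_piFinset S _ hk hkn, Finset.mul_sum]
  refine Finset.sum_congr rfl fun c hc => ?_
  simp only [hH]
  rw [← Finset.mul_sum, hφ c hc, mul_comm]

/-- Integrate out two coordinates simultaneously. -/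
lemma card_mul_card_mul_sum_mul {n : ℕ} (S : ℕ → Finset ℕ) (H φ : (Fin n → ℕ) → ℂ) {k l : ℕ}
    (hk : 1 ≤ k) (hkn : k ≤ n) (hl : 1 ≤ l) (hln : l ≤ n)
    (hHk : ∀ c x, H (setCoord c k x) = H c) (hHl : ∀ c x, H (setCoord c l x) = H c) {K : ℂ}
    (hφ : ∀ c ∈ Fintype.piFinset (fun j : Fin n => S (j.val + 1)),
      ∑ x ∈ S k, ∑ y ∈ S l, φ (setCoord (setCoord c k x) l y) = K) :
    ((S k).card : ℂ) * (S l).card *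
        ∑ c ∈ Fintype.piFinset (fun j : Fin n => S (j.val + 1)), H c * φ c =
      K * ∑ c ∈ Fintype.piFinset (fun j : Fin n => S (j.val + 1)), H c := by
  rw [mul_assoc, card_mul_sum_piFinset S _ hl hln, card_mul_sum_piFinset S _ hk hkn,
    Finset.mul_sum]
  refine Finset.sum_congr rfl fun c hc => ?_
  simp only [hHk, hHl]
  simp only [← Finset.mul_sum]
  rw [hφ c hc, mul_comm]

/-- Integrate out a chain of coordinates, the last one first. -/
lemma prod_card_mul_sum_mul_prod {N : ℕ} (S : ℕ → Finset ℕ) (H : (Fin N → ℕ) → ℂ)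
    (f : ℕ → (Fin N → ℕ) → ℂ) (K : ℕ → ℂ) (a n : ℕ) (han : a ≤ n) (hn : n ≤ N)
    (hH : ∀ k, a < k → k ≤ n → ∀ c x, H (setCoord c k x) = H c)
    (hf : ∀ j k, a < j → j < k → k ≤ n → ∀ c x, f j (setCoord c k x) = f j c)
    (hs : ∀ k, a < k → k ≤ n → ∀ c ∈ Fintype.piFinset (fun j : Fin N => S (j.val + 1)),
      ∑ x ∈ S k, f k (setCoord c k x) = K k) :
    (∏ k ∈ Ioc a n, ((S k).card : ℂ)) *
        ∑ c ∈ Fintype.piFinset (fun j : Fin N => S (j.val + 1)), H c * ∏ k ∈ Ioc a n, f k c =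
      (∏ k ∈ Ioc a n, K k) * ∑ c ∈ Fintype.piFinset (fun j : Fin N => S (j.val + 1)), H c := by
  induction n, han using Nat.le_induction with
  | base => simp
  | succ n han ih =>
    have ih' := ih (by omega) (fun k h1 h2 => hH k h1 (by omega))
      (fun j k h1 h2 h3 => hf j k h1 h2 (by omega)) (fun k h1 h2 => hs k h1 (by omega))
    have h1 := card_mul_sum_mul S (fun c => H c * ∏ k ∈ Ioc a n, f k c) (f (n + 1))
      (k := n + 1) (by omega) hn
      (fun c x => by
        rw [hH (n + 1) (by omega) le_rfl]
        congr 1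
        refine Finset.prod_congr rfl fun j hj => ?_
        rw [mem_Ioc] at hj
        exact hf j (n + 1) hj.1 (by omega) le_rfl c x)
      (hs (n + 1) (by omega) le_rfl)
    simp only [Finset.prod_Ioc_succ_top han, ← mul_assoc] at h1 ih' ⊢
    linear_combination (∏ k ∈ Ioc a n, ((S k).card : ℂ)) * h1 + K (n + 1) * ih'

lemma cext_setCoord {r k : ℕ} (hk : 1 ≤ k) (hkr : k ≤ 2 * r - 1) (c : Fin (2 * r - 1) → ℕ)
    (x : ℕ) : cext r (setCoord c k x) k = x := by
  have : k - 1 + 1 = k := by omega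
  simp [cext, hk, hkr, setCoord, this]

lemma cext_setCoord_of_ne {r j k : ℕ} (hjk : j ≠ k) (c : Fin (2 * r - 1) → ℕ) (x : ℕ) :
    cext r (setCoord c k x) j = cext r c j := by
  unfold cext setCoord
  split_ifs with h1 h2
  · simp only at h2
    omega
  · rfl
  · rfl

lemma uinv_setCoord_of_ne {p r j k : ℕ} {d : ℕ → ℕ} (hjk : j ≠ k) (c : Fin (2 * r - 1) → ℕ)
    (x : ℕ) : uinv p r d (setCoord c k x) j = uinv p r d c j := by
  unfold uinv
  rw [cext_setCoord_of_ne hjk]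

/-- The residues over which the `k`-th variable of `G(t)` ranges. -/
def residues (p r : ℕ) (d : ℕ → ℕ) (k : ℕ) : Finset ℕ :=
  (range (p ^ Lf r d k)).filter (fun x => 0 < d k → x.Coprime p)

lemma cext_mem_residues {p r k : ℕ} {d : ℕ → ℕ} (hk : 1 ≤ k) (hkr : k ≤ 2 * r - 1)
    {c : Fin (2 * r - 1) → ℕ}
    (hc : c ∈ Fintype.piFinset fun j : Fin (2 * r - 1) => residues p r d (j.val + 1)) :
    cext r c k ∈ residues p r d k := by
  have hkk : k - 1 + 1 = k := by omega
  have := Fintype.mem_piFinset.1 hc ⟨k - 1, by omega⟩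
  simp only [hkk] at this
  simpa [cext, hk, hkr] using this

lemma le_Lf {r k : ℕ} {d : ℕ → ℕ} (hd0 : d 0 = 0) (hk : 1 ≤ k) (hkr : k ≤ 2 * r - 1) :
    d k ≤ Lf r d k := by
  unfold Lf
  split_ifs with h1 h2
  · exact Finset.single_le_sum (f := d) (fun _ _ => Nat.zero_le _) (by simp; omega)
  · subst h2
    omega
  · have h3 : d k ≤ ∑ j ∈ Icc (r + 1) k, d j :=
      Finset.single_le_sum (f := d) (fun _ _ => Nat.zero_le _) (by simp; omega)
    have h4 : d (k - r - 1) ≤ ∑ j ∈ Icc 1 (r - 1), d j := by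
      rcases Nat.eq_zero_or_pos (k - r - 1) with h | h
      · rw [h, hd0]
        exact Nat.zero_le _
      · exact Finset.single_le_sum (f := d) (fun _ _ => Nat.zero_le _) (by simp; omega)
    omega

lemma le_Lf_middle {r : ℕ} {d : ℕ → ℕ} (hr : 2 ≤ r) (hd0 : d 0 = 0) :
    d r ≤ Lf r d (r + 1) := by
  have h1 : ¬ r + 1 ≤ r - 1 := by omega
  have h2 : r + 1 - r - 1 = 0 := by omega
  rw [Lf, if_neg h1, if_neg (by omega), h2, hd0]
  omega

lemma uinv_coprime {p r k : ℕ} [hp : Fact p.Prime] {d : ℕ → ℕ} (hd0 : d 0 = 0) (hk : 1 ≤ k)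
    (hkr : k ≤ 2 * r - 1) (hdk : 0 < d k) {c : Fin (2 * r - 1) → ℕ}
    (hc : c ∈ Fintype.piFinset fun j : Fin (2 * r - 1) => residues p r d (j.val + 1)) :
    (uinv p r d c k).Coprime p := by
  have hL : 0 < Lf r d k := hdk.trans_le (le_Lf hd0 hk hkr)
  have hcop : (cext r c k).Coprime p :=
    (Finset.mem_filter.1 (cext_mem_residues hk hkr hc)).2 hdk
  rw [uinv, if_neg hdk.ne', ← isUnit_natCast_zmod_pow hL, ZMod.natCast_zmod_val]
  exact IsUnit.of_mul_eq_one _ (ZMod.inv_mul_of_unit _ ((isUnit_natCast_zmod_pow hL _).2 hcop))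

lemma card_residues {p r k : ℕ} [hp : Fact p.Prime] {d : ℕ → ℕ} (hL : d k ≤ Lf r d k) :
    ((residues p r d k).card : ℂ) =
      (p : ℂ) ^ Lf r d k * (if d k = 0 then 1 else 1 - (p : ℂ)⁻¹) := by
  have hp0 : (p : ℂ) ≠ 0 := by exact_mod_cast hp.out.ne_zero
  rcases Nat.eq_zero_or_pos (d k) with h | h
  · simp [residues, h]
  · obtain ⟨m, hm⟩ : ∃ m, Lf r d k = m + 1 := ⟨Lf r d k - 1, by omega⟩
    have h1 := sum_range_filter_coprime (p := p) (N := m + 1) (L := m + 1) m.succ_pos le_rfl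
      (0 < d k) (fun _ => 1)
    have h2 := sum_isUnit_stdAddChar (p := p) m 0
    simp only [h, true_imp_iff, mul_zero, AddChar.map_zero_eq_one, if_true] at h1 h2
    rw [h2] at h1
    simp only [residues, h, h.ne', true_imp_iff, hm, if_false]
    rw [Finset.card_eq_sum_ones]
    push_cast
    rw [h1]
    simp only [Nat.sub_self, pow_zero, one_mul]
    rw [pow_succ]
    field_simp

lemma residues_card_ne_zero {p r k : ℕ} [hp : Fact p.Prime] {d : ℕ → ℕ}
    (hL : d k ≤ Lf r d k) : ((residues p r d k).card : ℂ) ≠ 0 := by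
  rw [card_residues hL]
  have hp0 : (p : ℂ) ≠ 0 := by exact_mod_cast hp.out.ne_zero
  have hp1 : (p : ℂ) ≠ 1 := by exact_mod_cast hp.out.ne_one
  refine mul_ne_zero (pow_ne_zero _ hp0) ?_
  split_ifs
  · exact one_ne_zero
  · rw [sub_ne_zero]
    intro h
    exact hp1 (by rw [← inv_inv (p : ℂ), ← h, inv_one])

lemma sum_residues_psi_of_int {p r k : ℕ} [hp : Fact p.Prime] {d : ℕ → ℕ}
    (hL : d k ≤ Lf r d k) (z : ℤ) (b : ℕ) :
    ∑ x ∈ residues p r d k, psi ((z : ℚ) * b * x) =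
      (p : ℂ) ^ Lf r d k * (if d k = 0 then 1 else 1 - (p : ℂ)⁻¹) := by
  rw [← card_residues hL, Finset.card_eq_sum_ones]
  push_cast
  refine Finset.sum_congr rfl fun x _ => ?_
  have := psi_intCast (z * b * x)
  push_cast at this
  exact this

lemma sum_residues_psi_of_div {p r k : ℕ} [hp : Fact p.Prime] {d : ℕ → ℕ}
    (hL : d k ≤ Lf r d k) (hdk : 0 < d k) {s : ℤ} (hs : IsUnit s) {b : ℕ} (hb : b.Coprime p) :
    ∑ x ∈ residues p r d k, psi ((s : ℚ) / p * b * x) = (p : ℂ) ^ Lf r d k * -(p : ℂ)⁻¹ := by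
  have hp0 : (p : ℂ) ≠ 0 := by exact_mod_cast hp.out.ne_zero
  have h1 := sum_range_filter_coprime (p := p) (N := 1) (L := Lf r d k) one_pos (by omega)
    (0 < d k) (fun x => ZMod.stdAddChar (x * ((s * b : ℤ) : ZMod (p ^ 1))))
  have hw : IsUnit (((s * b : ℤ)) : ZMod (p ^ 1)) := by
    have hb' := (isUnit_natCast_zmod_pow (p := p) one_pos b).2 hb
    have hs' := hs.map (Int.castRingHom (ZMod (p ^ 1)))
    simpa using hs'.mul hb'
  have hne : Nontrivial (ZMod (p ^ 1)) :=
    ZMod.nontrivial_iff.2 (by simpa using hp.out.ne_one)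
  have hpz : (p : ZMod (p ^ 1)) = 0 := by simpa using natCast_pow_eq_zero p 1
  have h2 := sum_isUnit_stdAddChar (p := p) 0 (((s * b : ℤ)) : ZMod (p ^ 1))
  simp only [zero_add] at h2
  rw [if_neg hw.ne_zero, hpz, zero_mul, if_pos rfl] at h2
  simp only [hdk, true_imp_iff] at h1
  rw [h2] at h1
  obtain ⟨m, hm⟩ : ∃ m, Lf r d k = m + 1 := ⟨Lf r d k - 1, by omega⟩
  have h3 : ∀ x : ℕ, psi ((s : ℚ) / p * b * x) =
      ZMod.stdAddChar ((x : ZMod (p ^ 1)) * ((s * b : ℤ) : ZMod (p ^ 1))) := fun x => by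
    have := psi_intCast_div (p ^ 1) (x * (s * b))
    push_cast at this ⊢
    rw [← this]
    congr 1
    ring
  simp only [h3, residues, hdk, true_imp_iff]
  rw [h1, hm, pow_succ]
  simp only [Nat.add_sub_cancel]
  field_simp
  simp

/-- The coefficient of the `k`-th variable in the exponential sum, `k ≠ r, r + 1`. -/
def coeff (p r : ℕ) (μ d : ℕ → ℕ) (k : ℕ) : ℚ :=
  if k ≤ r - 1 then (p : ℚ) ^ (μ k - 1) / (p : ℚ) ^ d k
  else -((p : ℚ) ^ (μ (2 * r - k + 1) - 1) * (p : ℚ) ^ d (2 * r - k) /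
    (p : ℚ) ^ (d (2 * r - k + 1) + d k))

/-- The inverse of the variable preceding the `k`-th one, `1` if there is none. -/
def prevInv (p r : ℕ) (d : ℕ → ℕ) (c : Fin (2 * r - 1) → ℕ) (k : ℕ) : ℕ :=
  if k = 1 then 1 else uinv p r d c (k - 1)

/-- The part of the exponential sum linear in the `k`-th variable. -/
def chainTerm (p r : ℕ) (μ d : ℕ → ℕ) (k : ℕ) (c : Fin (2 * r - 1) → ℕ) : ℚ :=
  coeff p r μ d k * prevInv p r d c k * cext r c k

/-- The part of the exponential sum quadratic in the two middle variables. -/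
def middleTerm (p r : ℕ) (μ d : ℕ → ℕ) (c : Fin (2 * r - 1) → ℕ) : ℚ :=
  (p : ℚ) ^ (μ r - 1) *
      ((uinv p r d c (r - 1) : ℚ) ^ 2 * (cext r c r : ℚ) / (p : ℚ) ^ d r
        + 2 * (p : ℚ) ^ d (r - 1) * (uinv p r d c (r - 1) : ℚ) * (cext r c (r + 1) : ℚ)
            / (p : ℚ) ^ (d (r + 1) + d r)
        + (p : ℚ) ^ (2 * d (r - 1)) * (cext r c (r + 1) : ℚ) ^ 2 * (uinv p r d c r : ℚ)
            / (p : ℚ) ^ (2 * d (r + 1) + d r))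

lemma expArg_eq {p r : ℕ} (hr : 2 ≤ r) (μ d : ℕ → ℕ) (c : Fin (2 * r - 1) → ℕ) :
    expArg p r μ d c = ∑ k ∈ Ioc 0 (r - 1), chainTerm p r μ d k c + middleTerm p r μ d c
      + ∑ k ∈ Ioc (r + 1) (2 * r - 1), chainTerm p r μ d k c := by
  have h1 : ∑ k ∈ Ioc 0 (r - 1), chainTerm p r μ d k c =
      (p : ℚ) ^ (μ 1 - 1) * (cext r c 1 : ℚ) / (p : ℚ) ^ d 1 +
      ∑ i ∈ Icc 1 (r - 2), (p : ℚ) ^ (μ (i + 1) - 1) *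
        ((uinv p r d c i : ℚ) * (cext r c (i + 1) : ℚ) / (p : ℚ) ^ d (i + 1)) := by
    have hset : Ioc 0 (r - 1) = insert 1 (Ioc 1 (r - 1)) := by
      ext k
      simp only [mem_Ioc, mem_insert]
      omega
    rw [hset, Finset.sum_insert (by simp)]
    congr 1
    · have : 1 ≤ r - 1 := by omega
      simp [chainTerm, coeff, prevInv, this]
      ring
    · symm
      refine Finset.sum_bij' (fun i _ => i + 1) (fun k _ => k - 1) ?_ ?_ ?_ ?_ ?_
      · intro i hi
        simp only [mem_Icc, mem_Ioc] at hi ⊢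
        omega
      · intro i hi
        simp only [mem_Icc, mem_Ioc] at hi ⊢
        omega
      · intro i hi
        simp
      · intro i hi
        simp only [mem_Ioc] at hi
        omega
      · intro i hi
        simp only [mem_Icc] at hi
        have h : i + 1 ≤ r - 1 := by omega
        have h' : i ≠ 0 := by omega
        simp [chainTerm, coeff, prevInv, h, h']
        ring
  have h2 : ∑ k ∈ Ioc (r + 1) (2 * r - 1), chainTerm p r μ d k c =
      -∑ i ∈ Icc 1 (r - 2), (p : ℚ) ^ (μ (i + 1) - 1) *
        ((p : ℚ) ^ d i * (cext r c (2 * r - i) : ℚ) * (uinv p r d c (2 * r - i - 1) : ℚ)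
              / (p : ℚ) ^ (d (i + 1) + d (2 * r - i))) := by
    rw [← Finset.sum_neg_distrib]
    symm
    refine Finset.sum_bij' (fun i _ => 2 * r - i) (fun k _ => 2 * r - k) ?_ ?_ ?_ ?_ ?_
    · intro i hi
      simp only [mem_Icc, mem_Ioc] at hi ⊢
      omega
    · intro i hi
      simp only [mem_Icc, mem_Ioc] at hi ⊢
      omega
    · intro i hi
      simp only [mem_Icc] at hi
      omega
    · intro i hi
      simp only [mem_Ioc] at hi
      omega
    · intro i hi
      simp only [mem_Icc] at hi
      have h : ¬ (2 * r - i ≤ r - 1) := by omega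
      have h' : 2 * r - i ≠ 1 := by omega
      have h'' : 2 * r - (2 * r - i) = i := by omega
      simp only [chainTerm, coeff, prevInv, if_neg h, if_neg h', h'']
      ring
  rw [h1, h2, expArg, middleTerm]
  simp only [mul_sub, Finset.sum_sub_distrib]
  ring

lemma pow_div_pow_eq_intCast {p e f : ℕ} (hp : p ≠ 0) (h : f ≤ e) :
    (p : ℚ) ^ e / (p : ℚ) ^ f = ((p ^ (e - f) : ℤ) : ℚ) := by
  have hp0 : (p : ℚ) ≠ 0 := by exact_mod_cast hp
  rw [div_eq_iff (pow_ne_zero _ hp0)]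
  push_cast
  rw [← pow_add]
  congr 1
  omega

lemma pow_div_pow_succ {p e f : ℕ} (hp : p ≠ 0) (h : f = e + 1) :
    (p : ℚ) ^ e / (p : ℚ) ^ f = 1 / p := by
  have hp0 : (p : ℚ) ≠ 0 := by exact_mod_cast hp
  rw [h, pow_succ]
  field_simp

/-- The sum over the `k`-th variable, `k ≠ r, r + 1`. -/
lemma sum_chainTerm {p r : ℕ} [hp : Fact p.Prime] {μ d : ℕ → ℕ}
    (hμ : ∀ i, 1 ≤ i → i ≤ r → 1 ≤ μ i) (hd0 : d 0 = 0) (hmem : MemCQ1 r μ d)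
    (hdiv : Divis r μ d) {k : ℕ} (hk : 1 ≤ k) (hkr : k ≤ 2 * r - 1) (hk' : k ≤ r - 1 ∨ r + 1 < k)
    {c : Fin (2 * r - 1) → ℕ}
    (hc : c ∈ Fintype.piFinset fun j : Fin (2 * r - 1) => residues p r d (j.val + 1)) :
    ∑ x ∈ residues p r d k, psi (chainTerm p r μ d k (setCoord c k x)) =
      (p : ℂ) ^ Lf r d k * gamB p r μ d k := by
  have hp0 : p ≠ 0 := hp.out.ne_zero
  have hterm : ∀ x, chainTerm p r μ d k (setCoord c k x) =
      coeff p r μ d k * prevInv p r d c k * x := by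
    intro x
    rw [chainTerm, cext_setCoord hk hkr]
    congr 2
    unfold prevInv
    split_ifs with h
    · rfl
    · rw [uinv_setCoord_of_ne (by omega)]
  simp only [hterm]
  have hL := le_Lf hd0 hk hkr
  have hunboxed : ∀ z : ℤ, coeff p r μ d k = z → ¬ BoxedB r μ d k →
      ∑ x ∈ residues p r d k, psi (coeff p r μ d k * prevInv p r d c k * x) =
      (p : ℂ) ^ Lf r d k * gamB p r μ d k := by
    intro z hz hB
    rw [hz, sum_residues_psi_of_int hL, gamB, if_neg hB]
    by_cases h : d k = 0 <;> simp [CircledB, h]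
  have hboxed : ∀ s : ℤ, IsUnit s → coeff p r μ d k = s / p → BoxedB r μ d k → 0 < d k →
      (k = 1 ∨ 0 < d (k - 1)) →
      ∑ x ∈ residues p r d k, psi (coeff p r μ d k * prevInv p r d c k * x) =
      (p : ℂ) ^ Lf r d k * gamB p r μ d k := by
    intro s hs hz hB hdk hprev
    have hcop : (prevInv p r d c k).Coprime p := by
      unfold prevInv
      split_ifs with h
      · simp
      · exact uinv_coprime hd0 (by omega) (by omega) (hprev.resolve_left h) hc
    have hC : ¬ CircledB d k := hdk.ne'
    rw [hz, sum_residues_psi_of_div hL hdk hs hcop, gamB, if_pos hB, if_neg hC]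
  obtain ⟨hdv1, hdv2, -⟩ := hdiv
  obtain ⟨hm1, hm2⟩ := hmem
  rcases hk' with hk' | hk'
  · have hμk := hμ k hk (by omega)
    have hle := hm1 k hk hk'
    have hBox : BoxedB r μ d k ↔ d k = μ k := by
      rw [BoxedB, if_pos (by omega)]
    by_cases hB : BoxedB r μ d k
    · have hdk := hBox.1 hB
      refine hboxed 1 isUnit_one ?_ hB (by omega) ?_
      · rw [coeff, if_pos hk', pow_div_pow_succ hp0 (by omega)]
        simp
      · by_cases h1 : k = 1
        · exact Or.inl h1
        · have := hdv1 (k - 1) (by omega) (by omega)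
          rw [show k - 1 + 1 = k by omega] at this
          right
          omega
    · have hdk := hBox.not.1 hB
      refine hunboxed (p ^ (μ k - 1 - d k)) ?_ hB
      rw [coeff, if_pos hk', pow_div_pow_eq_intCast hp0 (by omega)]
  · obtain ⟨i, rfl⟩ : ∃ i, k = 2 * r - i := ⟨2 * r - k, by omega⟩
    have hi1 : 1 ≤ i := by omega
    have hi2 : i ≤ r - 2 := by omega
    have hii : 2 * r - (2 * r - i) = i := by omega
    have hμk := hμ (i + 1) (by omega) (by omega)
    have hle := hm2 i hi1 hi2
    have h1 := hdv1 i hi1 hi2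
    have h2 := hdv2 i hi1 hi2
    have hcoeff : coeff p r μ d (2 * r - i) =
        -((p : ℚ) ^ (μ (i + 1) - 1 + d i) / (p : ℚ) ^ (d (i + 1) + d (2 * r - i))) := by
      rw [coeff, if_neg (by omega), hii, ← pow_add]
    have hBox : BoxedB r μ d (2 * r - i) ↔
        (d (2 * r - i) : ℤ) = (μ (i + 1) : ℤ) + (d i : ℤ) - (d (i + 1) : ℤ) := by
      rw [BoxedB, if_neg (by omega), if_neg (by omega), hii]
    by_cases hB : BoxedB r μ d (2 * r - i)
    · have hdk := hBox.1 hB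
      refine hboxed (-1) (by simp) ?_ hB (by omega) (Or.inr (by omega))
      rw [hcoeff, pow_div_pow_succ hp0 (by omega)]
      push_cast
      ring
    · have hdk := hBox.not.1 hB
      refine hunboxed (-(p ^ (μ (i + 1) - 1 + d i - (d (i + 1) + d (2 * r - i))) : ℤ)) ?_ hB
      rw [hcoeff, pow_div_pow_eq_intCast hp0 (by omega)]
      push_cast
      ring

/-- The sum over the two middle variables. -/
lemma sum_middleTerm {p r : ℕ} [hp : Fact p.Prime] (hodd : Odd p) (hr : 2 ≤ r) {μ d : ℕ → ℕ}
    (hd0 : d 0 = 0) (hres : d (r - 1) = d (r + 1)) {n : ℕ} (hn : 1 ≤ n)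
    (hdr : d r = μ r - 1 + (n + 1))
    {c : Fin (2 * r - 1) → ℕ}
    (hc : c ∈ Fintype.piFinset fun j : Fin (2 * r - 1) => residues p r d (j.val + 1)) :
    ∑ x ∈ residues p r d r, ∑ y ∈ residues p r d (r + 1),
        psi (middleTerm p r μ d (setCoord (setCoord c r x) (r + 1) y)) =
      (p : ℂ) ^ (Lf r d r - (n + 1)) * (p : ℂ) ^ (Lf r d (r + 1) - (n + 1)) *
        ((p : ℂ) ^ (n + 1) * (p : ℂ) ^ (n + 1 - (n + 2) / 2) -
          (p : ℂ) ^ n * (p : ℂ) ^ (n + 1 - (n + 1) / 2)) := by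
  have hp0 : (p : ℚ) ≠ 0 := by exact_mod_cast hp.out.ne_zero
  have hL1 : n + 1 ≤ Lf r d r := by
    have := le_Lf (r := r) (k := r) hd0 (by omega) (by omega)
    omega
  have hL2 : n + 1 ≤ Lf r d (r + 1) := by
    have := le_Lf_middle hr hd0
    omega
  have hdpos : 0 < d r := by omega
  set u := uinv p r d c (r - 1) with hu
  have hterm : ∀ x ∈ residues p r d r, ∀ y : ℕ,
      psi (middleTerm p r μ d (setCoord (setCoord c r x) (r + 1) y)) =
      ZMod.stdAddChar (N := p ^ (n + 1)) (u ^ 2 * x + 2 * u * y +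
        y ^ 2 * (x : ZMod (p ^ (n + 1)))⁻¹) := by
    intro x hx y
    set v := ((x : ZMod (p ^ Lf r d r))⁻¹).val with hv
    have hxc : x.Coprime p := (Finset.mem_filter.1 hx).2 hdpos
    have hvx : (v : ZMod (p ^ (n + 1))) = (x : ZMod (p ^ (n + 1)))⁻¹ := by
      have h1 : ((v * x : ℕ) : ZMod (p ^ Lf r d r)) = 1 := by
        rw [Nat.cast_mul, hv, ZMod.natCast_zmod_val]
        exact ZMod.inv_mul_of_unit _ ((isUnit_natCast_zmod_pow (by omega) _).2 hxc)
      have h2 := congrArg (ZMod.castHom (pow_dvd_pow p hL1) (ZMod (p ^ (n + 1)))) h1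
      rw [map_natCast, map_one, Nat.cast_mul] at h2
      have h3 := ZMod.inv_mul_of_unit _
        ((isUnit_natCast_zmod_pow (p := p) n.succ_pos x).2 hxc)
      linear_combination (x : ZMod (p ^ (n + 1)))⁻¹ * h2 - (v : ZMod (p ^ (n + 1))) * h3
    have hval : middleTerm p r μ d (setCoord (setCoord c r x) (r + 1) y) =
        ((u ^ 2 * x + 2 * u * y + y ^ 2 * v : ℤ) : ℚ) / ((p ^ (n + 1) : ℕ) : ℚ) := by
      have e1 : uinv p r d (setCoord (setCoord c r x) (r + 1) y) (r - 1) = u := by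
        rw [uinv_setCoord_of_ne (by omega), uinv_setCoord_of_ne (by omega)]
      have e2 : cext r (setCoord (setCoord c r x) (r + 1) y) r = x := by
        rw [cext_setCoord_of_ne (by omega), cext_setCoord (by omega) (by omega)]
      have e3 : cext r (setCoord (setCoord c r x) (r + 1) y) (r + 1) = y := by
        rw [cext_setCoord (by omega) (by omega)]
      have e4 : uinv p r d (setCoord (setCoord c r x) (r + 1) y) r = v := by
        rw [uinv, if_neg hdpos.ne', e2]
      rw [middleTerm, e1, e2, e3, e4, hres, hdr]
      push_cast
      simp only [pow_add, two_mul]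
      field_simp
    rw [hval, psi_intCast_div]
    push_cast
    rw [hvx]
  have hsum1 : ∑ x ∈ residues p r d r, ∑ y ∈ residues p r d (r + 1),
        psi (middleTerm p r μ d (setCoord (setCoord c r x) (r + 1) y)) =
      ∑ x ∈ residues p r d r, (p : ℂ) ^ (Lf r d (r + 1) - (n + 1)) *
        ∑ y : ZMod (p ^ (n + 1)) with (0 < d (r + 1) → IsUnit y),
          ZMod.stdAddChar (N := p ^ (n + 1)) (u ^ 2 * x + 2 * u * y +
            y ^ 2 * (x : ZMod (p ^ (n + 1)))⁻¹) := by
    refine Finset.sum_congr rfl fun x hx => ?_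
    rw [← sum_range_filter_coprime (N := n + 1) n.succ_pos hL2 (0 < d (r + 1))
      (fun y : ZMod (p ^ (n + 1)) => ZMod.stdAddChar (N := p ^ (n + 1)) (u ^ 2 * x + 2 * u * y +
            y ^ 2 * (x : ZMod (p ^ (n + 1)))⁻¹))]
    exact Finset.sum_congr rfl fun y _ => hterm x hx y
  rw [hsum1, ← Finset.mul_sum]
  have hsum2 := sum_range_filter_coprime (p := p) (N := n + 1) n.succ_pos hL1 (0 < d r)
    (fun x => ∑ y : ZMod (p ^ (n + 1)) with (0 < d (r + 1) → IsUnit y),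
          ZMod.stdAddChar (N := p ^ (n + 1)) (u ^ 2 * x + 2 * u * y + y ^ 2 * x⁻¹))
  simp only [hdpos, true_imp_iff] at hsum2
  simp only [residues, hdpos, true_imp_iff]
  rw [hsum2, sum_isUnit_sum_middle hodd hn, sum_isUnit_sum_sq]
  · ring
  · intro h
    exact (isUnit_natCast_zmod_pow n.succ_pos _).2
      (uinv_coprime hd0 (by omega) (by omega) (by rwa [hres]) hc)

lemma Gexp_eq {p r : ℕ} [hp : Fact p.Prime] (hodd : Odd p) (hr : 2 ≤ r) {μ d : ℕ → ℕ}
    (hμ : ∀ i, 1 ≤ i → i ≤ r → 1 ≤ μ i) (hd0 : d 0 = 0) (hmem : MemCQ1 r μ d)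
    (hdiv : Divis r μ d) (hres : d (r - 1) = d (r + 1)) {n : ℕ} (hn : 1 ≤ n)
    (hdr : d r = μ r - 1 + (n + 1)) :
    Gexp p r μ d =
      ((p : ℂ) ^ (n + 1))⁻¹ * ((p : ℂ) ^ (n + 1))⁻¹ *
        ((p : ℂ) ^ (n + 1) * (p : ℂ) ^ (n + 1 - (n + 2) / 2) -
          (p : ℂ) ^ n * (p : ℂ) ^ (n + 1 - (n + 1) / 2)) *
        ∏ i ∈ ((Finset.Icc 1 (2 * r - 1)).erase r).erase (r + 1), gamB p r μ d i := by
  have hp0 : (p : ℂ) ≠ 0 := by exact_mod_cast hp.out.ne_zero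
  set S := residues p r d with hS
  set T := (p : ℂ) ^ (n + 1) * (p : ℂ) ^ (n + 1 - (n + 2) / 2) -
          (p : ℂ) ^ n * (p : ℂ) ^ (n + 1 - (n + 1) / 2) with hT
  set P := Fintype.piFinset (fun j : Fin (2 * r - 1) => S (j.val + 1)) with hP
  have hsplit : ∀ h : ℕ → ℂ, ∏ k ∈ Icc 1 (2 * r - 1), h k =
      (∏ k ∈ Ioc 0 (r - 1), h k) * (h r * h (r + 1)) * ∏ k ∈ Ioc (r + 1) (2 * r - 1), h k := by
    intro h
    have e1 : Icc 1 (2 * r - 1) = Ioc 0 (2 * r - 1) := by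
      ext k
      simp only [mem_Icc, mem_Ioc]
      omega
    have e2 : Ioc (r - 1) (r + 1) = {r, r + 1} := by
      ext k
      simp only [mem_Ioc, mem_insert, mem_singleton]
      omega
    rw [e1, ← Finset.prod_Ioc_consecutive h (Nat.zero_le (r + 1)) (by omega),
      ← Finset.prod_Ioc_consecutive h (Nat.zero_le (r - 1)) (by omega : r - 1 ≤ r + 1), e2,
      Finset.prod_pair (by omega)]
  have herase : ∏ i ∈ ((Finset.Icc 1 (2 * r - 1)).erase r).erase (r + 1), gamB p r μ d i =
      (∏ k ∈ Ioc 0 (r - 1), gamB p r μ d k) * ∏ k ∈ Ioc (r + 1) (2 * r - 1), gamB p r μ d k := by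
    rw [← Finset.prod_union]
    · congr 1
      ext k
      simp only [mem_erase, mem_Icc, mem_union, mem_Ioc]
      omega
    · rw [Finset.disjoint_left]
      intro k
      simp only [mem_Ioc]
      omega
  have hdom : (Fintype.piFinset fun j : Fin (2 * r - 1) =>
              Finset.range (p ^ Lf r d (j.val + 1))).filter
            (fun c => ∀ j : Fin (2 * r - 1), 0 < d (j.val + 1) → Nat.Coprime (c j) p) = P := by
    ext c
    simp only [hP, hS, residues, mem_filter, Fintype.mem_piFinset, forall_and]
  have hchain : ∀ j k : ℕ, j < k → ∀ (c : Fin (2 * r - 1) → ℕ) (x : ℕ),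
      psi (chainTerm p r μ d j (setCoord c k x)) = psi (chainTerm p r μ d j c) := by
    intro j k hjk c x
    simp only [chainTerm, prevInv]
    rw [cext_setCoord_of_ne hjk.ne, uinv_setCoord_of_ne (by omega)]
  have hmidc : ∀ k : ℕ, r + 1 < k → ∀ (c : Fin (2 * r - 1) → ℕ) (x : ℕ),
      psi (middleTerm p r μ d (setCoord c k x)) = psi (middleTerm p r μ d c) := by
    intro k hk c x
    simp only [middleTerm]
    rw [cext_setCoord_of_ne (by omega), cext_setCoord_of_ne (by omega),
      uinv_setCoord_of_ne (by omega), uinv_setCoord_of_ne (by omega)]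
  have hlow : ∀ k : ℕ, r ≤ k → ∀ (c : Fin (2 * r - 1) → ℕ) (x : ℕ),
      ∏ j ∈ Ioc 0 (r - 1), psi (chainTerm p r μ d j (setCoord c k x)) =
        ∏ j ∈ Ioc 0 (r - 1), psi (chainTerm p r μ d j c) := by
    intro k hk c x
    refine Finset.prod_congr rfl fun j hj => hchain j k ?_ c x
    rw [mem_Ioc] at hj
    omega
  have hupper := prod_card_mul_sum_mul_prod S
    (fun c : Fin (2 * r - 1) → ℕ => (∏ j ∈ Ioc 0 (r - 1), psi (chainTerm p r μ d j c)) *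
      psi (middleTerm p r μ d c))
    (fun k c => psi (chainTerm p r μ d k c)) (fun k => (p : ℂ) ^ Lf r d k * gamB p r μ d k)
    (r + 1) (2 * r - 1) (by omega) le_rfl
    (fun k hk _ c x => by rw [hlow k (by omega), hmidc k hk])
    (fun j k _ hjk _ => hchain j k hjk)
    (fun k hk hk' c hc =>
      sum_chainTerm hμ hd0 hmem hdiv (by omega) hk' (Or.inr hk) hc)
  have hmiddle := card_mul_card_mul_sum_mul S
    (fun c : Fin (2 * r - 1) → ℕ => ∏ j ∈ Ioc 0 (r - 1), psi (chainTerm p r μ d j c))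
    (fun c => psi (middleTerm p r μ d c)) (k := r) (l := r + 1) (by omega) (by omega) (by omega)
    (by omega) (hlow r le_rfl) (hlow (r + 1) (by omega))
    (fun c hc => sum_middleTerm hodd hr hd0 hres hn hdr hc)
  have hlower := prod_card_mul_sum_mul_prod S (fun _ : Fin (2 * r - 1) → ℕ => 1)
    (fun k c => psi (chainTerm p r μ d k c)) (fun k => (p : ℂ) ^ Lf r d k * gamB p r μ d k)
    0 (r - 1) (by omega) (by omega) (fun _ _ _ _ _ => rfl)
    (fun j k _ hjk _ => hchain j k hjk)
    (fun k hk hk' c hc =>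
      sum_chainTerm hμ hd0 hmem hdiv (by omega) (by omega) (Or.inl hk') hc)
  have hcard : ∑ _c ∈ P, (1 : ℂ) = ∏ k ∈ Icc 1 (2 * r - 1), ((S k).card : ℂ) := by
    have e : Icc 1 (2 * r - 1) = Ico (0 + 1) (2 * r - 1 + 1) := by
      ext k
      simp only [mem_Icc, mem_Ico]
      omega
    rw [Finset.sum_const, nsmul_eq_mul, mul_one, hP, Fintype.card_piFinset, e,
      ← Finset.prod_Ico_add' (fun k => ((S k).card : ℂ)) 0 (2 * r - 1) 1, Nat.cast_prod,
      ← Finset.range_eq_Ico, Finset.prod_range]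
  have hne : ∏ k ∈ Icc 1 (2 * r - 1), ((S k).card : ℂ) ≠ 0 := by
    rw [Finset.prod_ne_zero_iff]
    intro k hk
    rw [mem_Icc] at hk
    exact residues_card_ne_zero (le_Lf hd0 hk.1 hk.2)
  have hL1 : n + 1 ≤ Lf r d r := by
    have := le_Lf (r := r) (k := r) hd0 (by omega) (by omega)
    omega
  have hL2 : n + 1 ≤ Lf r d (r + 1) := by
    have := le_Lf_middle hr hd0
    omega
  have hpow : ∀ {L : ℕ}, n + 1 ≤ L →
      (p : ℂ) ^ (L - (n + 1)) = (p : ℂ) ^ L * ((p : ℂ) ^ (n + 1))⁻¹ :=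
    fun h => pow_sub₀ _ hp0 h
  have hsum : ∑ c ∈ P, psi (expArg p r μ d c) =
      ((∏ k ∈ Ioc 0 (r - 1), (p : ℂ) ^ Lf r d k * gamB p r μ d k) *
        ((p : ℂ) ^ (Lf r d r - (n + 1)) * (p : ℂ) ^ (Lf r d (r + 1) - (n + 1)) * T) *
        ∏ k ∈ Ioc (r + 1) (2 * r - 1), (p : ℂ) ^ Lf r d k * gamB p r μ d k) := by
    have hF : ∀ c, psi (expArg p r μ d c) = ((∏ j ∈ Ioc 0 (r - 1), psi (chainTerm p r μ d j c)) *
        psi (middleTerm p r μ d c)) *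
        ∏ j ∈ Ioc (r + 1) (2 * r - 1), psi (chainTerm p r μ d j c) := fun c => by
      rw [expArg_eq hr, psi_add, psi_add, psi_sum, psi_sum]
    simp only [hF]
    apply mul_left_cancel₀ hne
    conv_rhs => rw [← hcard]
    rw [hsplit]
    simp only [one_mul, ← hP] at hupper hmiddle hlower
    linear_combination
      (∏ k ∈ Ioc 0 (r - 1), ((S k).card : ℂ)) * ((S r).card * (S (r + 1)).card) * hupper +
      (∏ k ∈ Ioc 0 (r - 1), ((S k).card : ℂ)) *
        (∏ k ∈ Ioc (r + 1) (2 * r - 1), (p : ℂ) ^ Lf r d k * gamB p r μ d k) * hmiddle +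
      ((p : ℂ) ^ (Lf r d r - (n + 1)) * (p : ℂ) ^ (Lf r d (r + 1) - (n + 1)) * T) *
        (∏ k ∈ Ioc (r + 1) (2 * r - 1), (p : ℂ) ^ Lf r d k * gamB p r μ d k) * hlower
  rw [Gexp, hdom, hsum, herase, hsplit]
  simp only [Finset.prod_mul_distrib, Finset.prod_inv_distrib]
  rw [hpow hL1, hpow hL2]
  have hprod : ∀ s : Finset ℕ, ∏ k ∈ s, (p : ℂ) ^ Lf r d k ≠ 0 := fun s =>
    Finset.prod_ne_zero_iff.2 fun _ _ => pow_ne_zero _ hp0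
  have hq1 := hprod (Ioc 0 (r - 1))
  have hq2 := hprod (Ioc (r + 1) (2 * r - 1))
  field_simp

/-- Suppose `t ∈ CQ₁(μ)`, `d_{r−1} = d_{r+1}` and `d_r > μ_r`.  If `d_r − μ_r` is odd,
then `G(t) = (1−q⁻¹) q^{−(d_r−μ_r+1)/2} ∏_{i≠r,r+1} γ(𝔠ᵢ)`; if `d_r − μ_r` is even,
then `G(t) = 0`.  (Here `q = p`.) -/
theorem stmt4 (p : ℕ) (hp : p.Prime) (hpodd : Odd p) (r : ℕ) (hr : 2 ≤ r)
    (μ : ℕ → ℕ) (hμ : ∀ i, 1 ≤ i → i ≤ r → 1 ≤ μ i)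
    (d : ℕ → ℕ) (hd : ∀ j, (j = 0 ∨ 2 * r - 1 < j) → d j = 0)
    (hmem : MemCQ1 r μ d)
    (hdiv : Divis r μ d)
    (hres : d (r - 1) = d (r + 1)) (hgt : μ r < d r) :
    (Odd (d r - μ r) →
        Gexp p r μ d =
          (1 - ((p : ℂ))⁻¹) * (((p : ℂ)) ^ ((d r - μ r + 1) / 2))⁻¹ *
            ∏ i ∈ ((Finset.Icc 1 (2 * r - 1)).erase r).erase (r + 1), gamB p r μ d i) ∧
      (Even (d r - μ r) → Gexp p r μ d = 0) := by
  have : Fact p.Prime := ⟨hp⟩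
  have hp0 : (p : ℂ) ≠ 0 := by exact_mod_cast hp.ne_zero
  have hμr := hμ r (by omega) le_rfl
  have hn : d r = μ r - 1 + (d r - μ r + 1) := by omega
  have hG := Gexp_eq hpodd hr hμ (hd 0 (Or.inl rfl)) hmem hdiv hres (by omega) hn
  constructor
  · rintro ⟨h, hh⟩
    rw [hG, hh, show 2 * h + 1 + 1 - (2 * h + 1 + 2) / 2 = h + 1 by omega,
      show 2 * h + 1 + 1 - (2 * h + 1 + 1) / 2 = h + 1 by omega,
      show (2 * h + 1 + 1) / 2 = h + 1 by omega]
    congr 1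
    field_simp
    ring
  · rintro ⟨h, hh⟩
    rw [hG, hh, show h + h + 1 - (h + h + 2) / 2 = h by omega,
      show h + h + 1 - (h + h + 1) / 2 = h + 1 by omega]
    ring

end Stmt4
end
end

section
/- Let r ≥ 1, μ ∈ ℤ^r with all μ_i ≥ 1, and let q be an indeterminate. If s = μ (the maximal totally resonant tuple), then Σ_{t ∈ Ω(s)} G_Δ(t) q^{k_A(t)} = 0 in ℚ(q). -/
open Finset
open scoped Classical

noncomputable section

namespace Stmt5

/-- The indeterminate `q`, in the field `ℚ(q)` of rational functions. -/
def q : RatFunc ℚ := RatFunc.X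

/-- The `j`-th entry (1-based, `1 ≤ j ≤ 2r-1`) of the `(2r−1)`-tuple
`(d₁,…,d_{r−1},d_r,d_{r−1},…,d₁)` with which the totally resonant tuple
`(d₁,…,d_r)` is identified. -/
def Dd (r : ℕ) (d : ℕ → ℕ) (j : ℕ) : ℕ := if j ≤ r then d j else d (2 * r - j)

/-- The entry `𝔠ᵢ` is circled iff the `i`-th entry of the identified tuple is `0`. -/
def Circled (r : ℕ) (d : ℕ → ℕ) (i : ℕ) : Prop := Dd r d i = 0

/-- The entry `𝔠ᵢ` is boxed iff: `dᵢ = μᵢ` (for `i ≤ r`); `d_r = μ_r` (for `i = r+1`);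
`d_{(2r−i)+1} = μ_{(2r−i)+1}` (for `r+2 ≤ i ≤ 2r−1`). -/
def Boxed (r : ℕ) (μ d : ℕ → ℕ) (i : ℕ) : Prop :=
  if i ≤ r then d i = μ i
  else if i = r + 1 then d r = μ r
  else d (2 * r - i + 1) = μ (2 * r - i + 1)

/-- `γ(𝔠ᵢ)`. -/
def gam (r : ℕ) (μ d : ℕ → ℕ) (i : ℕ) : RatFunc ℚ :=
  if Boxed r μ d i then (if Circled r d i then 0 else -q⁻¹)
  else (if Circled r d i then 1 else 1 - q⁻¹)

/-- `G_Δ(t) = ∏_{i=1}^{2r−1} γ(𝔠ᵢ)`. -/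
def GDelta (r : ℕ) (μ d : ℕ → ℕ) : RatFunc ℚ :=
  ∏ i ∈ Finset.Icc 1 (2 * r - 1), gam r μ d i

/-- `k_A(t) = d₁ + ⋯ + d_r`. -/
def kA (r : ℕ) (d : ℕ → ℕ) : ℕ := ∑ i ∈ Finset.Icc 1 r, d i

/-- An `r`-tuple, encoded as a function `ℕ → ℕ` supported on `{1,…,r}`. -/
def Supported (r : ℕ) (d : ℕ → ℕ) : Prop := ∀ j, (j = 0 ∨ r < j) → d j = 0

/-- `Ω^≤(μ) = {t ∈ ℤ^r_{≥0} : dᵢ ≤ μᵢ for all i}`. -/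
def OmegaLe (r : ℕ) (μ : ℕ → ℕ) : Set (ℕ → ℕ) :=
  {d | Supported r d ∧ ∀ i, 1 ≤ i → i ≤ r → d i ≤ μ i}

/-- The value of `γ` at an entry with the given decorations. -/
def decorationValue (boxed circled : Prop) : RatFunc ℚ :=
  if boxed then (if circled then 0 else -q⁻¹) else (if circled then 1 else 1 - q⁻¹)

/-- The contribution of a single coordinate `x` with upper bound `m`. -/
def coordWeight (m x : ℕ) : RatFunc ℚ := decorationValue (x = m) (x = 0) * q ^ x

lemma q_ne_zero : q ≠ 0 := RatFunc.X_ne_zero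

lemma gam_eq_decorationValue (r : ℕ) (μ d : ℕ → ℕ) (i : ℕ) :
    gam r μ d i = decorationValue (Boxed r μ d i) (Circled r d i) := rfl

/-- The product over the identified `(2r+1)`-tuple, split into its two halves. -/
lemma GDelta_succ_eq (r : ℕ) (μ d : ℕ → ℕ) :
    GDelta (r + 1) μ d =
      (∏ i ∈ range (r + 1), decorationValue (d (i + 1) = μ (i + 1)) (d (i + 1) = 0)) *
      ∏ j ∈ range r, decorationValue (d (j + 2) = μ (j + 2)) (d (j + 1) = 0) := by
  have hIcc : Finset.Icc 1 (2 * (r + 1) - 1) = Finset.Ico 1 (r + 1 + r + 1) := by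
    ext i
    simp only [Finset.mem_Icc, Finset.mem_Ico]
    omega
  rw [GDelta, hIcc, Finset.prod_Ico_eq_prod_range, Nat.add_sub_cancel, Finset.prod_range_add]
  congr 1
  · refine Finset.prod_congr rfl fun i hi => ?_
    have hle : i + 1 ≤ r + 1 := by
      rw [Finset.mem_range] at hi
      omega
    rw [gam_eq_decorationValue, add_comm 1 i, Boxed, Circled, Dd, if_pos hle, if_pos hle]
  · rw [← Finset.prod_range_reflect]
    refine Finset.prod_congr rfl fun j hj => ?_
    rw [Finset.mem_range] at hj
    have hle : ¬ 1 + (r + 1 + (r - 1 - j)) ≤ r + 1 := by omega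
    have hsub : 2 * (r + 1) - (1 + (r + 1 + (r - 1 - j))) = j + 1 := by omega
    have hbox : Boxed (r + 1) μ d (1 + (r + 1 + (r - 1 - j))) ↔ d (j + 2) = μ (j + 2) := by
      simp only [Boxed, if_neg hle, hsub]
      split_ifs with h
      · rw [show r + 1 = j + 2 by omega]
      · rfl
    rw [gam_eq_decorationValue, propext hbox, Circled, Dd, if_neg hle, hsub]

/-- The summand attached to a tuple of length `r`. -/
def summand (r : ℕ) (μ d : ℕ → ℕ) : RatFunc ℚ := GDelta r μ d * q ^ kA r d

lemma kA_succ (r : ℕ) (d : ℕ → ℕ) : kA (r + 1) d = kA r d + d (r + 1) :=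
  Finset.sum_Icc_succ_top (by omega) _

lemma summand_one (μ d : ℕ → ℕ) : summand 1 μ d = coordWeight (μ 1) (d 1) := by
  simp [summand, coordWeight, GDelta_succ_eq, kA]

lemma summand_succ_succ (r : ℕ) (μ d : ℕ → ℕ) :
    summand (r + 2) μ d = summand (r + 1) μ d * coordWeight (μ (r + 2)) (d (r + 2)) *
      decorationValue (d (r + 2) = μ (r + 2)) (d (r + 1) = 0) := by
  rw [summand, summand, GDelta_succ_eq (r + 1), GDelta_succ_eq r, Finset.prod_range_succ _ (r + 1),
    Finset.prod_range_succ _ r, kA_succ (r + 1), pow_add, coordWeight]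
  rw [Finset.prod_range_succ _ r]
  ring

lemma summand_congr (r : ℕ) (μ : ℕ → ℕ) {d e : ℕ → ℕ} (h : ∀ i ≤ r + 1, d i = e i) :
    summand (r + 1) μ d = summand (r + 1) μ e := by
  induction r with
  | zero => rw [summand_one, summand_one, h 1 le_rfl]
  | succ r ih =>
    rw [summand_succ_succ, summand_succ_succ, ih fun i hi => h i (by omega),
      h (r + 1) (by omega), h (r + 2) le_rfl]

/-- `Ω^≤(μ)` as a finset, built one coordinate at a time. -/
def omegaFinset (μ : ℕ → ℕ) : ℕ → Finset (ℕ → ℕ)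
  | 0 => {0}
  | r + 1 => (omegaFinset μ r ×ˢ range (μ (r + 1) + 1)).image
      fun p => Function.update p.1 (r + 1) p.2

lemma coe_omegaFinset (μ : ℕ → ℕ) (r : ℕ) : (omegaFinset μ r : Set (ℕ → ℕ)) = OmegaLe r μ := by
  induction r with
  | zero =>
    ext d
    simp only [omegaFinset, Finset.coe_singleton, Set.mem_singleton_iff, OmegaLe, Set.mem_ofPred_eq,
      Supported]
    constructor
    · rintro rfl
      simp
    · rintro ⟨h, -⟩
      funext j
      exact h j (by omega)
  | succ r ih =>
    have hmem (e : ℕ → ℕ) : e ∈ omegaFinset μ r ↔ e ∈ OmegaLe r μ := by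
      rw [← ih, Finset.mem_coe]
    ext d
    simp only [omegaFinset, Finset.mem_coe, Finset.mem_image, Finset.mem_product, hmem,
      Finset.mem_range, Prod.exists]
    constructor
    · rintro ⟨e, x, ⟨⟨hsupp, hle⟩, hx⟩, rfl⟩
      refine ⟨fun j hj => ?_, fun i h1 hi => ?_⟩
      · rw [Function.update_of_ne (by omega)]
        exact hsupp j (by omega)
      · rcases eq_or_ne i (r + 1) with rfl | hne
        · rw [Function.update_self]
          omega
        · rw [Function.update_of_ne hne]
          exact hle i h1 (by omega)
    · rintro ⟨hsupp, hle⟩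
      refine ⟨Function.update d (r + 1) 0, d (r + 1), ⟨⟨fun j hj => ?_, fun i h1 hi => ?_⟩, ?_⟩, ?_⟩
      · rcases eq_or_ne j (r + 1) with rfl | hne
        · rw [Function.update_self]
        · rw [Function.update_of_ne hne]
          exact hsupp j (by omega)
      · rw [Function.update_of_ne (by omega)]
        exact hle i h1 (by omega)
      · have := hle (r + 1) (by omega) le_rfl
        omega
      · simp

lemma apply_eq_zero_of_mem_omegaFinset {μ d : ℕ → ℕ} {r : ℕ} (hd : d ∈ omegaFinset μ r) :
    d (r + 1) = 0 := by
  rw [← Finset.mem_coe, coe_omegaFinset] at hd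
  exact hd.1 _ (Or.inr (Nat.lt_succ_self r))

lemma sum_omegaFinset_succ (μ : ℕ → ℕ) (r : ℕ) (F : (ℕ → ℕ) → RatFunc ℚ) :
    ∑ d ∈ omegaFinset μ (r + 1), F d =
      ∑ d ∈ omegaFinset μ r, ∑ x ∈ range (μ (r + 1) + 1), F (Function.update d (r + 1) x) := by
  rw [omegaFinset, Finset.sum_image, Finset.sum_product]
  rintro ⟨d, x⟩ hd ⟨e, y⟩ he h
  simp only [Finset.coe_product, Set.mem_prod, Finset.mem_coe] at hd he
  have hval (j : ℕ) := congrFun h j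
  refine Prod.ext (funext fun j => ?_) (by simpa using hval (r + 1))
  rcases eq_or_ne j (r + 1) with rfl | hne
  · exact (apply_eq_zero_of_mem_omegaFinset hd.1).trans
      (apply_eq_zero_of_mem_omegaFinset he.1).symm
  · simpa [Function.update_of_ne hne] using hval j

lemma coordWeight_zero {m : ℕ} (hm : 1 ≤ m) : coordWeight m 0 = 1 := by
  simp [coordWeight, decorationValue, show 0 ≠ m by omega]

lemma sum_coordWeight_range (m n : ℕ) (hn : n < m) :
    ∑ x ∈ range (n + 1), coordWeight m x = q ^ n := by
  induction n with
  | zero => simp [coordWeight_zero (show 1 ≤ m by omega)]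
  | succ n ih =>
    rw [Finset.sum_range_succ, ih (by omega), coordWeight, decorationValue, if_neg (by omega),
      if_neg (by omega), pow_succ]
    field_simp [q_ne_zero]
    ring

lemma sum_coordWeight {m : ℕ} (hm : 1 ≤ m) : ∑ x ∈ range (m + 1), coordWeight m x = 0 := by
  obtain ⟨n, rfl⟩ : ∃ n, m = n + 1 := ⟨m - 1, by omega⟩
  rw [Finset.sum_range_succ, sum_coordWeight_range _ _ (Nat.lt_succ_self n), coordWeight,
    decorationValue, if_pos rfl, if_neg (by omega), pow_succ]
  field_simp [q_ne_zero]
  ring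

/-- Summing out one coordinate against the decoration linking it to the next one gives `q⁻¹`,
whether or not the next entry is boxed. -/
lemma sum_coordWeight_mul_decorationValue {m : ℕ} (hm : 1 ≤ m) (boxed : Prop) :
    ∑ x ∈ range (m + 1), coordWeight m x * decorationValue boxed (x = 0) = q⁻¹ := by
  have hsum := sum_coordWeight hm
  rw [Finset.sum_range_succ', coordWeight_zero hm] at hsum
  have hconst : ∀ x ∈ range m, coordWeight m (x + 1) * decorationValue boxed (x + 1 = 0) =
      coordWeight m (x + 1) * decorationValue boxed False := by
    simp
  rw [Finset.sum_range_succ', Finset.sum_congr rfl hconst, ← Finset.sum_mul, coordWeight_zero hm,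
    eq_neg_of_add_eq_zero_left hsum]
  by_cases h : boxed <;> simp [decorationValue, h]

/-- The last coordinate decouples from the previous ones, which contribute a power of `q⁻¹`. -/
lemma sum_summand_mul (μ : ℕ → ℕ) (r : ℕ) (hμ : ∀ i, 1 ≤ i → i ≤ r → 1 ≤ μ i)
    (h : ℕ → RatFunc ℚ) :
    ∑ d ∈ omegaFinset μ (r + 1), summand (r + 1) μ d * h (d (r + 1)) =
      q⁻¹ ^ r * ∑ x ∈ range (μ (r + 1) + 1), coordWeight (μ (r + 1)) x * h x := by
  induction r generalizing h with
  | zero =>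
    rw [sum_omegaFinset_succ]
    simp [omegaFinset, summand_one]
  | succ r ih =>
    have hterm (d : ℕ → ℕ) (x : ℕ) :
        summand (r + 2) μ (Function.update d (r + 2) x) * h (Function.update d (r + 2) x (r + 2)) =
          coordWeight (μ (r + 2)) x * h x *
            (summand (r + 1) μ d * decorationValue (x = μ (r + 2)) (d (r + 1) = 0)) := by
      rw [summand_succ_succ, summand_congr r μ (e := d)
        fun i hi => Function.update_of_ne (by omega) _ _, Function.update_self,
        Function.update_of_ne (by omega)]
      ring
    rw [sum_omegaFinset_succ, Finset.sum_comm, Finset.mul_sum]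
    refine Finset.sum_congr rfl fun x _ => ?_
    simp only [hterm]
    rw [← Finset.mul_sum, ih (fun i h1 hi => hμ i h1 (by omega))
      fun y => decorationValue (x = μ (r + 2)) (y = 0),
      sum_coordWeight_mul_decorationValue (hμ (r + 1) (by omega) le_rfl)]
    ring

/-- If `s = μ` is the maximal totally resonant tuple, so that `Ω(s) = Ω^≤(μ)`, then
`Σ_{t ∈ Ω(s)} G_Δ(t) q^{k_A(t)} = 0` in `ℚ(q)`. -/
theorem stmt5 (r : ℕ) (hr : 1 ≤ r) (μ : ℕ → ℕ)
    (hμ : ∀ i, 1 ≤ i → i ≤ r → 1 ≤ μ i) :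
    ∑ᶠ t ∈ OmegaLe r μ, GDelta r μ t * q ^ kA r t = 0 := by
  obtain ⟨n, rfl⟩ : ∃ n, r = n + 1 := ⟨r - 1, by omega⟩
  rw [← coe_omegaFinset, finsum_mem_coe_finset]
  have hsum := sum_summand_mul μ n (fun i h1 hi => hμ i h1 (by omega)) fun _ => 1
  simpa only [summand, mul_one, sum_coordWeight (hμ (n + 1) hr le_rfl), mul_zero] using hsum

end Stmt5
end
end

section
/- Let r ≥ 1, μ ∈ ℤ^r with all μ_i ≥ 1, and let q be an indeterminate. Let s = (b₁,…,b_r) ∈ Ω^≤(μ) be non-maximal (s ≠ μ) and let i_□ = i_□(s) = max{i : b_i < μ_i}. Then in ℚ(q): Σ_{t ∈ Ω(s)} G_Δ(t) q^{k_A(t)} = q^{k_A(s) − (r − i_□)} · G_Δ(s_{i_□}) · c, where c = (1 − q^{−1})^{−1} if b_{i_□} > 0 and c = 1 if b_{i_□} = 0, and s_{i_□} = (b₁,…,b_{i_□}) is regarded as a totally resonant tuple of rank i_□ relative to (μ₁,…,μ_{i_□}) with G_Δ computed accordingly. -/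
open Finset
open scoped Classical

noncomputable section

namespace Stmt6

/-- The indeterminate `q`, in the field `ℚ(q)` of rational functions. -/
def q : RatFunc ℚ := RatFunc.X

/-- The `j`-th entry (1-based) of the `(2r−1)`-tuple `(d₁,…,d_{r−1},d_r,d_{r−1},…,d₁)`. -/
def Dd (r : ℕ) (d : ℕ → ℕ) (j : ℕ) : ℕ := if j ≤ r then d j else d (2 * r - j)

def Circled (r : ℕ) (d : ℕ → ℕ) (i : ℕ) : Prop := Dd r d i = 0

def Boxed (r : ℕ) (μ d : ℕ → ℕ) (i : ℕ) : Prop :=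
  if i ≤ r then d i = μ i
  else if i = r + 1 then d r = μ r
  else d (2 * r - i + 1) = μ (2 * r - i + 1)

/-- `γ(𝔠ᵢ)`. -/
def gam (r : ℕ) (μ d : ℕ → ℕ) (i : ℕ) : RatFunc ℚ :=
  if Boxed r μ d i then (if Circled r d i then 0 else -q⁻¹)
  else (if Circled r d i then 1 else 1 - q⁻¹)

/-- `G_Δ(t)` for a totally resonant tuple of rank `r` relative to `(μ₁,…,μ_r)`. -/
def GDelta (r : ℕ) (μ d : ℕ → ℕ) : RatFunc ℚ :=
  ∏ i ∈ Finset.Icc 1 (2 * r - 1), gam r μ d i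

def kA (r : ℕ) (d : ℕ → ℕ) : ℕ := ∑ i ∈ Finset.Icc 1 r, d i

def Supported (r : ℕ) (d : ℕ → ℕ) : Prop := ∀ j, (j = 0 ∨ r < j) → d j = 0

def OmegaLe (r : ℕ) (μ : ℕ → ℕ) : Set (ℕ → ℕ) :=
  {d | Supported r d ∧ ∀ i, 1 ≤ i → i ≤ r → d i ≤ μ i}

/-- `Ω(s)` for a non-maximal `s` with distinguished index `iB = i_□(s)`:
`{x ∈ Ω^≤(μ) : xᵢ = sᵢ for i < i_□, xᵢ ≤ sᵢ for i ≥ i_□}`. -/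
def OmegaS (r : ℕ) (μ b : ℕ → ℕ) (iB : ℕ) : Set (ℕ → ℕ) :=
  {x ∈ OmegaLe r μ |
    (∀ i, 1 ≤ i → i < iB → x i = b i) ∧ ∀ i, iB ≤ i → i ≤ r → x i ≤ b i}

theorem q_ne_zero : q ≠ 0 := RatFunc.X_ne_zero

theorem q_ne_one : q ≠ 1 := by
  intro h
  have h' : algebraMap (Polynomial ℚ) (RatFunc ℚ) Polynomial.X =
      algebraMap (Polynomial ℚ) (RatFunc ℚ) 1 := by
    rw [RatFunc.algebraMap_X, map_one]
    exact h
  simpa using congrArg (Polynomial.eval 0) (RatFunc.algebraMap_injective ℚ h')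

theorem one_sub_q_inv_ne_zero : 1 - q⁻¹ ≠ 0 := by
  rw [sub_ne_zero]
  exact fun h => q_ne_one (inv_eq_one.mp h.symm)

/-- The weight of a part that is boxed iff `B` and circled iff `C`. -/
def weight (B C : Prop) : RatFunc ℚ :=
  if B then (if C then 0 else -q⁻¹) else (if C then 1 else 1 - q⁻¹)

theorem weight_of_not_left {B : Prop} (C : Prop) (hB : ¬B) :
    weight B C = if C then 1 else 1 - q⁻¹ := if_neg hB

/-- `G_Δ` with the parts paired according to the entry that circles them. -/
theorem GDelta_eq_prod {r : ℕ} (hr : 1 ≤ r) (μ d : ℕ → ℕ) :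
    GDelta r μ d =
      (∏ i ∈ Finset.Ico 1 r, weight (d i = μ i) (d i = 0) * weight (d (i + 1) = μ (i + 1)) (d i = 0))
        * weight (d r = μ r) (d r = 0) := by
  have hIcc : Finset.Icc 1 (2 * r - 1) = Finset.Ico 1 (2 * r) := by
    ext i
    simp only [Finset.mem_Icc, Finset.mem_Ico]
    omega
  have hlow : ∏ i ∈ Finset.Ico 1 (r + 1), gam r μ d i =
      ∏ i ∈ Finset.Ico 1 (r + 1), weight (d i = μ i) (d i = 0) := by
    refine Finset.prod_congr rfl fun i hi => ?_
    have hir : i ≤ r := by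
      have := (Finset.mem_Ico.mp hi).2
      omega
    change weight (Boxed r μ d i) (Circled r d i) = _
    simp only [Boxed, Circled, Dd, if_pos hir]
  have hhigh : ∏ i ∈ Finset.Ico (r + 1) (2 * r), gam r μ d i =
      ∏ i ∈ Finset.Ico 1 r, weight (d (i + 1) = μ (i + 1)) (d i = 0) := by
    refine Finset.prod_nbij' (fun i => 2 * r - i) (fun i => 2 * r - i) ?_ ?_ ?_ ?_ ?_
    any_goals
      intro i hi
      simp only [Finset.mem_Ico] at hi ⊢
      omega
    intro i hi
    simp only [Finset.mem_Ico] at hi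
    have hir : ¬i ≤ r := by omega
    change weight (Boxed r μ d i) (Circled r d i) = _
    simp only [Boxed, Circled, Dd, if_neg hir]
    split_ifs with h
    · subst h
      rw [show 2 * r - (r + 1) + 1 = r by omega]
    · rfl
  rw [GDelta, hIcc, ← Finset.prod_Ico_consecutive _ (by omega : 1 ≤ r + 1) (by omega : r + 1 ≤ 2 * r),
    hlow, hhigh, Finset.prod_Ico_succ_top hr, Finset.prod_mul_distrib]
  ring

theorem GDelta_succ {n : ℕ} (hn : 1 ≤ n) (μ d : ℕ → ℕ) :
    GDelta (n + 1) μ d = GDelta n μ d *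
      (weight (d (n + 1) = μ (n + 1)) (d n = 0) *
        weight (d (n + 1) = μ (n + 1)) (d (n + 1) = 0)) := by
  rw [GDelta_eq_prod (by omega), GDelta_eq_prod hn, Finset.prod_Ico_succ_top hn]
  ring

theorem GDelta_congr {r : ℕ} (hr : 1 ≤ r) (μ : ℕ → ℕ) {d e : ℕ → ℕ}
    (h : ∀ i, 1 ≤ i → i ≤ r → d i = e i) : GDelta r μ d = GDelta r μ e := by
  rw [GDelta_eq_prod hr, GDelta_eq_prod hr, h r hr le_rfl]
  congr 1
  refine Finset.prod_congr rfl fun i hi => ?_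
  rw [Finset.mem_Ico] at hi
  rw [h i hi.1 hi.2.le, h (i + 1) (by omega) hi.2]

theorem kA_succ (n : ℕ) (d : ℕ → ℕ) : kA (n + 1) d = kA n d + d (n + 1) :=
  Finset.sum_Icc_succ_top (by omega) _

theorem kA_congr {r : ℕ} {d e : ℕ → ℕ} (h : ∀ i, 1 ≤ i → i ≤ r → d i = e i) :
    kA r d = kA r e :=
  Finset.sum_congr rfl fun i hi => h i (Finset.mem_Icc.mp hi).1 (Finset.mem_Icc.mp hi).2

theorem sum_ite_mul_q_pow (n : ℕ) :
    ∑ v ∈ Finset.range (n + 1), (if v = 0 then (1 : RatFunc ℚ) else 1 - q⁻¹) * q ^ v = q ^ n := by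
  induction n with
  | zero => simp
  | succ n ih =>
    have := q_ne_zero
    rw [Finset.sum_range_succ, ih, if_neg n.succ_ne_zero]
    field_simp
    ring

/-- Summing over an entry bounded by `n + 1` gives `q ^ n`, whether or not the preceding entry
vanishes. -/
theorem sum_weight_mul_weight_mul_q_pow (C : Prop) (n : ℕ) :
    ∑ v ∈ Finset.range (n + 2), weight (v = n + 1) C * weight (v = n + 1) (v = 0) * q ^ v
      = q ^ n := by
  have hlow : ∑ v ∈ Finset.range (n + 1),
      weight (v = n + 1) C * weight (v = n + 1) (v = 0) * q ^ v =
        (if C then 1 else 1 - q⁻¹) * q ^ n := by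
    rw [← sum_ite_mul_q_pow n, Finset.mul_sum]
    refine Finset.sum_congr rfl fun v hv => ?_
    have hv' : v ≠ n + 1 := (Finset.mem_range.mp hv).ne
    rw [weight_of_not_left _ hv', weight_of_not_left _ hv', mul_assoc]
    congr
  have := q_ne_zero
  rw [Finset.sum_range_succ, hlow]
  by_cases hC : C
  · simp [weight, hC]
  · simp only [weight, hC, if_true, if_false, n.succ_ne_zero]
    field_simp
    ring

/-- `Ω(s)` in rank `n + 1` is obtained from rank `n` by adjoining a last entry. -/
theorem OmegaS_succ {n iB : ℕ} (μ b : ℕ → ℕ) (hn : iB ≤ n) (hb : b (n + 1) ≤ μ (n + 1)) :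
    OmegaS (n + 1) μ b iB =
      (fun p : (ℕ → ℕ) × ℕ => Function.update p.1 (n + 1) p.2) ''
        (OmegaS n μ b iB ×ˢ (Finset.range (b (n + 1) + 1) : Set ℕ)) := by
  ext x
  simp only [OmegaS, OmegaLe, Supported, Set.mem_ofPred_eq, Set.mem_image, Set.mem_prod, Prod.exists,
    Finset.coe_range, Set.mem_Iio]
  constructor
  · rintro ⟨⟨hs, hle⟩, heq, hx⟩
    refine ⟨Function.update x (n + 1) 0, x (n + 1), ⟨⟨⟨fun j hj => ?_, fun i h1 h2 => ?_⟩,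
      fun i h1 h2 => ?_, fun i h1 h2 => ?_⟩, ?_⟩, by simp⟩
    · by_cases h : j = n + 1
      · simp [h]
      · rw [Function.update_of_ne h]
        exact hs j (by omega)
    · rw [Function.update_of_ne (by omega)]
      exact hle i h1 (by omega)
    · rw [Function.update_of_ne (by omega)]
      exact heq i h1 h2
    · rw [Function.update_of_ne (by omega)]
      exact hx i h1 (by omega)
    · exact Nat.lt_succ_of_le (hx (n + 1) (by omega) le_rfl)
  · rintro ⟨y, v, ⟨⟨⟨hs, hle⟩, heq, hy⟩, hv⟩, rfl⟩
    refine ⟨⟨fun j hj => ?_, fun i h1 h2 => ?_⟩, fun i h1 h2 => ?_, fun i h1 h2 => ?_⟩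
    · rw [Function.update_of_ne (by omega)]
      exact hs j (by omega)
    · by_cases h : i = n + 1
      · subst h
        rw [Function.update_self]
        omega
      · rw [Function.update_of_ne h]
        exact hle i h1 (by omega)
    · rw [Function.update_of_ne (by omega)]
      exact heq i h1 h2
    · by_cases h : i = n + 1
      · subst h
        rw [Function.update_self]
        omega
      · rw [Function.update_of_ne h]
        exact hy i h1 (by omega)

theorem injOn_update_OmegaS (n iB : ℕ) (μ b : ℕ → ℕ) (s : Set ℕ) :
    Set.InjOn (fun p : (ℕ → ℕ) × ℕ => Function.update p.1 (n + 1) p.2)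
      (OmegaS n μ b iB ×ˢ s) := by
  rintro ⟨x, v⟩ hx ⟨y, w⟩ hy h
  have h' : ∀ j, Function.update x (n + 1) v j = Function.update y (n + 1) w j := congrFun h
  refine Prod.ext (funext fun j => ?_) (by simpa using h' (n + 1))
  by_cases hj : j = n + 1
  · exact (hx.1.1.1 j (by omega)).trans (hy.1.1.1 j (by omega)).symm
  · simpa [Function.update_of_ne hj] using h' j

/-- In `Ω(s)` for rank `i_□` only the last entry varies. -/
theorem OmegaS_self {k : ℕ} (hk : 1 ≤ k) (μ b : ℕ → ℕ) (hb : ∀ i, 1 ≤ i → i ≤ k → b i ≤ μ i) :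
    OmegaS k μ b k =
      (fun v => Function.update (fun i => if 1 ≤ i ∧ i < k then b i else 0) k v) ''
        (Finset.range (b k + 1) : Set ℕ) := by
  ext x
  simp only [OmegaS, OmegaLe, Supported, Set.mem_ofPred_eq, Set.mem_image, Finset.coe_range,
    Set.mem_Iio]
  constructor
  · rintro ⟨⟨hs, -⟩, heq, hx⟩
    refine ⟨x k, Nat.lt_succ_of_le (hx k le_rfl le_rfl), funext fun j => ?_⟩
    by_cases h : j = k
    · simp [h]
    · rw [Function.update_of_ne h]
      split_ifs with hj
      · exact (heq j hj.1 hj.2).symm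
      · exact (hs j (by omega)).symm
  · rintro ⟨v, hv, rfl⟩
    refine ⟨⟨fun j hj => ?_, fun i h1 h2 => ?_⟩, fun i h1 h2 => ?_, fun i h1 h2 => ?_⟩
    · rw [Function.update_of_ne (by omega), if_neg (by omega)]
    · by_cases h : i = k
      · subst h
        rw [Function.update_self]
        exact (Nat.le_of_lt_succ hv).trans (hb i h1 le_rfl)
      · rw [Function.update_of_ne h, if_pos (by omega)]
        exact hb i h1 h2
    · rw [Function.update_of_ne (by omega), if_pos (by omega)]
    · obtain rfl : i = k := by omega
      rw [Function.update_self]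
      omega

theorem finsum_OmegaS_self {k : ℕ} (hk : 1 ≤ k) (μ b : ℕ → ℕ)
    (hb : ∀ i, 1 ≤ i → i ≤ k → b i ≤ μ i) (hbk : b k < μ k) :
    ∑ᶠ t ∈ OmegaS k μ b k, GDelta k μ t * q ^ kA k t =
      q ^ kA k b * GDelta k μ b * (if 0 < b k then (1 - q⁻¹)⁻¹ else 1) := by
  have hinj : Function.Injective
      (fun v => Function.update (fun i => if 1 ≤ i ∧ i < k then b i else 0) k v) :=
    fun v w h => by simpa using congrFun h k
  rw [OmegaS_self hk μ b hb, finsum_mem_image hinj.injOn, finsum_mem_coe_finset]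
  obtain ⟨n, rfl⟩ : ∃ n, k = n + 1 := ⟨k - 1, by omega⟩
  set P := ∏ i ∈ Finset.Ico 1 (n + 1),
    weight (b i = μ i) (b i = 0) * weight (b (i + 1) = μ (i + 1)) (b i = 0)
    with hP
  have hG : ∀ d : ℕ → ℕ, (∀ i, 1 ≤ i → i ≤ n → d i = b i) → d (n + 1) < μ (n + 1) →
      GDelta (n + 1) μ d = P * (if d (n + 1) = 0 then 1 else 1 - q⁻¹) := by
    intro d hd hdn
    rw [GDelta_eq_prod hk, weight_of_not_left _ hdn.ne, hP]
    congr 1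
    swap
    · congr
    refine Finset.prod_congr rfl fun i hi => ?_
    rw [Finset.mem_Ico] at hi
    rw [hd i hi.1 (by omega)]
    by_cases h : i = n
    · subst h
      rw [weight_of_not_left _ hdn.ne, weight_of_not_left _ hbk.ne]
    · rw [hd (i + 1) (by omega) (by omega)]
  have hterm : ∀ v ∈ Finset.range (b (n + 1) + 1),
      GDelta (n + 1) μ (Function.update (fun i => if 1 ≤ i ∧ i < n + 1 then b i else 0) (n + 1) v) *
        q ^ kA (n + 1)
          (Function.update (fun i => if 1 ≤ i ∧ i < n + 1 then b i else 0) (n + 1) v) =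
      P * q ^ kA n b * ((if v = 0 then 1 else 1 - q⁻¹) * q ^ v) := by
    intro v hv
    have hv' := Finset.mem_range.mp hv
    have hd : ∀ i, 1 ≤ i → i ≤ n →
        Function.update (fun i => if 1 ≤ i ∧ i < n + 1 then b i else 0) (n + 1) v i = b i := by
      intro i h1 h2
      rw [Function.update_of_ne (by omega), if_pos (by omega)]
    rw [hG _ hd (by rw [Function.update_self]; omega), kA_succ, kA_congr hd, Function.update_self,
      pow_add]
    ring
  rw [Finset.sum_congr rfl hterm, ← Finset.mul_sum, sum_ite_mul_q_pow,
    hG b (fun _ _ _ => rfl) hbk, kA_succ, pow_add]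
  have := one_sub_q_inv_ne_zero
  rcases Nat.eq_zero_or_pos (b (n + 1)) with h | h
  · simp [h, mul_comm]
  · rw [if_pos h, if_neg h.ne', mul_assoc _ (P * _), mul_assoc P (1 - q⁻¹), mul_inv_cancel₀ this]
    ring

theorem finite_OmegaS {k : ℕ} (hk : 1 ≤ k) (μ b : ℕ → ℕ) {n : ℕ} (hkn : k ≤ n)
    (hb : ∀ i, 1 ≤ i → i ≤ n → b i ≤ μ i) : (OmegaS n μ b k).Finite := by
  induction n, hkn using Nat.le_induction with
  | base =>
    rw [OmegaS_self hk μ b hb]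
    exact (Finset.finite_toSet _).image _
  | succ n hkn ih =>
    rw [OmegaS_succ μ b hkn (hb _ (by omega) le_rfl)]
    exact ((ih fun i h1 h2 => hb i h1 (by omega)).prod (Finset.finite_toSet _)).image _

theorem finsum_OmegaS_succ {k n m : ℕ} (hk : 1 ≤ k) (μ b : ℕ → ℕ) (hkn : k ≤ n)
    (hb : ∀ i, 1 ≤ i → i ≤ n → b i ≤ μ i) (hbm : b (n + 1) = m + 1) (hμm : μ (n + 1) = m + 1) :
    ∑ᶠ t ∈ OmegaS (n + 1) μ b k, GDelta (n + 1) μ t * q ^ kA (n + 1) t =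
      q ^ m * ∑ᶠ t ∈ OmegaS n μ b k, GDelta n μ t * q ^ kA n t := by
  have hfin := finite_OmegaS hk μ b hkn hb
  rw [OmegaS_succ μ b hkn (by omega), finsum_mem_image (injOn_update_OmegaS _ _ _ _ _)]
  obtain ⟨S, hS⟩ := hfin.exists_finset_coe
  rw [← hS, ← Finset.coe_product, finsum_mem_coe_finset, finsum_mem_coe_finset,
    Finset.sum_product, Finset.mul_sum]
  refine Finset.sum_congr rfl fun x _ => ?_
  rw [hbm, ← sum_weight_mul_weight_mul_q_pow (x n = 0) m, Finset.sum_mul]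
  refine Finset.sum_congr rfl fun v _ => ?_
  have hx : ∀ i, 1 ≤ i → i ≤ n → Function.update x (n + 1) v i = x i :=
    fun i _ _ => Function.update_of_ne (by omega) _ _
  rw [GDelta_succ (by omega), GDelta_congr (by omega) μ hx, kA_succ, kA_congr hx,
    Function.update_self, hx n (by omega) le_rfl, hμm, pow_add]
  ring

/-- For a non-maximal `s ∈ Ω^≤(μ)` with `i_□ = max{i : bᵢ < μᵢ}`,
`Σ_{t ∈ Ω(s)} G_Δ(t) q^{k_A(t)} = q^{k_A(s) − (r − i_□)} G_Δ(s_{i_□}) · c`, where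
`c = (1 − q⁻¹)⁻¹` if `b_{i_□} > 0` and `c = 1` if `b_{i_□} = 0`; here `s_{i_□}` is the
truncation of `s`, regarded as a totally resonant tuple of rank `i_□` relative to
`(μ₁,…,μ_{i_□})`. -/
theorem stmt6 (r : ℕ) (hr : 1 ≤ r) (μ : ℕ → ℕ)
    (hμ : ∀ i, 1 ≤ i → i ≤ r → 1 ≤ μ i)
    (b : ℕ → ℕ) (hb : b ∈ OmegaLe r μ)
    (hnonmax : ∃ i, 1 ≤ i ∧ i ≤ r ∧ b i ≠ μ i)
    (iB : ℕ) (hiB1 : 1 ≤ iB) (hiB2 : iB ≤ r) (hiB3 : b iB < μ iB)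
    (hiBmax : ∀ i, 1 ≤ i → i ≤ r → b i < μ i → i ≤ iB) :
    ∑ᶠ t ∈ OmegaS r μ b iB, GDelta r μ t * q ^ kA r t
      = q ^ ((kA r b : ℤ) - ((r : ℤ) - (iB : ℤ))) * GDelta iB μ b *
          (if 0 < b iB then (1 - q⁻¹)⁻¹ else 1) := by
  have hle : ∀ i, 1 ≤ i → i ≤ r → b i ≤ μ i := hb.2
  have hfull : ∀ i, iB < i → i ≤ r → b i = μ i := fun i h1 h2 =>
    (hle i (by omega) h2).eq_of_not_lt fun h => absurd (hiBmax i (by omega) h2 h) (by omega)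
  clear hr hnonmax hiBmax hb
  induction r, hiB2 using Nat.le_induction with
  | base =>
    rw [finsum_OmegaS_self hiB1 μ b hle hiB3, sub_self, sub_zero, zpow_natCast]
  | succ n hn ih =>
    obtain ⟨m, hm⟩ : ∃ m, μ (n + 1) = m + 1 :=
      ⟨μ (n + 1) - 1, by have := hμ (n + 1) (by omega) le_rfl; omega⟩
    have hbm : b (n + 1) = m + 1 := (hfull _ (by omega) le_rfl).trans hm
    rw [finsum_OmegaS_succ hiB1 μ b hn (fun i h1 h2 => hle i h1 (by omega)) hbm hm,
      ih (fun i h1 h2 => hμ i h1 (by omega)) (fun i h1 h2 => hle i h1 (by omega))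
        (fun i h1 h2 => hfull i h1 (by omega)), ← mul_assoc, ← mul_assoc, ← zpow_natCast,
      ← zpow_add₀ q_ne_zero, kA_succ, hbm]
    congr 3
    push_cast
    ring

end Stmt6
end
end
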